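/- Let P be a nonzero element of the polynomial ring Q̄[X,Y,Z] without multiple irreducible factors (i.e., P is squarefree). Then every zero of ψ_P in H is simple: if a ∈ H and ψ_P(a) = 0, then the derivative of ψ_P at a is nonzero. -/

import Mathlib

/-- The normalized Eisenstein series of even weight `k ≥ 4` (the definition also
makes sense for `k = 2`, giving the quasi-modular Eisenstein series `E₂`), defined by
its Fourier expansion `E_k(z) = 1 - (2k/B_k) ∑_{n≥1} σ_{k-1}(n) qⁿ`, `q = exp(2πiz)`. -/
noncomputable def Ek (k : ℕ) (z : ℂ) : ℂ :=
  1 - (2 * (k : ℂ) / ((bernoulli k : ℚ) : ℂ)) *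
    ∑' n : ℕ, (∑ d ∈ n.divisors, (d : ℂ) ^ (k - 1)) * Complex.exp (2 * Real.pi * Complex.I * z) ^ n

/-- `ψ_P = P(E₂, E₄, E₆)` as a function on the upper half-plane, for a polynomial `P`
in three variables. -/
noncomputable def psi (P : MvPolynomial (Fin 3) ℂ) (z : ℂ) : ℂ :=
  MvPolynomial.eval (![Ek 2 z, Ek 4 z, Ek 6 z]) P

open Complex

/-- The nome `q = exp(2πiz)`. -/
noncomputable def nome (z : ℂ) : ℂ := exp (2 * Real.pi * I * z)

/-- The integer Fourier coefficients of `E₂, E₄, E₆`. -/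
def eisCoeff (i : Fin 3) (n : ℕ) : ℤ :=
  if n = 0 then 1 else (![-24, 240, -504] i : ℤ) * ∑ d ∈ n.divisors, (d : ℤ) ^ (![1, 3, 5] i : ℕ)

/-- The vector `(E₂, E₄, E₆)`. -/
noncomputable def eisVec (z : ℂ) : Fin 3 → ℂ := ![Ek 2 z, Ek 4 z, Ek 6 z]

lemma norm_nome (z : ℂ) : ‖nome z‖ = Real.exp (-(2 * Real.pi * z.im)) := by
  simp [nome, Complex.norm_exp]

lemma norm_nome_lt_one {z : ℂ} (hz : 0 < z.im) : ‖nome z‖ < 1 := by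
  rw [norm_nome, Real.exp_lt_one_iff]
  have := Real.pi_pos
  nlinarith [mul_pos this hz]

lemma abs_eisCoeff_le (i : Fin 3) (n : ℕ) :
    |(eisCoeff i n : ℝ)| ≤ 362880 * ((n + 6).choose 6 : ℝ) := by
  have h1 : ((n : ℝ) + 1) ^ 6 ≤ 720 * ((n + 6).choose 6 : ℝ) := by
    have h := Nat.pow_succ_le_ascFactorial (n + 1) 6
    rw [Nat.ascFactorial_eq_factorial_mul_choose] at h
    have h' : (n + 1) ^ 6 ≤ 720 * (n + 6).choose 6 := by
      simpa [Nat.factorial] using h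
    exact_mod_cast h'
  have h2 : |(eisCoeff i n : ℝ)| ≤ 504 * ((n : ℝ) + 1) ^ 6 := by
    have hn : (1 : ℝ) ≤ (n : ℝ) + 1 := by linarith [Nat.cast_nonneg (α := ℝ) n]
    have hp := one_le_pow₀ hn (n := 6)
    unfold eisCoeff
    split_ifs with h
    · norm_num; linarith
    · have hsum : |((∑ d ∈ n.divisors, (d : ℤ) ^ (![1, 3, 5] i : ℕ) : ℤ) : ℝ)| ≤ ((n : ℝ) + 1) ^ 6 := by
        push_cast
        rw [abs_of_nonneg (by positivity)]
        calc _ ≤ ∑ d ∈ n.divisors, ((n : ℝ) + 1) ^ 5 := by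
              apply Finset.sum_le_sum
              intro d hd
              have hdn : (d : ℝ) ≤ n + 1 := by
                have := Nat.divisor_le hd
                have : (d : ℝ) ≤ n := by exact_mod_cast this
                linarith
              have hd1 : (0 : ℝ) ≤ d := by positivity
              calc (d : ℝ) ^ (![1, 3, 5] i : ℕ) ≤ (n + 1 : ℝ) ^ (![1, 3, 5] i : ℕ) := by gcongr
                _ ≤ _ := by
                  apply pow_le_pow_right₀ hn
                  fin_cases i <;> simp
          _ = n.divisors.card * ((n : ℝ) + 1) ^ 5 := by simp
          _ ≤ (n + 1) * ((n : ℝ) + 1) ^ 5 := by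
              gcongr
              have := Nat.card_divisors_le_self n
              have : (n.divisors.card : ℝ) ≤ n := by exact_mod_cast this
              linarith
          _ = _ := by ring
      push_cast at hsum ⊢
      rw [abs_mul]
      have : |((![-24, 240, -504] i : ℤ) : ℝ)| ≤ 504 := by
        fin_cases i <;> norm_num
      gcongr
  linarith

lemma summable_norm_eisCoeff (i : Fin 3) {r : ℝ} (hr0 : 0 ≤ r) (hr : r < 1) :
    Summable fun n ↦ |(eisCoeff i n : ℝ)| * r ^ n := by
  have h := (summable_choose_mul_geometric_of_norm_lt_one 6
    (r := r) (by rwa [Real.norm_of_nonneg hr0])).mul_left 362880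
  refine Summable.of_nonneg_of_le (fun n ↦ by positivity) (fun n ↦ ?_) h
  have := abs_eisCoeff_le i n
  calc _ ≤ (362880 * ((n + 6).choose 6 : ℝ)) * r ^ n := by gcongr
    _ = _ := by ring

lemma tsum_norm_eisCoeff_le (i : Fin 3) {r : ℝ} (hr0 : 0 ≤ r) (hr : r < 1) :
    ∑' n, |(eisCoeff i n : ℝ)| * r ^ n ≤ 362880 / (1 - r) ^ 7 := by
  have hr' : ‖r‖ < 1 := by rwa [Real.norm_of_nonneg hr0]
  have h := (summable_choose_mul_geometric_of_norm_lt_one 6 hr').mul_left 362880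
  calc _ ≤ ∑' n, 362880 * (((n + 6).choose 6 : ℝ) * r ^ n) := by
        refine (summable_norm_eisCoeff i hr0 hr).tsum_le_tsum (fun n ↦ ?_) h
        have := abs_eisCoeff_le i n
        calc _ ≤ (362880 * ((n + 6).choose 6 : ℝ)) * r ^ n := by gcongr
          _ = _ := by ring
    _ = _ := by
        rw [tsum_mul_left, tsum_choose_mul_geometric_of_norm_lt_one 6 hr']
        ring

lemma hasSum_eisVec (i : Fin 3) {z : ℂ} (hz : 0 < z.im) :
    HasSum (fun n ↦ (eisCoeff i n : ℂ) * nome z ^ n) (eisVec z i) := by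
  have hs : Summable fun n ↦ (eisCoeff i n : ℂ) * nome z ^ n := by
    apply Summable.of_norm
    convert summable_norm_eisCoeff i (norm_nonneg _) (norm_nome_lt_one hz) using 2 with n
    simp
  have key : ∀ (k : ℕ) (b : ℤ), b ≠ 0 → - (2 * (k : ℂ) / ((bernoulli k : ℚ) : ℂ)) = b →
      (∀ n, eisCoeff i n = if n = 0 then 1 else b * ∑ d ∈ n.divisors, (d : ℤ) ^ (k - 1)) →
      HasSum (fun n ↦ (eisCoeff i n : ℂ) * nome z ^ n) (Ek k z) := by
    intro k b hb0 hb hc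
    have e : (fun n ↦ (eisCoeff i n : ℂ) * nome z ^ n) = fun n : ℕ ↦ (if n = 0 then (1 : ℂ) else 0) +
        b * ((∑ d ∈ n.divisors, (d : ℂ) ^ (k - 1)) * nome z ^ n) := by
      ext n
      rw [hc]
      rcases eq_or_ne n 0 with rfl | hn
      · simp
      · simp [hn, mul_assoc]
    have h0 : HasSum (fun n : ℕ ↦ if n = 0 then (1 : ℂ) else 0) 1 := by
      simpa using hasSum_ite_eq (0 : ℕ) (1 : ℂ)
    have h1 : Summable fun n : ℕ ↦ (b : ℂ) * ((∑ d ∈ n.divisors, (d : ℂ) ^ (k - 1)) * nome z ^ n) := by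
      rw [e] at hs
      simpa using hs.sub h0.summable
    have h2 : Summable fun n : ℕ ↦ ((∑ d ∈ n.divisors, (d : ℂ) ^ (k - 1)) * nome z ^ n) := by
      rwa [summable_mul_left_iff (by exact_mod_cast hb0)] at h1
    rw [e]
    have h3 := h0.add (h2.hasSum.mul_left (b : ℂ))
    convert h3 using 1
    rw [Ek, ← hb, nome]
    ring
  fin_cases i
  · refine key 2 (-24) (by norm_num) ?_ (fun n ↦ by simp [eisCoeff])
    rw [bernoulli_two]; norm_num
  · refine key 4 240 (by norm_num) ?_ (fun n ↦ by simp [eisCoeff])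
    rw [show bernoulli 4 = -1/30 by decide +kernel]; norm_num
  · refine key 6 (-504) (by norm_num) ?_ (fun n ↦ by simp [eisCoeff])
    rw [show bernoulli 6 = 1/42 by decide +kernel]; norm_num

section Modular

open UpperHalfPlane hiding I
open ModularForm Filter EisensteinSeries MatrixGroups Derivative Manifold Topology

/-- The power series in the nome defining `E₂, E₄, E₆`. -/
noncomputable def eisDisc (i : Fin 3) (q : ℂ) : ℂ := ∑' n, (eisCoeff i n : ℂ) * q ^ n

lemma differentiableOn_eisDisc (i : Fin 3) : DifferentiableOn ℂ (eisDisc i) (Metric.ball 0 1) := by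
  intro x hx
  have hx1 : ‖x‖ < 1 := by simpa using hx
  obtain ⟨r, hr1, hr2⟩ := exists_between hx1
  have h := differentiableOn_tsum_of_summable_norm (F := fun n q ↦ (eisCoeff i n : ℂ) * q ^ n)
    (summable_norm_eisCoeff i ((norm_nonneg x).trans hr1.le) hr2)
    (fun n ↦ by fun_prop) (Metric.isOpen_ball (x := (0 : ℂ)) (ε := r)) (fun n q hq ↦ by
      have : ‖q‖ ≤ r := by simpa using (Metric.mem_ball.mp hq).le
      rw [norm_mul, norm_pow, Complex.norm_intCast]
      gcongr)
  exact (h.differentiableAt (Metric.isOpen_ball.mem_nhds (by simpa using hr1))).differentiableWithinAt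

lemma eisVec_eq_eisDisc (i : Fin 3) {z : ℂ} (hz : 0 < z.im) : eisVec z i = eisDisc i (nome z) :=
  (hasSum_eisVec i hz).tsum_eq.symm

lemma hasDerivAt_nome (z : ℂ) : HasDerivAt nome (2 * Real.pi * I * nome z) z := by
  have := ((hasDerivAt_id z).const_mul (2 * Real.pi * I)).cexp
  rw [mul_one] at this
  exact (mul_comm (nome z) _) ▸ this

lemma hasDerivAt_eisVec (i : Fin 3) {z : ℂ} (hz : 0 < z.im) :
    HasDerivAt (fun z ↦ eisVec z i) (deriv (eisDisc i) (nome z) * (2 * Real.pi * I * nome z)) z := by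
  have hd := ((differentiableOn_eisDisc i).differentiableAt
    (Metric.isOpen_ball.mem_nhds (by simpa using norm_nome_lt_one hz))).hasDerivAt
  refine (hd.comp z (hasDerivAt_nome z)).congr_of_eventuallyEq ?_
  filter_upwards [isOpen_upperHalfPlaneSet.mem_nhds hz] with w hw
  exact eisVec_eq_eisDisc i hw

/-- `E₂, E₄, E₆` as functions on the upper half plane. -/
noncomputable def eisUHP (i : Fin 3) (z : ℍ) : ℂ := eisVec z i

lemma hasDerivAt_eisUHP (i : Fin 3) (z : ℍ) : HasDerivAt (eisUHP i ∘ ofComplex)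
    (deriv (eisDisc i) (nome z) * (2 * Real.pi * I * nome z)) z := by
  refine (hasDerivAt_eisVec i z.im_pos).congr_of_eventuallyEq ?_
  filter_upwards [isOpen_upperHalfPlaneSet.mem_nhds z.im_pos] with w hw
  simp [eisUHP, ofComplex_apply_of_im_pos hw]

lemma mdifferentiable_eisUHP (i : Fin 3) : MDiff (eisUHP i) := fun z ↦
  mdifferentiableAt_iff.mpr (hasDerivAt_eisUHP i z).differentiableAt

lemma tendsto_nome_atImInfty : Tendsto (fun z : ℍ ↦ nome z) atImInfty (𝓝 0) := by
  have := qParam_tendsto_atImInfty (h := 1) one_pos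
  simpa [nome, Function.Periodic.qParam] using! this

lemma tendsto_eisUHP (i : Fin 3) : Tendsto (eisUHP i) atImInfty (𝓝 1) := by
  have h := ((differentiableOn_eisDisc i).differentiableAt
    (Metric.isOpen_ball.mem_nhds (by simp : (0 : ℂ) ∈ _))).continuousAt.tendsto
  have h0 : eisDisc i 0 = 1 := by
    rw [eisDisc, tsum_eq_single 0 (fun n hn ↦ by simp [hn])]
    simp [eisCoeff]
  rw [h0] at h
  exact (h.comp tendsto_nome_atImInfty).congr fun z ↦ (eisVec_eq_eisDisc i z.im_pos).symm

lemma tendsto_normalizedDeriv_eisUHP (i : Fin 3) : Tendsto (D (eisUHP i)) atImInfty (𝓝 0) := by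
  have h := (((differentiableOn_eisDisc i).deriv Metric.isOpen_ball).differentiableAt
    (Metric.isOpen_ball.mem_nhds (by simp : (0 : ℂ) ∈ _))).continuousAt.tendsto
  have h2 := (h.comp tendsto_nome_atImInfty).mul tendsto_nome_atImInfty
  rw [mul_zero] at h2
  refine h2.congr fun z ↦ ?_
  rw [normalizedDerivOfComplex, (hasDerivAt_eisUHP i z).deriv]
  have : (2 * Real.pi * I : ℂ) ≠ 0 := two_pi_I_ne_zero
  simp only [Function.comp_apply]
  field_simp

lemma eisUHP_zero : eisUHP 0 = E2 := by
  ext z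
  have h := hasSum_qExpansion_E2 (z := z)
  refine (hasSum_eisVec 0 z.im_pos).unique ?_
  convert h using 1
  ext m
  rcases eq_or_ne m 0 with rfl | hm
  · simp [eisCoeff]
  · simp [eisCoeff, hm, ArithmeticFunction.sigma_apply, nome]

lemma E_eq_Ek {k : ℕ} (hk : 3 ≤ k) (hk2 : Even k) (z : ℍ) : E hk z = Ek k z := by
  rw [q_expansion_bernoulli hk hk2, Ek]
  congr 2
  rw [tsum_pnat_eq_tsum_succ (f := fun n : ℕ ↦
    ((ArithmeticFunction.sigma (k - 1) n : ℕ) : ℂ) * cexp (2 * Real.pi * I * z) ^ (n : ℤ)),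
    tsum_eq_zero_add' (f := fun n : ℕ ↦
      (∑ d ∈ n.divisors, (d : ℂ) ^ (k - 1)) * cexp (2 * Real.pi * I * z) ^ n)]
  · simp [ArithmeticFunction.sigma_apply]
    norm_cast
  · have := (summable_nat_add_iff 1).mpr (summable_sigma_mul_cexp_pow (k := k) (by lia) z)
    simpa [ArithmeticFunction.sigma_apply] using this

lemma eisUHP_one : eisUHP 1 = E₄ := by
  ext z
  exact (E_eq_Ek (by norm_num) ⟨2, rfl⟩ z).symm

lemma eisUHP_two : eisUHP 2 = E₆ := by
  ext z
  exact (E_eq_Ek (by norm_num) ⟨3, rfl⟩ z).symm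

/-- A holomorphic slash-invariant function with a limit at infinity is a modular form. -/
noncomputable def modularFormOfTendsto {k : ℤ} (F : ℍ → ℂ) (hF : MDiff F)
    (hs : ∀ γ : SL(2, ℤ), F ∣[k] γ = F) {c : ℂ} (hc : Tendsto F atImInfty (𝓝 c)) :
    ModularForm 𝒮ℒ k where
  toFun := F
  slash_action_eq' := fun _ ⟨γ, hγ⟩ ↦ hγ ▸ hs γ
  holo' := hF
  bdd_at_cusps' {c} hc' := by
    rw [Subgroup.IsArithmetic.isCusp_iff_isCusp_SL2Z] at hc'
    rw [OnePoint.isBoundedAt_iff_forall_SL2Z hc']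
    intro γ _
    rw [hs γ, IsBoundedAtImInfty, BoundedAtFilter]
    exact hc.isBigO_one ℝ

lemma eq_smul_of_rank_eq_one {k : ℤ} (hk : Module.rank ℂ (ModularForm 𝒮ℒ k) = 1)
    {F G : ℍ → ℂ} (hF : MDiff F) (hG : MDiff G) (hFs : ∀ γ : SL(2, ℤ), F ∣[k] γ = F)
    (hGs : ∀ γ : SL(2, ℤ), G ∣[k] γ = G) {c : ℂ} (hFc : Tendsto F atImInfty (𝓝 c))
    (hGc : Tendsto G atImInfty (𝓝 1)) : F = c • G := by
  have h1 := Module.rank_eq_one_iff_finrank_eq_one.mp hk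
  have hG0 : modularFormOfTendsto G hG hGs hGc ≠ 0 := by
    intro h
    have : G = 0 := congrArg DFunLike.coe h
    rw [this] at hGc
    exact zero_ne_one (tendsto_nhds_unique (tendsto_const_nhds (x := (0 : ℂ))) hGc)
  obtain ⟨b, hb⟩ := (finrank_eq_one_iff_of_nonzero' _ hG0).mp h1 (modularFormOfTendsto F hF hFs hFc)
  have hb' : b • G = F := congrArg DFunLike.coe hb
  have : b = c := by
    refine tendsto_nhds_unique ?_ hFc
    rw [← hb']
    simpa using! hGc.const_mul b
  rw [← hb', this]

lemma E2_slash_apply (γ : SL(2, ℤ)) (z : ℍ) :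
    (E2 ∣[(2 : ℤ)] γ) z = E2 z - 6 * I / Real.pi * (γ 1 0 / denom γ z) := by
  have h := congrFun (E2_slash_action γ) z
  have hpi : (Real.pi : ℂ) ≠ 0 := by exact_mod_cast Real.pi_ne_zero
  rw [h]
  simp only [Pi.sub_apply, Pi.smul_apply, smul_eq_mul, D2, riemannZeta_two]
  congr 1
  field_simp

lemma normalizedDeriv_E2_slash (γ : SL(2, ℤ)) :
    (fun z ↦ D E2 z - 12⁻¹ * E2 z ^ 2) ∣[(4 : ℤ)] γ = fun z ↦ D E2 z - 12⁻¹ * E2 z ^ 2 := by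
  have hpi : (Real.pi : ℂ) ≠ 0 := by exact_mod_cast Real.pi_ne_zero
  ext z
  have h1 := congrFun (normalizedDerivOfComplex_SL_slash (k := 2) E2_mdifferentiable (γ := γ)) z
  have hden : denom γ z ≠ 0 := denom_ne_zero γ z
  have h2 : D (E2 ∣[(2 : ℤ)] γ) z =
      D E2 z + 6 * I / Real.pi * (2 * Real.pi * I)⁻¹ * (γ 1 0 / denom γ z) ^ 2 := by
    have hd : HasDerivAt ((E2 ∣[(2 : ℤ)] γ) ∘ ofComplex) (deriv (E2 ∘ ofComplex) z -
        6 * I / Real.pi * (γ 1 0 * (-(γ 1 0 : ℂ) / (denom γ z) ^ 2))) z := by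
      have hE : HasDerivAt (E2 ∘ ofComplex) (deriv (E2 ∘ ofComplex) z) z :=
        (mdifferentiableAt_iff.mp (E2_mdifferentiable z)).hasDerivAt
      have hdn : HasDerivAt (fun w : ℂ ↦ denom γ w) (γ 1 0 : ℂ) z := by
        have : (fun w : ℂ ↦ denom γ w) = fun w ↦ (γ 1 0 : ℂ) * w + γ 1 1 := by
          ext w; simp [denom]
        rw [this]
        simpa using ((hasDerivAt_id (z : ℂ)).const_mul (γ 1 0 : ℂ)).add_const (γ 1 1 : ℂ)
      refine (hE.sub (((hdn.inv hden).const_mul (γ 1 0 : ℂ)).const_mul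
        (6 * I / Real.pi : ℂ))).congr_of_eventuallyEq ?_
      filter_upwards [isOpen_upperHalfPlaneSet.mem_nhds z.im_pos] with w hw
      simp [E2_slash_apply, ofComplex_apply_of_im_pos hw, div_eq_mul_inv]
    rw [normalizedDerivOfComplex, hd.deriv, normalizedDerivOfComplex]
    field_simp
    ring
  have h3 := E2_slash_apply γ z
  rw [h2] at h1
  simp only [Pi.sub_apply, h3] at h1
  simp only [SL_slash_apply] at h1 h3 ⊢
  have e4 : (denom γ z : ℂ) ^ (-4 : ℤ) = ((denom γ z) ^ (-2 : ℤ)) ^ 2 := by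
    rw [← zpow_natCast, ← zpow_mul]; norm_num
  have e5 : (denom γ z : ℂ) ^ (-(2 + 2) : ℤ) = denom γ z ^ (-4 : ℤ) := by norm_num
  have h4 : E2 (γ • z) ^ 2 * denom γ z ^ (-4 : ℤ) =
      (E2 z - 6 * I / Real.pi * (γ 1 0 / denom γ z)) ^ 2 := by
    rw [← h3, e4]; ring
  have h5 : (D E2 (γ • z)) * denom γ z ^ (-4 : ℤ) = D E2 z +
      6 * I / Real.pi * (2 * Real.pi * I)⁻¹ * (γ 1 0 / denom γ z) ^ 2 +
      (2 : ℤ) * (2 * Real.pi * I)⁻¹ * (γ 1 0 / denom γ z) *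
        (E2 z - 6 * I / Real.pi * (γ 1 0 / denom γ z)) := by
    rw [← e5]
    linear_combination -h1
  rw [sub_mul, mul_assoc, h4, h5]
  generalize (γ 1 0 / denom γ z : ℂ) = x
  generalize E2 z = e
  push_cast
  field_simp
  linear_combination (24 * Real.pi * x * e - 72 * I * x ^ 2) * I_sq

lemma eisUHP_slash (γ : SL(2, ℤ)) :
    eisUHP 1 ∣[(4 : ℤ)] γ = eisUHP 1 ∧ eisUHP 2 ∣[(6 : ℤ)] γ = eisUHP 2 := by
  rw [eisUHP_one, eisUHP_two]
  exact ⟨E₄.slash_action_eq' _ ⟨γ, rfl⟩, E₆.slash_action_eq' _ ⟨γ, rfl⟩⟩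

lemma ramanujan_eisUHP_zero (z : ℍ) :
    D (eisUHP 0) z = 12⁻¹ * (eisUHP 0 z ^ 2 - eisUHP 1 z) := by
  have hF : MDiff (fun z : ℍ ↦ (D (eisUHP 0) z - 12⁻¹ * eisUHP 0 z ^ 2 : ℂ)) :=
    (normalizedDerivOfComplex_mdifferentiable (mdifferentiable_eisUHP 0)).sub
      (mdifferentiable_const.mul ((mdifferentiable_eisUHP 0).pow 2))
  have hl : Tendsto (fun z ↦ D (eisUHP 0) z - 12⁻¹ * eisUHP 0 z ^ 2) atImInfty (𝓝 (-12⁻¹)) := by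
    simpa using (tendsto_normalizedDeriv_eisUHP 0).sub (((tendsto_eisUHP 0).pow 2).const_mul 12⁻¹)
  have h := congrFun (eq_smul_of_rank_eq_one levelOne_weight_four_rank_one hF
    (mdifferentiable_eisUHP 1) (by simpa only [eisUHP_zero] using normalizedDeriv_E2_slash)
    (fun γ ↦ (eisUHP_slash γ).1) hl (tendsto_eisUHP 1)) z
  simp only [Pi.smul_apply, smul_eq_mul] at h
  linear_combination h

lemma ramanujan_eisUHP_one (z : ℍ) :
    D (eisUHP 1) z = 3⁻¹ * (eisUHP 0 z * eisUHP 1 z - eisUHP 2 z) := by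
  have hl : Tendsto (serreDerivative (4 : ℤ) (eisUHP 1)) atImInfty (𝓝 (-3⁻¹)) := by
    have h := (tendsto_normalizedDeriv_eisUHP 1).sub
      (((tendsto_eisUHP 0).const_mul (4 * 12⁻¹)).mul (tendsto_eisUHP 1))
    rw [eisUHP_zero] at h
    convert! h using 2
    norm_num
  have h := congrFun (eq_smul_of_rank_eq_one levelOne_weight_six_rank_one
    (serreDerivative_mdifferentiable _ (mdifferentiable_eisUHP 1)) (mdifferentiable_eisUHP 2)
    (fun γ ↦ serreDerivative_slash_invariant (mdifferentiable_eisUHP 1) (eisUHP_slash γ).1)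
    (fun γ ↦ (eisUHP_slash γ).2) hl (tendsto_eisUHP 2)) z
  simp only [Pi.smul_apply, smul_eq_mul, serreDerivative_apply, ← eisUHP_zero] at h
  push_cast at h
  linear_combination h

lemma ramanujan_eisUHP_two (z : ℍ) :
    D (eisUHP 2) z = 2⁻¹ * (eisUHP 0 z * eisUHP 2 z - eisUHP 1 z ^ 2) := by
  have hl : Tendsto (serreDerivative (6 : ℤ) (eisUHP 2)) atImInfty (𝓝 (-2⁻¹)) := by
    have h := (tendsto_normalizedDeriv_eisUHP 2).sub
      (((tendsto_eisUHP 0).const_mul (6 * 12⁻¹)).mul (tendsto_eisUHP 2))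
    rw [eisUHP_zero] at h
    convert! h using 2
    norm_num
  have hr : Module.rank ℂ (ModularForm 𝒮ℒ 8) = 1 :=
    (rank_eq_one_add_rank_cuspForm (k := 8) (by norm_num) ⟨4, rfl⟩).trans
      ((congrArg (1 + ·) (CuspForm.rank_eq_zero_of_weight_lt_twelve (by norm_num))).trans
        (by norm_cast))
  have hs (γ : SL(2, ℤ)) : (eisUHP 1 * eisUHP 1) ∣[(8 : ℤ)] γ = eisUHP 1 * eisUHP 1 := by
    have := ModularForm.mul_slash_SL2 4 4 γ (eisUHP 1) (eisUHP 1)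
    rw [(eisUHP_slash γ).1] at this
    exact this
  have hl2 : Tendsto (eisUHP 1 * eisUHP 1) atImInfty (𝓝 1) := by
    simpa using! (tendsto_eisUHP 1).mul (tendsto_eisUHP 1)
  have h := congrFun (eq_smul_of_rank_eq_one hr
    (serreDerivative_mdifferentiable _ (mdifferentiable_eisUHP 2))
    ((mdifferentiable_eisUHP 1).mul (mdifferentiable_eisUHP 1))
    (fun γ ↦ serreDerivative_slash_invariant (mdifferentiable_eisUHP 2) (eisUHP_slash γ).2)
    hs hl hl2) z
  simp only [Pi.smul_apply, smul_eq_mul, serreDerivative_apply, ← eisUHP_zero, Pi.mul_apply] at h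
  push_cast at h
  linear_combination h

lemma exists_smul_eisVec {z : ℂ} (hz : 0 < z.im) {c d : ℤ} (hcd : IsCoprime c d) :
    ∃ w : ℂ, w.im = z.im / ‖c * z + d‖ ^ 2 ∧
      eisVec w = ![(c * z + d) ^ 2 * eisVec z 0 + 6 / (Real.pi * I) * c * (c * z + d),
        (c * z + d) ^ 4 * eisVec z 1, (c * z + d) ^ 6 * eisVec z 2] := by
  obtain ⟨γ, hc, hd⟩ := ModularGroup.bottom_row_surj (R := ℤ) (a := ![c, d])
    (by simpa using hcd) |> fun ⟨γ, _, h⟩ ↦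
      (⟨γ, congrFun h 0, congrFun h 1⟩ : ∃ γ : SL(2, ℤ), γ 1 0 = c ∧ γ 1 1 = d)
  let t : ℍ := ⟨z, hz⟩
  have hden : denom γ t = c * z + d := by
    rw [ModularGroup.denom_apply, hc, hd]
  have hden0 : (c * z + d : ℂ) ≠ 0 := hden ▸ denom_ne_zero γ t
  refine ⟨(γ • t : ℍ), ?_, ?_⟩
  · have := ModularGroup.im_smul_eq_div_normSq γ t
    rw [hden, Complex.normSq_eq_norm_sq] at this
    exact this
  · have h0 := E2_slash_apply γ t
    have h1 := congrFun (eisUHP_slash γ).1 t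
    have h2 := congrFun (eisUHP_slash γ).2 t
    rw [← eisUHP_zero] at h0
    rw [SL_slash_apply, hden] at h0 h1 h2
    rw [hc] at h0
    have e (n : ℕ) : (c * z + d : ℂ) ^ (-(n : ℤ)) = ((c * z + d) ^ n)⁻¹ := by
      rw [zpow_neg, zpow_natCast]
    have e2 := e 2
    have e4 := e 4
    have e6 := e 6
    push_cast at e2 e4 e6
    rw [e2] at h0
    rw [e4] at h1
    rw [e6] at h2
    have hpi : (Real.pi : ℂ) ≠ 0 := by exact_mod_cast Real.pi_ne_zero
    ext i
    fin_cases i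
    · change eisUHP 0 (γ • t) = (c * z + d) ^ 2 * eisUHP 0 t + 6 / (Real.pi * I) * c * (c * z + d)
      field_simp at h0 ⊢
      linear_combination I * h0 - 6 * (c * z + d) * c * I_sq
    · change eisUHP 1 (γ • t) = (c * z + d) ^ 4 * eisUHP 1 t
      field_simp at h1
      linear_combination h1
    · change eisUHP 2 (γ • t) = (c * z + d) ^ 6 * eisUHP 2 t
      field_simp at h2
      linear_combination h2

end Modular

open MvPolynomial in
/-- The derivation of `ℤ[X, Y, Z]` corresponding to `12 q d/dq` on `E₂, E₄, E₆`. -/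
noncomputable def ramanujanPoly : Fin 3 → MvPolynomial (Fin 3) ℤ :=
  ![X 0 ^ 2 - X 1, 4 * (X 0 * X 1 - X 2), 6 * (X 0 * X 2 - X 1 ^ 2)]

lemma hasDerivAt_eisVec_apply (i : Fin 3) {z : ℂ} (hz : 0 < z.im) :
    HasDerivAt (fun w ↦ eisVec w i)
      (2 * Real.pi * I / 12 * MvPolynomial.aeval (eisVec z) (ramanujanPoly i)) z := by
  have h := hasDerivAt_eisVec i hz
  have h' := hasDerivAt_eisUHP i ⟨z, hz⟩
  convert h using 1
  have e := h'.deriv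
  have h2 : (2 * Real.pi * I : ℂ) ≠ 0 := two_pi_I_ne_zero
  have key : 12 * Derivative.normalizedDerivOfComplex (eisUHP i) ⟨z, hz⟩ =
      MvPolynomial.aeval (eisVec z) (ramanujanPoly i) := by
    fin_cases i
    · simp [ramanujan_eisUHP_zero, ramanujanPoly, eisUHP]
    · simp [ramanujan_eisUHP_one, ramanujanPoly, eisUHP]; ring
    · simp [ramanujan_eisUHP_two, ramanujanPoly, eisUHP]; ring
  rw [Derivative.normalizedDerivOfComplex, e] at key
  rw [← key]
  field_simp

/-- A power series in one variable with nonnegative majorant sum `S` at radius `r`. -/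
def IsMajorized (f : PowerSeries ℂ) (r S : ℝ) : Prop :=
  ∀ N : ℕ, ∑ n ∈ Finset.range N, ‖f.coeff n‖ * r ^ n ≤ S

namespace IsMajorized

variable {f g : PowerSeries ℂ} {r S T : ℝ}

lemma nonneg (hf : IsMajorized f r S) : 0 ≤ S := by simpa using hf 0

lemma mono (hf : IsMajorized f r S) (h : S ≤ T) : IsMajorized f r T := fun N ↦ (hf N).trans h

lemma add (hr : 0 ≤ r) (hf : IsMajorized f r S) (hg : IsMajorized g r T) :
    IsMajorized (f + g) r (S + T) := fun N ↦ by
  refine le_trans ?_ (add_le_add (hf N) (hg N))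
  rw [← Finset.sum_add_distrib]
  refine Finset.sum_le_sum fun n _ ↦ ?_
  rw [← add_mul, map_add]
  gcongr
  exact norm_add_le _ _

lemma sum {ι : Type*} (hr : 0 ≤ r) {f : ι → PowerSeries ℂ} {S : ι → ℝ} (s : Finset ι)
    (h : ∀ i ∈ s, IsMajorized (f i) r (S i)) : IsMajorized (∑ i ∈ s, f i) r (∑ i ∈ s, S i) := by
  classical
  induction s using Finset.induction_on with
  | empty => intro N; simp
  | insert a s ha ih =>
    rw [Finset.sum_insert ha, Finset.sum_insert ha]
    exact (h a (by simp)).add hr (ih fun i hi ↦ h i (by simp [hi]))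

lemma const (r : ℝ) (c : ℂ) : IsMajorized (PowerSeries.C c) r ‖c‖ := by
  intro N
  rcases N with _ | N
  · simp
  · rw [Finset.sum_range_succ']
    simp [PowerSeries.coeff_C]

lemma mul (hr : 0 ≤ r) (hf : IsMajorized f r S) (hg : IsMajorized g r T) :
    IsMajorized (f * g) r (S * T) := fun N ↦ by
  calc ∑ n ∈ Finset.range N, ‖(f * g).coeff n‖ * r ^ n
      ≤ ∑ n ∈ Finset.range N, ∑ p ∈ Finset.HasAntidiagonal.antidiagonal n,
          (‖f.coeff p.1‖ * r ^ p.1) * (‖g.coeff p.2‖ * r ^ p.2) := by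
        refine Finset.sum_le_sum fun n _ ↦ ?_
        rw [PowerSeries.coeff_mul]
        calc _ ≤ (∑ p ∈ Finset.HasAntidiagonal.antidiagonal n, ‖f.coeff p.1 * g.coeff p.2‖) * r ^ n := by
              gcongr; exact norm_sum_le _ _
          _ = _ := by
              rw [Finset.sum_mul]
              refine Finset.sum_congr rfl fun p hp ↦ ?_
              rw [← Finset.HasAntidiagonal.mem_antidiagonal.mp hp, norm_mul, pow_add]
              ring
    _ = ∑ p ∈ (Finset.range N).sigma fun n ↦ Finset.HasAntidiagonal.antidiagonal n,
          (‖f.coeff p.2.1‖ * r ^ p.2.1) * (‖g.coeff p.2.2‖ * r ^ p.2.2) := by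
        rw [Finset.sum_sigma]
    _ ≤ ∑ p ∈ Finset.range N ×ˢ Finset.range N,
          (‖f.coeff p.1‖ * r ^ p.1) * (‖g.coeff p.2‖ * r ^ p.2) := by
        rw [← Finset.sum_image (f := fun p : ℕ × ℕ ↦
          (‖f.coeff p.1‖ * r ^ p.1) * (‖g.coeff p.2‖ * r ^ p.2))
          (g := fun p : (_ : ℕ) × ℕ × ℕ ↦ p.2)]
        · refine Finset.sum_le_sum_of_subset_of_nonneg ?_ fun _ _ _ ↦ by positivity
          intro p hp
          simp only [Finset.mem_image, Finset.mem_sigma, Finset.mem_range,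
            Finset.HasAntidiagonal.mem_antidiagonal, Finset.mem_product] at hp ⊢
          obtain ⟨⟨n, i, j⟩, ⟨h1, h2⟩, rfl⟩ := hp
          simp at h1 h2 ⊢
          omega
        · rintro ⟨n, i, j⟩ h1 ⟨m, k, l⟩ h2 h
          simp only [Finset.coe_sigma, Set.mem_sigma_iff, Finset.mem_coe,
            Finset.HasAntidiagonal.mem_antidiagonal, Prod.mk.injEq] at h1 h2 h
          obtain ⟨rfl, rfl⟩ := h
          obtain ⟨_, rfl⟩ := h1
          obtain ⟨_, rfl⟩ := h2
          rfl
    _ = (∑ n ∈ Finset.range N, ‖f.coeff n‖ * r ^ n) *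
          ∑ n ∈ Finset.range N, ‖g.coeff n‖ * r ^ n := by
        rw [Finset.sum_mul_sum, Finset.sum_product]
    _ ≤ S * T := by
        gcongr
        · exact hf.nonneg
        · exact hf N
        · exact hg N

lemma pow (hr : 0 ≤ r) (hf : IsMajorized f r S) (n : ℕ) : IsMajorized (f ^ n) r (S ^ n) := by
  induction n with
  | zero => simpa using const r (1 : ℂ)
  | succ n ih => rw [pow_succ, pow_succ]; exact ih.mul hr hf

lemma summable (hr : 0 ≤ r) (hf : IsMajorized f r S) : Summable fun n ↦ ‖f.coeff n‖ * r ^ n :=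
  summable_of_sum_range_le (fun n ↦ by positivity) hf

lemma tsum_le (hr : 0 ≤ r) (hf : IsMajorized f r S) : ∑' n, ‖f.coeff n‖ * r ^ n ≤ S :=
  Real.tsum_le_of_sum_range_le (fun n ↦ by positivity) hf

lemma norm_coeff_mul_pow_le (hr : 0 ≤ r) (hf : IsMajorized f r S) (n : ℕ) :
    ‖f.coeff n‖ * r ^ n ≤ S := by
  refine le_trans ?_ (hf (n + 1))
  exact Finset.single_le_sum (f := fun n ↦ ‖f.coeff n‖ * r ^ n) (fun i _ ↦ by positivity)
    (Finset.self_mem_range_succ n)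

/-- The Schwarz-lemma estimate, for series with a zero of order `M` at the origin. -/
lemma norm_le_of_hasSum (hr : 0 < r) (hf : IsMajorized f r S) {M : ℕ}
    (hM : ∀ n < M, f.coeff n = 0) {q v : ℂ} (hq : ‖q‖ ≤ r)
    (hv : HasSum (fun n ↦ f.coeff n * q ^ n) v) : ‖v‖ ≤ (‖q‖ / r) ^ M * S := by
  have hle (n : ℕ) : ‖f.coeff n * q ^ n‖ ≤ (‖q‖ / r) ^ M * (‖f.coeff n‖ * r ^ n) := by
    rcases lt_or_ge n M with h | h
    · simp [hM n h]
    · have h1 : ‖q‖ / r ≤ 1 := (div_le_one hr).mpr hq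
      have h2 : (‖q‖ / r) ^ n ≤ (‖q‖ / r) ^ M := pow_le_pow_of_le_one (by positivity) h1 h
      rw [norm_mul, norm_pow]
      calc ‖f.coeff n‖ * ‖q‖ ^ n = (‖q‖ / r) ^ n * (‖f.coeff n‖ * r ^ n) := by
            rw [div_pow]; field_simp
        _ ≤ _ := by gcongr
  have hs := (hf.summable hr.le).mul_left ((‖q‖ / r) ^ M)
  rw [← hv.tsum_eq]
  refine (tsum_of_norm_bounded hs.hasSum hle).trans ?_
  rw [tsum_mul_left]
  gcongr
  exact hf.tsum_le hr.le

end IsMajorized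

/-- `f` converges absolutely at `q` with sum `v`. -/
def EvalsTo (f : PowerSeries ℂ) (q v : ℂ) : Prop :=
  Summable (fun n ↦ ‖f.coeff n * q ^ n‖) ∧ HasSum (fun n ↦ f.coeff n * q ^ n) v

namespace EvalsTo

variable {f g : PowerSeries ℂ} {q v w : ℂ}

lemma add (hf : EvalsTo f q v) (hg : EvalsTo g q w) : EvalsTo (f + g) q (v + w) := by
  have e : (fun n ↦ (f + g).coeff n * q ^ n) =
      fun n ↦ f.coeff n * q ^ n + g.coeff n * q ^ n := by ext n; simp [add_mul]
  have h := hf.2.add hg.2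
  refine ⟨?_, by simpa only [e] using! h⟩
  simp_rw [funext_iff.mp e]
  exact Summable.of_nonneg_of_le (fun _ ↦ norm_nonneg _)
    (fun n ↦ norm_add_le _ _) (hf.1.add hg.1)

lemma const (q c : ℂ) : EvalsTo (PowerSeries.C c) q c := by
  have e : (fun n ↦ (PowerSeries.C c).coeff n * q ^ n) = fun n ↦ if n = 0 then c else 0 := by
    ext n; by_cases h : n = 0 <;> simp [PowerSeries.coeff_C, h]
  refine ⟨?_, ?_⟩
  · refine summable_of_hasFiniteSupport ((Set.finite_singleton 0).subset fun n hn ↦ ?_)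
    by_contra h
    have h' : n ≠ 0 := h
    simp [PowerSeries.coeff_C, h'] at hn
  · rw [e]
    simpa using hasSum_ite_eq (0 : ℕ) c

lemma mul (hf : EvalsTo f q v) (hg : EvalsTo g q w) : EvalsTo (f * g) q (v * w) := by
  have e : (fun n ↦ (f * g).coeff n * q ^ n) =
      fun n ↦ ∑ p ∈ Finset.HasAntidiagonal.antidiagonal n, (f.coeff p.1 * q ^ p.1) * (g.coeff p.2 * q ^ p.2) := by
    ext n
    rw [PowerSeries.coeff_mul, Finset.sum_mul]
    refine Finset.sum_congr rfl fun p hp ↦ ?_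
    rw [← Finset.HasAntidiagonal.mem_antidiagonal.mp hp, pow_add]
    ring
  have h1 := summable_norm_sum_mul_antidiagonal_of_summable_norm hf.1 hg.1
  have h2 := tsum_mul_tsum_eq_tsum_sum_antidiagonal_of_summable_norm hf.1 hg.1
  unfold EvalsTo
  rw [e]
  refine ⟨by simpa only [funext_iff.mp e] using h1, ?_⟩
  rw [hf.2.tsum_eq, hg.2.tsum_eq] at h2
  rw [h2]
  exact h1.of_norm.hasSum

end EvalsTo

/-- The sum of the norms of the coefficients of a polynomial. -/
noncomputable def mvLength {σ R : Type*} [NormedCommRing R] (A : MvPolynomial σ R) : ℝ :=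
  ∑ m ∈ A.support, ‖A.coeff m‖

/-- The Fourier series of `E₂, E₄, E₆`. -/
noncomputable def eisSeries (i : Fin 3) : PowerSeries ℂ := PowerSeries.mk fun n ↦ (eisCoeff i n : ℂ)

/-- The Fourier series of `A(E₂, E₄, E₆)`. -/
noncomputable def qSeries (A : MvPolynomial (Fin 3) ℂ) : PowerSeries ℂ :=
  MvPolynomial.eval₂ PowerSeries.C eisSeries A

lemma evalsTo_qSeries (A : MvPolynomial (Fin 3) ℂ) {z : ℂ} (hz : 0 < z.im) :
    EvalsTo (qSeries A) (nome z) (MvPolynomial.eval (eisVec z) A) := by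
  unfold qSeries
  induction A using MvPolynomial.induction_on with
  | C a => simpa using EvalsTo.const (nome z) a
  | add p q hp hq => simpa using hp.add hq
  | mul_X p i hp =>
    simp only [MvPolynomial.eval₂_mul, MvPolynomial.eval₂_X, MvPolynomial.eval_mul,
      MvPolynomial.eval_X]
    refine hp.mul ⟨?_, ?_⟩
    · have := summable_norm_eisCoeff i (norm_nonneg _) (norm_nome_lt_one hz)
      simpa [eisSeries] using this
    · simpa [eisSeries] using hasSum_eisVec i hz

lemma isMajorized_eisSeries (i : Fin 3) {r : ℝ} (hr0 : 0 ≤ r) (hr : r < 1) :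
    IsMajorized (eisSeries i) r (362880 / (1 - r) ^ 7) := by
  intro N
  refine le_trans ?_ (tsum_norm_eisCoeff_le i hr0 hr)
  have := (summable_norm_eisCoeff i hr0 hr).sum_le_tsum (Finset.range N)
    (fun n _ ↦ by positivity)
  simpa [eisSeries] using this

lemma isMajorized_qSeries {A : MvPolynomial (Fin 3) ℂ} {d : ℕ} (hd : A.totalDegree ≤ d) {r : ℝ}
    (hr0 : 0 ≤ r) (hr : r < 1) :
    IsMajorized (qSeries A) r (mvLength A * (362880 / (1 - r) ^ 7) ^ d) := by
  have h1 : 1 ≤ 362880 / (1 - r) ^ 7 := by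
    rw [le_div_iff₀ (by have := sub_pos.mpr hr; positivity)]
    have : (1 - r) ^ 7 ≤ 1 := pow_le_one₀ (by linarith) (by linarith)
    linarith
  rw [qSeries, MvPolynomial.eval₂_eq', mvLength, Finset.sum_mul]
  refine IsMajorized.sum hr0 _ fun m hm ↦ ?_
  refine (IsMajorized.const r _).mul hr0 (IsMajorized.mono (S := (362880 / (1 - r) ^ 7) ^
    (m 0 + m 1 + m 2)) ?_ ?_)
  · rw [Fin.prod_univ_three, pow_add, pow_add]
    exact (((isMajorized_eisSeries 0 hr0 hr).pow hr0 _).mul hr0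
      ((isMajorized_eisSeries 1 hr0 hr).pow hr0 _)).mul hr0
      ((isMajorized_eisSeries 2 hr0 hr).pow hr0 _)
  · refine pow_le_pow_right₀ h1 ?_
    have := (MvPolynomial.le_totalDegree hm).trans hd
    rwa [Finsupp.sum_fintype _ _ (fun _ ↦ rfl), Fin.sum_univ_three] at this

/-- Cauchy's bound for the coefficients of a convergent power series. -/
lemma norm_coeff_le_of_hasSum {g : ℂ → ℂ} {a : ℕ → ℂ} {ρ R B : ℝ} (hρ : 0 < ρ) (hR : ρ < R)
    (hg : ∀ q, ‖q‖ < R → HasSum (fun n ↦ a n * q ^ n) (g q)) (hB : ∀ q, ‖q‖ = ρ → ‖g q‖ ≤ B)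
    (n : ℕ) : ‖a n‖ ≤ B / ρ ^ n := by
  obtain ⟨R', h1, h2⟩ := exists_between hR
  have hR' : 0 < R' := hρ.trans h1
  have hp : HasFPowerSeriesOnBall g (FormalMultilinearSeries.ofScalars ℂ a) 0
      (ENNReal.ofReal R') := by
    refine ⟨?_, by simpa, fun {y} hy ↦ ?_⟩
    · refine FormalMultilinearSeries.le_radius_of_tendsto _ (l := 0) ?_
      have := (hg (R' : ℂ) (by simpa [abs_of_pos hR'] using h2)).summable.tendsto_atTop_zero.norm
      simpa [abs_of_pos hR', hR'.le] using this
    · simp only [FormalMultilinearSeries.ofScalars_apply_eq, zero_add, smul_eq_mul]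
      refine hg y ?_
      have : ‖y‖ < R' := by simpa using hy
      linarith
  have hcl : DiffContOnCl ℂ g (Metric.ball 0 ρ) := by
    refine DifferentiableOn.diffContOnCl (hp.differentiableOn.mono ?_)
    intro y hy
    have : ‖y‖ ≤ ρ := by simpa using Metric.closure_ball_subset_closedBall hy
    simp only [Metric.eball_ofReal, Metric.mem_ball, dist_zero_right]
    linarith
  have h3 := norm_iteratedDeriv_le_of_forall_mem_sphere_norm_le n hρ hcl
    (fun q hq ↦ hB q (by simpa using hq))
  have h4 := hp.factorial_smul 1 n
  rw [← iteratedDeriv_eq_iteratedFDeriv] at h4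
  rw [← h4] at h3
  simp only [FormalMultilinearSeries.ofScalars_apply_eq, one_pow, smul_eq_mul, mul_one,
    nsmul_eq_mul, norm_mul, Complex.norm_natCast] at h3
  rw [mul_div_assoc] at h3
  exact le_of_mul_le_mul_left h3 (by positivity)

section ZeroEstimate

open PowerSeries in
lemma polynomial_eq_zero_of_X_pow_dvd {p : Polynomial ℂ} {n : ℕ} (hn : p.natDegree ≤ n)
    {u v : PowerSeries ℂ} (hu : u = 1 + X * v) (hv : constantCoeff v ≠ 0)
    (h : X ^ (n + 1) ∣ Polynomial.aeval u p) : p = 0 := by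
  by_contra hp
  obtain ⟨g, hg, hg1⟩ := Polynomial.exists_eq_pow_rootMultiplicity_mul_and_not_dvd p hp 1
  set m := p.rootMultiplicity 1
  have hm : m ≤ n := by
    refine le_trans ?_ hn
    exact (Polynomial.natDegree_le_of_dvd (Polynomial.pow_rootMultiplicity_dvd p 1) hp).trans'
      (by rw [Polynomial.natDegree_pow, Polynomial.natDegree_X_sub_C, mul_one])
  have e : Polynomial.aeval u p = X ^ m * (v ^ m * Polynomial.aeval u g) := by
    have h1 : Polynomial.aeval u ((Polynomial.X - Polynomial.C (1 : ℂ)) ^ m * g) =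
        (u - 1) ^ m * Polynomial.aeval u g := by simp
    rw [← hg] at h1
    rw [h1, hu]
    ring
  have h2 : X ∣ v ^ m * Polynomial.aeval u g := by
    rw [e, show n + 1 = m + (n - m + 1) by omega, pow_add] at h
    exact (dvd_pow_self X (by omega)).trans
      ((mul_dvd_mul_iff_left (pow_ne_zero m PowerSeries.X_ne_zero)).mp h)
  rw [PowerSeries.X_dvd_iff, map_mul, map_pow] at h2
  rcases mul_eq_zero.mp h2 with h3 | h3
  · exact hv (eq_zero_of_pow_eq_zero h3)
  · refine hg1 (Polynomial.dvd_iff_isRoot.mpr ?_)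
    have h4 : constantCoeff (Polynomial.aeval u g) = Polynomial.eval 1 g := by
      rw [Polynomial.aeval_def, Polynomial.hom_eval₂, hu]
      simp only [map_add, map_one, map_mul, constantCoeff_X, zero_mul, add_zero]
      have : (constantCoeff.comp (algebraMap ℂ (PowerSeries ℂ))) = RingHom.id ℂ :=
        RingHom.ext fun x ↦ by simp
      rw [this, Polynomial.eval₂_id]
    rw [Polynomial.IsRoot, ← h4, h3]

open PowerSeries in
lemma eisSeries_cube_div : ∃ v : PowerSeries ℂ, constantCoeff v ≠ 0 ∧
    eisSeries 1 ^ 3 * ((eisSeries 2)⁻¹) ^ 2 = 1 + X * v := by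
  have hc (i : Fin 3) : constantCoeff (eisSeries i) = 1 := by
    rw [← coeff_zero_eq_constantCoeff_apply, eisSeries, coeff_mk]; simp [eisCoeff]
  have h1 : eisSeries 2 * (eisSeries 2)⁻¹ = 1 := PowerSeries.mul_inv_cancel _ (by simp [hc])
  have hX (i : Fin 3) : ∃ g : PowerSeries ℂ, eisSeries i = 1 + X * g ∧ constantCoeff g = (eisCoeff i 1 : ℂ) := by
    obtain ⟨g, hg⟩ := (PowerSeries.X_dvd_iff (φ := eisSeries i - 1)).mpr (by simp [hc])
    have e : eisSeries i = 1 + X * g := by rw [← hg]; ring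
    refine ⟨g, e, ?_⟩
    have : coeff 1 (eisSeries i) = coeff 1 (1 + X * g) := by rw [← e]
    rw [eisSeries, coeff_mk, map_add, show (1 : ℕ) = 0 + 1 from rfl, coeff_succ_X_mul] at this
    simpa using this.symm
  obtain ⟨g1, e1, c1⟩ := hX 1
  obtain ⟨g2, e2, c2⟩ := hX 2
  have k1 : eisCoeff 1 1 = 240 := by simp [eisCoeff]
  have k2 : eisCoeff 2 1 = -504 := by simp [eisCoeff]
  refine ⟨(3 * g1 + 3 * X * g1 ^ 2 + X ^ 2 * g1 ^ 3 - 2 * g2 - X * g2 ^ 2) *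
    ((eisSeries 2)⁻¹) ^ 2, ?_, ?_⟩
  · have : constantCoeff ((eisSeries 2)⁻¹) = 1 := by simp [hc]
    have n3 : constantCoeff (3 : PowerSeries ℂ) = 3 := map_ofNat (constantCoeff (R := ℂ)) 3
    have n2 : constantCoeff (2 : PowerSeries ℂ) = 2 := map_ofNat (constantCoeff (R := ℂ)) 2
    simp [this, c1, c2, k1, k2, n3, n2]
    norm_num
  · have h2 : eisSeries 2 ^ 2 * (eisSeries 2)⁻¹ ^ 2 = 1 := by rw [← mul_pow, h1, one_pow]
    calc eisSeries 1 ^ 3 * (eisSeries 2)⁻¹ ^ 2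
        = eisSeries 2 ^ 2 * (eisSeries 2)⁻¹ ^ 2 +
          (eisSeries 1 ^ 3 - eisSeries 2 ^ 2) * (eisSeries 2)⁻¹ ^ 2 := by ring
      _ = _ := by
        rw [h2]
        generalize (eisSeries 2)⁻¹ = y
        rw [e1, e2]
        ring

/-- An isobaric polynomial in `E₄, E₆` with a zero of large order at infinity vanishes. -/
lemma eq_zero_of_X_pow_dvd_isobaric {ι : Type*} (s : Finset ι) (j k : ι → ℕ) (a : ι → ℂ) {w d : ℕ}
    (hw : ∀ m ∈ s, 4 * j m + 6 * k m = w) (hd : ∀ m ∈ s, j m ≤ d) (hj : Set.InjOn j s)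
    (h : PowerSeries.X ^ (d + 1) ∣
      ∑ m ∈ s, PowerSeries.C (a m) * (eisSeries 1 ^ j m * eisSeries 2 ^ k m)) :
    ∀ m ∈ s, a m = 0 := by
  obtain ⟨v, hv, hu⟩ := eisSeries_cube_div
  have hc (i : Fin 3) : PowerSeries.constantCoeff (eisSeries i) = 1 := by
    rw [← PowerSeries.coeff_zero_eq_constantCoeff_apply, eisSeries, PowerSeries.coeff_mk]
    simp [eisCoeff]
  have hinv : eisSeries 2 * (eisSeries 2)⁻¹ = 1 := PowerSeries.mul_inv_cancel _ (by simp [hc])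
  have hunit (i : Fin 3) : IsUnit (eisSeries i) :=
    PowerSeries.isUnit_iff_constantCoeff.mpr (by simp [hc])
  set u := eisSeries 1 ^ 3 * ((eisSeries 2)⁻¹) ^ 2 with hudef
  intro m₀ hm₀
  set p : Polynomial ℂ := ∑ m ∈ s, Polynomial.monomial (j m / 3) (a m) with hp
  have hterm (m) (hm : m ∈ s) : eisSeries 1 ^ j m * eisSeries 2 ^ k m =
      eisSeries 1 ^ (j m₀ % 3) * eisSeries 2 ^ (k m₀ + 2 * (j m₀ / 3)) * u ^ (j m / 3) := by
    have h1 := hw m hm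
    have h2 := hw m₀ hm₀
    have h3 : j m = j m₀ % 3 + 3 * (j m / 3) := by omega
    have h4 : k m₀ + 2 * (j m₀ / 3) = k m + 2 * (j m / 3) := by omega
    rw [h4, hudef]
    conv_lhs => rw [h3]
    generalize j m / 3 = t
    calc _ = eisSeries 1 ^ (j m₀ % 3 + 3 * t) * eisSeries 2 ^ k m *
          (eisSeries 2 * (eisSeries 2)⁻¹) ^ (2 * t) := by rw [hinv]; simp
      _ = _ := by rw [mul_pow, mul_pow, pow_add, pow_add, ← pow_mul, ← pow_mul]; ring
  have hsum : ∑ m ∈ s, PowerSeries.C (a m) * (eisSeries 1 ^ j m * eisSeries 2 ^ k m) =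
      (eisSeries 1 ^ (j m₀ % 3) * eisSeries 2 ^ (k m₀ + 2 * (j m₀ / 3))) *
        Polynomial.aeval u p := by
    rw [hp, map_sum, Finset.mul_sum]
    refine Finset.sum_congr rfl fun m hm ↦ ?_
    rw [hterm m hm, Polynomial.aeval_monomial, PowerSeries.algebraMap_apply]
    simp only [Algebra.algebraMap_self, RingHom.id_apply]
    ring
  rw [hsum, IsUnit.dvd_mul_left (((hunit 1).pow _).mul ((hunit 2).pow _))] at h
  have hpd : p.natDegree ≤ d := by
    refine Polynomial.natDegree_sum_le_of_forall_le _ _ fun m hm ↦ ?_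
    refine (Polynomial.natDegree_monomial_le _).trans ?_
    have := hd m hm
    omega
  have hp0 := polynomial_eq_zero_of_X_pow_dvd hpd hu hv h
  have hcoef : p.coeff (j m₀ / 3) = a m₀ := by
    rw [hp, Polynomial.finsetSum_coeff, Finset.sum_eq_single m₀]
    · simp
    · intro m hm hne
      rw [Polynomial.coeff_monomial, if_neg]
      intro heq
      refine hne (hj hm hm₀ ?_)
      have h1 := hw m hm
      have h2 := hw m₀ hm₀
      omega
    · exact fun h ↦ (h hm₀).elim
  rw [← hcoef, hp0, Polynomial.coeff_zero]

end ZeroEstimate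

section Interpolation

lemma norm_eval_le_of_nodes {p : Polynomial ℂ} {K : ℕ} (hp : p.natDegree ≤ K) (x : ℕ → ℂ)
    {R ε : ℝ} (hx : ∀ i ≤ K, ∀ j ≤ K, i ≠ j → 1 ≤ ‖x i - x j‖) (hR : ∀ i ≤ K, ‖x i‖ ≤ R)
    (hε : ∀ i ≤ K, ‖p.eval (x i)‖ ≤ ε) (u : ℂ) :
    ‖p.eval u‖ ≤ (K + 1) * ε * (‖u‖ + R) ^ K := by
  have hR0 : 0 ≤ R := (norm_nonneg _).trans (hR 0 (Nat.zero_le _))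
  have hε0 : 0 ≤ ε := (norm_nonneg _).trans (hε 0 (Nat.zero_le _))
  have hmem {i : ℕ} (hi : i ∈ Finset.range (K + 1)) : i ≤ K := by
    have := Finset.mem_range.mp hi; omega
  have hinj : Set.InjOn x (Finset.range (K + 1)) := by
    intro i hi j hj hij
    by_contra h
    have := hx i (hmem hi) j (hmem hj) h
    simp [hij] at this
    linarith
  have hdeg : p.degree < (Finset.range (K + 1)).card := by
    rw [Finset.card_range]
    exact (Polynomial.degree_le_natDegree).trans_lt (by exact_mod_cast Nat.lt_succ_of_le hp)
  have h := Lagrange.eq_interpolate hinj hdeg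
  rw [h, Lagrange.interpolate_apply, Polynomial.eval_finsetSum]
  refine (norm_sum_le _ _).trans ?_
  calc _ ≤ ∑ i ∈ Finset.range (K + 1), ε * (‖u‖ + R) ^ K := by
        refine Finset.sum_le_sum fun i hi ↦ ?_
        rw [Polynomial.eval_mul, Polynomial.eval_C, norm_mul]
        refine mul_le_mul (hε i (hmem hi)) ?_ (norm_nonneg _) hε0
        rw [Lagrange.basis, Polynomial.eval_prod, norm_prod]
        have hc : ((Finset.range (K + 1)).erase i).card = K := by
          rw [Finset.card_erase_of_mem hi, Finset.card_range]; rfl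
        calc _ ≤ ∏ j ∈ (Finset.range (K + 1)).erase i, (‖u‖ + R) := by
              refine Finset.prod_le_prod (fun _ _ ↦ norm_nonneg _) fun j hj ↦ ?_
              obtain ⟨hne, hj'⟩ := Finset.mem_erase.mp hj
              rw [Lagrange.basisDivisor]
              simp only [Polynomial.eval_mul, Polynomial.eval_C, Polynomial.eval_sub,
                Polynomial.eval_X, norm_mul, norm_inv]
              have h1 := hx i (hmem hi) j (hmem hj') hne.symm
              calc _ ≤ 1 * ‖u - x j‖ := by
                    gcongr
                    exact inv_le_one_of_one_le₀ h1
                _ ≤ ‖u‖ + ‖x j‖ := by rw [one_mul]; exact norm_sub_le _ _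
                _ ≤ _ := by gcongr; exact hR j (hmem hj')
          _ = _ := by rw [Finset.prod_const, hc]
    _ = _ := by rw [Finset.sum_const, Finset.card_range, nsmul_eq_mul]; push_cast; ring

lemma natDegree_aeval_le (P : MvPolynomial (Fin 3) ℂ) (α : Fin 3 → Polynomial ℂ) {D d : ℕ}
    (hα : ∀ i, (α i).natDegree ≤ D) (hd : P.totalDegree ≤ d) :
    (MvPolynomial.aeval α P).natDegree ≤ D * d := by
  rw [MvPolynomial.aeval_def, MvPolynomial.eval₂_eq']
  refine Polynomial.natDegree_sum_le_of_forall_le _ _ fun m hm ↦ ?_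
  refine Polynomial.natDegree_mul_le.trans ?_
  rw [Polynomial.algebraMap_apply, Algebra.algebraMap_self, RingHom.id_apply,
    Polynomial.natDegree_C, zero_add]
  refine (Polynomial.natDegree_prod_le _ _).trans ?_
  have h := (MvPolynomial.le_totalDegree hm).trans hd
  rw [Finsupp.sum_fintype _ _ (fun _ ↦ rfl)] at h
  refine le_trans ?_ (Nat.mul_le_mul_left D h)
  rw [Finset.mul_sum]
  refine Finset.sum_le_sum fun i _ ↦ ?_
  refine Polynomial.natDegree_pow_le.trans ?_
  rw [mul_comm]
  exact Nat.mul_le_mul_right _ (hα i)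

lemma eval_aeval_polynomial (P : MvPolynomial (Fin 3) ℂ) (α : Fin 3 → Polynomial ℂ) (x : ℂ) :
    (MvPolynomial.aeval α P).eval x = MvPolynomial.eval (fun i ↦ (α i).eval x) P := by
  rw [MvPolynomial.aeval_def, MvPolynomial.eval₂_eq', Polynomial.eval_finsetSum,
    MvPolynomial.eval_eq']
  refine Finset.sum_congr rfl fun m _ ↦ ?_
  simp [Polynomial.eval_prod]

lemma Polynomial.norm_coeff_le_of_unit_circle {p : Polynomial ℂ} {B : ℝ}
    (hB : ∀ x, ‖x‖ = 1 → ‖p.eval x‖ ≤ B) (n : ℕ) : ‖p.coeff n‖ ≤ B := by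
  have := norm_coeff_le_of_hasSum (g := fun x ↦ p.eval x) (a := p.coeff) (ρ := 1) (R := 2)
    one_pos one_lt_two (fun q _ ↦ by
      rw [Polynomial.eval_eq_sum_range]
      refine hasSum_sum_of_ne_finset_zero fun b hb ↦ ?_
      rw [Polynomial.coeff_eq_zero_of_natDegree_lt, zero_mul]
      simpa using hb) hB n
  simpa using this

end Interpolation

section Transform

/-- The values of `E₂, E₄, E₆` at a translate, as a function of the bottom row `(c, e)` of the
translating matrix, in terms of the values `ξ` at `τ`. -/
noncomputable def slashVec (τ : ℂ) (ξ : Fin 3 → ℂ) (c e : ℂ) : Fin 3 → ℂ :=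
  ![(c * τ + e) ^ 2 * ξ 0 + 6 / (Real.pi * I) * c * (c * τ + e),
    (c * τ + e) ^ 4 * ξ 1, (c * τ + e) ^ 6 * ξ 2]

lemma norm_eval_slashVec_le {P : MvPolynomial (Fin 3) ℂ} {d : ℕ} (hd : P.totalDegree ≤ d)
    {τ : ℂ} (hτ : ‖τ‖ ≤ 2) (ξ : Fin 3 → ℂ) {ε : ℝ}
    (hε : ∀ c e : ℤ, IsCoprime c e → ‖(c * τ + e : ℂ)‖ ≤ (6 * d + 2) ^ 2 →
      ‖MvPolynomial.eval (slashVec τ ξ c e) P‖ ≤ ε) (c e : ℂ) :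
    ‖MvPolynomial.eval (slashVec τ ξ c e) P‖ ≤ (6 * d + 1) ^ 2 * ε *
      ((‖e‖ + (6 * d + 2) ^ 2) * (‖c‖ + (6 * d + 2) ^ 2)) ^ (6 * d) := by
  set κ : ℂ := 6 / (Real.pi * I)
  have hge (i j : ℕ) (hij : i ≠ j) : 1 ≤ ‖(i : ℂ) - j‖ := by
    have h1 : 1 ≤ |(i : ℤ) - j| := Int.one_le_abs (by omega)
    have h2 : ‖(((i : ℤ) - j : ℤ) : ℂ)‖ = |(i : ℤ) - j| := by rw [Complex.norm_intCast]; push_cast; rfl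
    push_cast at h2
    rw [h2]
    exact_mod_cast h1
  have hstep (c : ℕ) (hc1 : 1 ≤ c) (hc2 : c ≤ 6 * d + 1) (e : ℂ) :
      ‖MvPolynomial.eval (slashVec τ ξ c e) P‖ ≤
        (6 * d + 1) * ε * (‖e‖ + (6 * d + 2) ^ 2) ^ (6 * d) := by
    let α : Fin 3 → Polynomial ℂ :=
      ![(Polynomial.C (c * τ) + Polynomial.X) ^ 2 * Polynomial.C (ξ 0) +
          Polynomial.C (κ * c) * (Polynomial.C (c * τ) + Polynomial.X),
        (Polynomial.C (c * τ) + Polynomial.X) ^ 4 * Polynomial.C (ξ 1),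
        (Polynomial.C (c * τ) + Polynomial.X) ^ 6 * Polynomial.C (ξ 2)]
    have hα (i) : (α i).natDegree ≤ 6 := by
      fin_cases i
      · simp only [α, Fin.zero_eta, Matrix.cons_val_zero]; compute_degree; simp
      · simp only [α, Fin.mk_one, Matrix.cons_val_one, Matrix.cons_val_zero]; compute_degree; simp
      · simp only [α, Fin.reduceFinMk, Matrix.cons_val]; compute_degree
    have hev (x : ℂ) : (MvPolynomial.aeval α P).eval x =
        MvPolynomial.eval (slashVec τ ξ c x) P := by
      rw [eval_aeval_polynomial]
      congr 2
      ext i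
      fin_cases i <;> simp [α, slashVec, κ]
    have key := norm_eval_le_of_nodes (p := MvPolynomial.aeval α P) (K := 6 * d)
      (natDegree_aeval_le P α hα hd) (fun k ↦ 1 + (c : ℂ) * k) (R := (6 * d + 2) ^ 2) (ε := ε)
      (fun i _ j _ hij ↦ by
        have : (1 + (c : ℂ) * i) - (1 + c * j) = c * (i - j) := by ring
        rw [this, norm_mul, Complex.norm_natCast]
        have h1 : (1 : ℝ) ≤ c := by exact_mod_cast hc1
        have := hge i j hij
        nlinarith)
      (fun k hk ↦ by
        have h1 : ((1 + c * k : ℕ) : ℝ) ≤ ((6 * d + 2) ^ 2 : ℕ) := by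
          have := Nat.mul_le_mul hc2 hk
          exact_mod_cast (by nlinarith)
        have h2 : ‖(1 + (c : ℂ) * k)‖ = ((1 + c * k : ℕ) : ℝ) := by
          rw [← Complex.norm_natCast]; push_cast; rfl
        rw [h2]
        exact_mod_cast h1)
      (fun k hk ↦ by
        rw [hev]
        have := hε c (1 + c * k) ⟨-k, 1, by ring⟩ (by
          have h1 : ((2 * c + (1 + c * k) : ℕ) : ℝ) ≤ ((6 * d + 2) ^ 2 : ℕ) := by
            have := Nat.mul_le_mul hc2 hk
            exact_mod_cast (by nlinarith)
          push_cast
          calc ‖(c : ℂ) * τ + (1 + c * k)‖ ≤ ‖(c : ℂ) * τ‖ + ‖((1 + c * k : ℕ) : ℂ)‖ := by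
                push_cast; exact norm_add_le _ _
            _ ≤ c * 2 + (1 + c * k : ℕ) := by
                rw [norm_mul, Complex.norm_natCast, Complex.norm_natCast]
                gcongr
            _ ≤ _ := by push_cast at h1 ⊢; linarith)
        simpa using this) e
    rw [hev] at key
    exact_mod_cast key
  let β : Fin 3 → Polynomial ℂ :=
    ![(Polynomial.C τ * Polynomial.X + Polynomial.C e) ^ 2 * Polynomial.C (ξ 0) +
        Polynomial.C κ * Polynomial.X * (Polynomial.C τ * Polynomial.X + Polynomial.C e),
      (Polynomial.C τ * Polynomial.X + Polynomial.C e) ^ 4 * Polynomial.C (ξ 1),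
      (Polynomial.C τ * Polynomial.X + Polynomial.C e) ^ 6 * Polynomial.C (ξ 2)]
  have hβ (i) : (β i).natDegree ≤ 6 := by
    fin_cases i
    · simp only [β, Fin.zero_eta, Matrix.cons_val_zero]; compute_degree; simp
    · simp only [β, Fin.mk_one, Matrix.cons_val_one, Matrix.cons_val_zero]; compute_degree; simp
    · simp only [β, Fin.reduceFinMk, Matrix.cons_val]; compute_degree
  have hev (x : ℂ) : (MvPolynomial.aeval β P).eval x =
      MvPolynomial.eval (slashVec τ ξ x e) P := by
    rw [eval_aeval_polynomial]
    congr 2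
    ext i
    fin_cases i <;> simp [β, slashVec, κ, mul_comm τ x]
  have key := norm_eval_le_of_nodes (p := MvPolynomial.aeval β P) (K := 6 * d)
    (natDegree_aeval_le P β hβ hd) (fun k ↦ ((k + 1 : ℕ) : ℂ)) (R := (6 * d + 2) ^ 2)
    (fun i _ j _ hij ↦ by
      have := hge (i + 1) (j + 1) (by omega)
      exact this)
    (fun k hk ↦ by
      rw [Complex.norm_natCast]
      have : k + 1 ≤ (6 * d + 2) ^ 2 := by nlinarith
      exact_mod_cast this)
    (fun k hk ↦ by
      rw [hev]
      exact hstep (k + 1) (by omega) (by omega) e) c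
  rw [hev] at key
  refine key.trans (le_of_eq ?_)
  rw [mul_pow]
  push_cast
  ring

/-- The part of `P` of degree `i` in the first variable and of weight `w` in the others. -/
noncomputable def isobaricPart (P : MvPolynomial (Fin 3) ℂ) (i w : ℕ) : MvPolynomial (Fin 3) ℂ :=
  ∑ m ∈ P.support with m 0 = i ∧ 4 * m 1 + 6 * m 2 = w,
    MvPolynomial.C (P.coeff m) * (MvPolynomial.X 1 ^ m 1 * MvPolynomial.X 2 ^ m 2)

lemma norm_eval_isobaricPart_le {P : MvPolynomial (Fin 3) ℂ} {ξ : Fin 3 → ℂ} {B : ℝ}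
    (hB : ∀ s v : ℂ, ‖s‖ = 1 → ‖v‖ = 1 →
      ‖MvPolynomial.eval ![s, v ^ 4 * ξ 1, v ^ 6 * ξ 2] P‖ ≤ B) (i w : ℕ) :
    ‖MvPolynomial.eval ξ (isobaricPart P i w)‖ ≤ B := by
  have h1 (v : ℂ) (hv : ‖v‖ = 1) : ‖∑ m ∈ P.support with m 0 = i,
      P.coeff m * ((v ^ 4 * ξ 1) ^ m 1 * (v ^ 6 * ξ 2) ^ m 2)‖ ≤ B := by
    have := Polynomial.norm_coeff_le_of_unit_circle (p := ∑ m ∈ P.support, Polynomial.monomial (m 0)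
      (P.coeff m * ((v ^ 4 * ξ 1) ^ m 1 * (v ^ 6 * ξ 2) ^ m 2))) (B := B) (fun s hs ↦ by
        convert hB s v hs hv using 2
        rw [Polynomial.eval_finsetSum, MvPolynomial.eval_eq']
        refine Finset.sum_congr rfl fun m _ ↦ ?_
        rw [Polynomial.eval_monomial, Fin.prod_univ_three]
        simp only [Matrix.cons_val]
        ring) i
    rw [Polynomial.finsetSum_coeff] at this
    simpa only [Polynomial.coeff_monomial, Finset.sum_filter] using this
  have h2 := Polynomial.norm_coeff_le_of_unit_circle (p := ∑ m ∈ P.support with m 0 = i,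
    Polynomial.monomial (4 * m 1 + 6 * m 2) (P.coeff m * (ξ 1 ^ m 1 * ξ 2 ^ m 2))) (B := B)
    (fun v hv ↦ by
      convert h1 v hv using 2
      rw [Polynomial.eval_finsetSum]
      refine Finset.sum_congr rfl fun m _ ↦ ?_
      rw [Polynomial.eval_monomial, mul_pow, mul_pow, ← pow_mul, ← pow_mul, pow_add]
      ring) w
  rw [Polynomial.finsetSum_coeff] at h2
  simp only [Polynomial.coeff_monomial] at h2
  rw [← Finset.sum_filter, Finset.filter_filter] at h2
  simpa [isobaricPart, MvPolynomial.eval_sum] using h2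

end Transform

section IsobaricBound

lemma norm_eisVec_le (i : Fin 3) {z : ℂ} (hz : 1 ≤ z.im) : ‖eisVec z i‖ ≤ 46448640 := by
  have h0 : 0 < z.im := by linarith
  have hn : ‖nome z‖ ≤ 1 / 2 := by
    rw [norm_nome]
    have h1 : Real.exp (-(2 * Real.pi * z.im)) ≤ Real.exp (-1) := by
      apply Real.exp_le_exp.mpr
      nlinarith [Real.pi_gt_three]
    refine h1.trans ?_
    rw [Real.exp_neg, one_div]
    refine inv_anti₀ (by norm_num) ?_
    linarith [Real.add_one_le_exp (1 : ℝ)]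
  have h := (isMajorized_eisSeries i (r := 1 / 2) (by norm_num) (by norm_num)).norm_le_of_hasSum
    (by norm_num) (M := 0) (by simp) hn (v := eisVec z i) (by
      simpa [eisSeries] using hasSum_eisVec i h0)
  norm_num at h
  exact h

lemma norm_eval_isobaricPart_eisVec_le {P : MvPolynomial (Fin 3) ℂ} {d : ℕ}
    (hd : P.totalDegree ≤ d) {ε : ℝ}
    (hε : ∀ z : ℂ, 1 / (6 * d + 2 : ℝ) ^ 4 ≤ z.im → ‖MvPolynomial.eval (eisVec z) P‖ ≤ ε)
    {τ : ℂ} (hτ : ‖τ‖ ≤ 2) (him : τ.im = 1) (i w : ℕ) :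
    ‖MvPolynomial.eval (eisVec τ) (isobaricPart P i w)‖ ≤
      (6 * d + 1) ^ 2 * ε * (10 ^ 16 * (6 * d + 2) ^ 4) ^ (6 * d) := by
  have hd2 : (0 : ℝ) < 6 * d + 2 := by positivity
  have hε0 : 0 ≤ ε := (norm_nonneg _).trans (hε τ (by
    rw [him, div_le_one (by positivity)]
    exact one_le_pow₀ (by linarith [(Nat.cast_nonneg d : (0 : ℝ) ≤ d)])))
  have hslash := norm_eval_slashVec_le hd hτ (eisVec τ) (ε := ε) fun c e hce hle ↦ by
    obtain ⟨w, hw, hv⟩ := exists_smul_eisVec (by rw [him]; exact one_pos : 0 < τ.im) hce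
    rw [slashVec, ← hv]
    refine hε w ?_
    rw [hw, him]
    have hpos : 0 < ‖(c * τ + e : ℂ)‖ := by
      rw [norm_pos_iff]
      intro h0
      have h1 := congrArg Complex.im h0
      have h2 := congrArg Complex.re h0
      simp [him] at h1 h2
      subst h1
      simp at h2
      subst h2
      exact not_isCoprime_zero_zero hce
    apply one_div_le_one_div_of_le (by positivity)
    calc ‖(c * τ + e : ℂ)‖ ^ 2 ≤ ((6 * d + 2 : ℝ) ^ 2) ^ 2 := by gcongr
      _ = _ := by ring
  refine norm_eval_isobaricPart_le (fun s v hs hv ↦ ?_) i w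
  have hκ : (6 : ℂ) / (Real.pi * I) ≠ 0 := by
    simp [Real.pi_ne_zero]
  have hκn : 1 ≤ ‖(6 : ℂ) / (Real.pi * I)‖ := by
    simp only [norm_div, norm_mul, norm_I, mul_one, Complex.norm_real, Real.norm_eq_abs,
      abs_of_pos Real.pi_pos, Complex.norm_ofNat]
    rw [le_div_iff₀ Real.pi_pos]
    linarith [Real.pi_lt_four]
  set κ := (6 : ℂ) / (Real.pi * I) with hκdef
  have hv0 : v ≠ 0 := by rw [← norm_pos_iff, hv]; exact one_pos
  have hξ : ‖eisVec τ 0‖ ≤ 46448640 := norm_eisVec_le 0 him.ge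
  set c := (s - v ^ 2 * eisVec τ 0) / (κ * v) with hc
  have hcn : ‖c‖ ≤ 46448641 := by
    rw [hc, norm_div, norm_mul, hv, mul_one]
    refine (div_le_self (norm_nonneg _) hκn).trans ((norm_sub_le _ _).trans ?_)
    rw [norm_mul, norm_pow, hs, hv]
    linarith
  have hen : ‖v - c * τ‖ ≤ 92897283 := by
    refine (norm_sub_le _ _).trans ?_
    rw [norm_mul, hv]
    nlinarith [norm_nonneg c, norm_nonneg τ]
  have h := hslash c (v - c * τ)
  have he : slashVec τ (eisVec τ) c (v - c * τ) = ![s, v ^ 4 * eisVec τ 1, v ^ 6 * eisVec τ 2] := by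
    rw [slashVec, show c * τ + (v - c * τ) = v by ring, ← hκdef]
    congr 1
    rw [hc]
    field_simp
    ring
  rw [he] at h
  refine h.trans ?_
  have hone : (1 : ℝ) ≤ (6 * d + 2 : ℝ) ^ 2 :=
    one_le_pow₀ (by linarith [(Nat.cast_nonneg d : (0 : ℝ) ≤ d)])
  refine mul_le_mul_of_nonneg_left (pow_le_pow_left₀ (by positivity) ?_ _) (by positivity)
  calc (‖v - c * τ‖ + (6 * d + 2) ^ 2) * (‖c‖ + (6 * d + 2) ^ 2)
      ≤ (10 ^ 8 * (6 * d + 2) ^ 2) * (10 ^ 8 * (6 * d + 2) ^ 2) := by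
        gcongr <;> linarith
    _ = _ := by ring

lemma exists_nome_eq {q : ℂ} (hq : ‖q‖ = Real.exp (-(2 * Real.pi))) :
    ∃ τ : ℂ, ‖τ‖ ≤ 2 ∧ τ.im = 1 ∧ nome τ = q := by
  have hq0 : q ≠ 0 := by rw [← norm_pos_iff, hq]; exact Real.exp_pos _
  have hpi := Real.pi_pos
  have hre : (log q / (2 * Real.pi * I)) = (q.arg / (2 * Real.pi) : ℝ) + (1 : ℝ) * I := by
    have : log q = (-(2 * Real.pi) : ℝ) + q.arg * I := by
      rw [Complex.log, hq, Real.log_exp]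
    rw [this]
    have : (Real.pi : ℂ) ≠ 0 := by simp [Real.pi_ne_zero]
    push_cast
    field_simp
    linear_combination (-2 * Real.pi : ℂ) * I_sq
  refine ⟨log q / (2 * Real.pi * I), ?_, ?_, ?_⟩
  · rw [hre]
    refine (norm_add_le _ _).trans ?_
    rw [Complex.norm_real, norm_mul, Complex.norm_real, norm_I, Real.norm_eq_abs, abs_div,
      abs_of_pos (by positivity : 0 < 2 * Real.pi)]
    have : |q.arg| / (2 * Real.pi) ≤ 1 := by
      rw [div_le_one (by positivity)]
      linarith [abs_arg_le_pi q]
    norm_num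
    linarith
  · rw [hre, add_im, ofReal_im]
    simp
  · rw [nome, mul_div_cancel₀ _ (by simp [Real.pi_ne_zero]), exp_log hq0]

lemma norm_coeff_qSeries_isobaricPart_le {P : MvPolynomial (Fin 3) ℂ} {d : ℕ}
    (hd : P.totalDegree ≤ d) {ε : ℝ}
    (hε : ∀ z : ℂ, 1 / (6 * d + 2 : ℝ) ^ 4 ≤ z.im → ‖MvPolynomial.eval (eisVec z) P‖ ≤ ε)
    (i w n : ℕ) :
    ‖(qSeries (isobaricPart P i w)).coeff n‖ ≤
      (6 * d + 1) ^ 2 * ε * (10 ^ 16 * (6 * d + 2) ^ 4) ^ (6 * d) * Real.exp (2 * Real.pi * n) := by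
  have h := norm_coeff_le_of_hasSum (ρ := Real.exp (-(2 * Real.pi))) (R := 1)
    (a := fun n ↦ (qSeries (isobaricPart P i w)).coeff n)
    (g := fun q ↦ ∑' n, (qSeries (isobaricPart P i w)).coeff n * q ^ n)
    (B := (6 * d + 1) ^ 2 * ε * (10 ^ 16 * (6 * d + 2) ^ 4) ^ (6 * d)) (Real.exp_pos _)
    (Real.exp_lt_one_iff.mpr (by linarith [Real.pi_pos]))
    (fun q hq ↦ by
      refine Summable.hasSum (Summable.of_norm ?_)
      have := (isMajorized_qSeries (A := isobaricPart P i w) le_rfl (norm_nonneg q) hq).summable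
        (norm_nonneg q)
      simpa only [norm_mul, norm_pow] using this)
    (fun q hq ↦ by
      obtain ⟨τ, h1, h2, rfl⟩ := exists_nome_eq hq
      rw [(evalsTo_qSeries _ (by rw [h2]; exact one_pos)).2.tsum_eq]
      exact norm_eval_isobaricPart_eisVec_le hd hε h1 h2 i w) n
  refine h.trans (le_of_eq ?_)
  rw [← Real.exp_nat_mul, div_eq_mul_inv, ← Real.exp_neg]
  congr 2
  ring

lemma qSeries_isobaricPart (P : MvPolynomial (Fin 3) ℂ) (i w : ℕ) :
    qSeries (isobaricPart P i w) = ∑ m ∈ P.support with m 0 = i ∧ 4 * m 1 + 6 * m 2 = w,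
      PowerSeries.C (P.coeff m) * (eisSeries 1 ^ m 1 * eisSeries 2 ^ m 2) := by
  simp [qSeries, isobaricPart, MvPolynomial.eval₂_sum]

lemma eq_zero_of_coeff_qSeries_isobaricPart {P : MvPolynomial (Fin 3) ℂ} {d : ℕ}
    (hd : P.totalDegree ≤ d)
    (h : ∀ i w, ∀ n ≤ d, (qSeries (isobaricPart P i w)).coeff n = 0) : P = 0 := by
  by_contra hP
  obtain ⟨m, hm⟩ := MvPolynomial.support_nonempty.mpr hP
  refine MvPolynomial.mem_support_iff.mp hm (eq_zero_of_X_pow_dvd_isobaric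
    (P.support.filter fun m' ↦ m' 0 = m 0 ∧ 4 * m' 1 + 6 * m' 2 = 4 * m 1 + 6 * m 2)
    (fun m ↦ m 1) (fun m ↦ m 2) (fun m ↦ P.coeff m) (w := 4 * m 1 + 6 * m 2) (d := d)
    (fun m' hm' ↦ (Finset.mem_filter.mp hm').2.2) (fun m' hm' ↦ ?_) ?_ ?_ m ?_)
  · have h1 := MvPolynomial.le_totalDegree (Finset.mem_filter.mp hm').1
    have h2 : m' 1 ≤ m'.sum fun _ e ↦ e := by
      rw [Finsupp.sum_fintype _ _ (fun _ ↦ rfl), Fin.sum_univ_three]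
      omega
    omega
  · intro x hx y hy hxy
    have hx' := (Finset.mem_filter.mp (Finset.mem_coe.mp hx)).2
    have hy' := (Finset.mem_filter.mp (Finset.mem_coe.mp hy)).2
    ext j
    fin_cases j
    · exact hx'.1.trans hy'.1.symm
    · exact hxy
    · show x 2 = y 2
      have : x 1 = y 1 := hxy
      omega
  · rw [← qSeries_isobaricPart, PowerSeries.X_pow_dvd_iff]
    exact fun n hn ↦ h _ _ n (by omega)
  · simp [hm]

/-- `E₂, E₄, E₆` are algebraically independent over `ℂ`. -/
lemma eq_zero_of_eval_eisVec {P : MvPolynomial (Fin 3) ℂ}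
    (h : ∀ z : ℂ, 0 < z.im → MvPolynomial.eval (eisVec z) P = 0) : P = 0 := by
  refine eq_zero_of_coeff_qSeries_isobaricPart le_rfl fun i w n _ ↦ ?_
  have := norm_coeff_qSeries_isobaricPart_le (P := P) le_rfl (ε := 0) (fun z hz ↦ by
    rw [h z (lt_of_lt_of_le (by positivity) hz), norm_zero]) i w n
  simpa using this

end IsobaricBound

section ZeroEstimate

lemma eisSeries_mem_range (i : Fin 3) :
    eisSeries i ∈ (PowerSeries.map (Int.castRingHom ℂ)).range :=
  ⟨PowerSeries.mk (eisCoeff i), by ext n; simp [eisSeries]⟩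

lemma intCast_C_mem_range (a : ℤ) :
    PowerSeries.C (a : ℂ) ∈ (PowerSeries.map (Int.castRingHom ℂ)).range :=
  ⟨PowerSeries.C a, by simp⟩

lemma exists_int_eq_coeff {f : PowerSeries ℂ} (hf : f ∈ (PowerSeries.map (Int.castRingHom ℂ)).range)
    (n : ℕ) : ∃ k : ℤ, f.coeff n = k := by
  obtain ⟨g, rfl⟩ := hf
  exact ⟨g.coeff n, by simp⟩

lemma qSeries_map_mem_range (A : MvPolynomial (Fin 3) ℤ) :
    qSeries (A.map (Int.castRingHom ℂ)) ∈ (PowerSeries.map (Int.castRingHom ℂ)).range := by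
  rw [qSeries, MvPolynomial.eval₂_map, MvPolynomial.eval₂_eq']
  exact sum_mem fun m _ ↦ mul_mem (by simp)
    (prod_mem fun i _ ↦ pow_mem (eisSeries_mem_range i) _)

lemma coeff_qSeries_isobaricPart_map (A : MvPolynomial (Fin 3) ℤ) (i w n : ℕ) :
    ∃ k : ℤ, (qSeries (isobaricPart (A.map (Int.castRingHom ℂ)) i w)).coeff n = k := by
  refine exists_int_eq_coeff ?_ n
  rw [qSeries_isobaricPart]
  refine sum_mem fun m _ ↦ mul_mem ?_ (mul_mem (pow_mem (eisSeries_mem_range 1) _)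
    (pow_mem (eisSeries_mem_range 2) _))
  rw [MvPolynomial.coeff_map]
  exact intCast_C_mem_range _

lemma mvLength_map_intCast {σ : Type*} (A : MvPolynomial σ ℤ) :
    mvLength (A.map (Int.castRingHom ℂ)) = mvLength A := by
  rw [mvLength, mvLength, MvPolynomial.support_map_of_injective _ (Int.cast_injective)]
  exact Finset.sum_congr rfl fun m _ ↦ by simp [MvPolynomial.coeff_map, Int.norm_eq_abs]

lemma totalDegree_map_intCast {σ : Type*} (A : MvPolynomial σ ℤ) :
    (A.map (Int.castRingHom ℂ)).totalDegree = A.totalDegree := by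
  rw [MvPolynomial.totalDegree, MvPolynomial.totalDegree,
    MvPolynomial.support_map_of_injective _ (Int.cast_injective)]

lemma exp_neg_two_le_one_sub_pow {M : ℕ} (hM : 2 ≤ M) :
    Real.exp (-2) ≤ (1 - 1 / M : ℝ) ^ M := by
  have hM' : (2 : ℝ) ≤ M := by exact_mod_cast hM
  have hM1 : (0 : ℝ) < M - 1 := by linarith
  have h1 : Real.exp (-(1 / (M - 1))) ≤ (1 - 1 / M : ℝ) := by
    rw [Real.exp_neg]
    calc (Real.exp (1 / (M - 1)))⁻¹ ≤ (1 / (M - 1) + 1 : ℝ)⁻¹ :=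
          inv_anti₀ (by positivity) (Real.add_one_le_exp _)
      _ = 1 - 1 / M := by
          have h0 : (M : ℝ) ≠ 0 := by linarith
          have h2 : (M - 1 : ℝ) ≠ 0 := hM1.ne'
          field_simp
          ring
  calc Real.exp (-2) ≤ Real.exp (M * -(1 / (M - 1))) := by
        apply Real.exp_le_exp.mpr
        rw [mul_neg, neg_le_neg_iff, mul_one_div, div_le_iff₀ hM1]
        linarith
    _ = Real.exp (-(1 / (M - 1))) ^ M := by rw [Real.exp_nat_mul]
    _ ≤ _ := pow_le_pow_left₀ (Real.exp_nonneg _) h1 M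

lemma nome_norm_le {d : ℕ} (hd : 8 ≤ d) {z : ℂ} (hz : 1 / (6 * d + 2 : ℝ) ^ 4 ≤ z.im) :
    ‖nome z‖ ≤ 1 - 1 / (d ^ 8 : ℕ) ∧ ‖nome z‖ ^ (d ^ 8) ≤ Real.exp (-((d : ℝ) ^ 4 / 1000)) := by
  have hd' : (8 : ℝ) ≤ d := by exact_mod_cast hd
  have hd0 : (0 : ℝ) < d := by linarith
  have him : 1 / (4096 * (d : ℝ) ^ 4) ≤ z.im := by
    refine le_trans ?_ hz
    apply one_div_le_one_div_of_le (by positivity)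
    calc (6 * d + 2 : ℝ) ^ 4 ≤ (8 * d) ^ 4 := by gcongr; linarith
      _ = _ := by ring
  set x : ℝ := 6 / (4096 * (d : ℝ) ^ 4) with hx
  have hx0 : 0 < x := by positivity
  have hle : ‖nome z‖ ≤ Real.exp (-x) := by
    rw [norm_nome]
    apply Real.exp_le_exp.mpr
    rw [neg_le_neg_iff]
    calc x = 6 * (1 / (4096 * (d : ℝ) ^ 4)) := by rw [hx]; ring
      _ ≤ 2 * Real.pi * z.im := by
        gcongr
        linarith [Real.pi_gt_three]
  constructor
  · refine hle.trans ?_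
    rw [Real.exp_neg]
    refine (inv_anti₀ (by positivity) (Real.add_one_le_exp x)).trans ?_
    rw [inv_le_iff_one_le_mul₀ (by positivity)]
    push_cast
    have h4 : (4096 : ℝ) ≤ d ^ 4 := by
      calc (4096 : ℝ) = 8 ^ 4 := by norm_num
        _ ≤ _ := by gcongr
    have h1 : 2 * (1 / (d : ℝ) ^ 8) ≤ x := by
      rw [hx, mul_one_div, div_le_div_iff₀ (by positivity) (by positivity)]
      nlinarith [pow_pos hd0 4]
    have h2 : x ≤ 1 := by
      rw [hx, div_le_one (by positivity)]
      linarith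
    have h3 : 0 < 1 / (d : ℝ) ^ 8 := by positivity
    nlinarith
  · calc ‖nome z‖ ^ (d ^ 8) ≤ Real.exp (-x) ^ (d ^ 8) := by gcongr
      _ = Real.exp (-((d : ℝ) ^ 4 * 6 / 4096)) := by
        rw [← Real.exp_nat_mul]
        congr 1
        push_cast
        rw [hx]
        field_simp
      _ ≤ _ := by
        apply Real.exp_le_exp.mpr
        nlinarith [pow_pos hd0 4]

/-- A weak zero estimate at the cusp for polynomials in `E₂, E₄, E₆` with integer coefficients. -/
lemma exists_coeff_qSeries_ne_zero (C : ℝ) : ∃ d₀ : ℕ, ∀ d ≥ d₀, ∀ A : MvPolynomial (Fin 3) ℤ,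
    A ≠ 0 → A.totalDegree ≤ d → mvLength A ≤ Real.exp (C * d ^ 2) →
    ∃ n < d ^ 8, (qSeries (A.map (Int.castRingHom ℂ))).coeff n ≠ 0 := by
  refine ⟨max 8 ⌈1000 * (C + 600)⌉₊, fun d hd A hA hdeg hlen ↦ ?_⟩
  have hd8 : 8 ≤ d := (le_max_left _ _).trans hd
  have hdC : 1000 * (C + 600) ≤ d :=
    (Nat.le_ceil _).trans (by exact_mod_cast (le_max_right _ _).trans hd)
  have hd' : (8 : ℝ) ≤ d := by exact_mod_cast hd8
  by_contra! hcon
  apply hA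
  apply MvPolynomial.map_injective (Int.castRingHom ℂ) Int.cast_injective
  rw [map_zero]
  set P := A.map (Int.castRingHom ℂ) with hP
  have hPd : P.totalDegree ≤ d := by rwa [hP, totalDegree_map_intCast]
  have hM2 : 2 ≤ d ^ 8 := by
    calc 2 ≤ 8 ^ 8 := by norm_num
      _ ≤ d ^ 8 := by gcongr
  have hM2' : (2 : ℝ) ≤ (d ^ 8 : ℕ) := by exact_mod_cast hM2
  set M := d ^ 8 with hM
  have hMinv : 1 / (M : ℝ) ≤ 1 / 2 := one_div_le_one_div_of_le two_pos hM2'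
  have hMpos : 0 < 1 / (M : ℝ) := by positivity
  have hcast : (d : ℝ) ≤ Real.exp d := by linarith [Real.add_one_le_exp (d : ℝ)]
  have h1000 : (1000 : ℝ) ≤ Real.exp 10 := by
    calc (1000 : ℝ) ≤ 2 ^ 10 := by norm_num
      _ ≤ Real.exp 1 ^ 10 := by gcongr; linarith [Real.add_one_le_exp (1 : ℝ)]
      _ = _ := by rw [← Real.exp_nat_mul]; norm_num
  have hS : mvLength P * (362880 / (1 - (1 - 1 / (M : ℝ))) ^ 7) ^ d ≤
      Real.exp ((C + 76) * d ^ 2) := by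
    rw [hP, mvLength_map_intCast]
    have h1 : (362880 / (1 - (1 - 1 / (M : ℝ))) ^ 7) ≤ Real.exp (20 + 56 * d) := by
      rw [sub_sub_cancel, one_div, inv_pow, div_inv_eq_mul, Real.exp_add]
      gcongr
      · calc (362880 : ℝ) ≤ 1000 ^ 2 := by norm_num
          _ ≤ Real.exp 10 ^ 2 := by gcongr
          _ = _ := by rw [← Real.exp_nat_mul]; norm_num
      · rw [hM]
        push_cast
        calc (((d : ℝ) ^ 8) ^ 7) = d ^ 56 := by ring
          _ ≤ Real.exp d ^ 56 := by gcongr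
          _ = _ := by rw [← Real.exp_nat_mul]; norm_num
    calc mvLength A * (362880 / (1 - (1 - 1 / (M : ℝ))) ^ 7) ^ d
        ≤ Real.exp (C * d ^ 2) * Real.exp (20 + 56 * d) ^ d := by
          gcongr
          all_goals rw [sub_sub_cancel]; positivity
      _ = Real.exp (C * d ^ 2 + d * (20 + 56 * d)) := by
          rw [← Real.exp_nat_mul, ← Real.exp_add]
      _ ≤ _ := by
          apply Real.exp_le_exp.mpr
          nlinarith
  have hsmall (z : ℂ) (hz : 1 / (6 * d + 2 : ℝ) ^ 4 ≤ z.im) :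
      ‖MvPolynomial.eval (eisVec z) P‖ ≤ Real.exp ((C + 78) * d ^ 2 - (d : ℝ) ^ 4 / 1000) := by
    have hz0 : 0 < z.im := lt_of_lt_of_le (by positivity) hz
    obtain ⟨hq1, hq2⟩ := nome_norm_le hd8 hz
    rw [← hM] at hq1 hq2
    have h := (isMajorized_qSeries hPd (r := 1 - 1 / (M : ℝ)) (by linarith)
      (by linarith)).norm_le_of_hasSum (by linarith) hcon hq1 (evalsTo_qSeries P hz0).2
    refine h.trans ?_
    calc (‖nome z‖ / (1 - 1 / (M : ℝ))) ^ M * (mvLength P * (362880 / (1 - (1 - 1 / (M : ℝ))) ^ 7) ^ d)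
        ≤ (Real.exp (-((d : ℝ) ^ 4 / 1000)) / Real.exp (-2)) * Real.exp ((C + 76) * d ^ 2) := by
          rw [div_pow]
          gcongr
          · exact (isMajorized_qSeries hPd (r := 1 - 1 / (M : ℝ)) (by linarith)
              (by linarith)).nonneg
          · exact exp_neg_two_le_one_sub_pow hM2
      _ = Real.exp (-((d : ℝ) ^ 4 / 1000) - (-2) + (C + 76) * d ^ 2) := by
          rw [Real.exp_add, Real.exp_sub]
      _ ≤ _ := by
          apply Real.exp_le_exp.mpr
          nlinarith
  refine eq_zero_of_coeff_qSeries_isobaricPart hPd fun i w n hn ↦ ?_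
  obtain ⟨k, hk⟩ := coeff_qSeries_isobaricPart_map A i w n
  have h := norm_coeff_qSeries_isobaricPart_le hPd hsmall i w n
  rw [← hP] at hk
  rw [hk] at h ⊢
  suffices hlt : ‖(k : ℂ)‖ < 1 by
    rw [Complex.norm_intCast] at hlt
    have : |k| < 1 := by exact_mod_cast hlt
    rw [Int.abs_lt_one_iff.mp this, Int.cast_zero]
  refine h.trans_lt ?_
  have hn' : (n : ℝ) ≤ d := by exact_mod_cast hn
  have e1 : (6 * d + 1 : ℝ) ^ 2 ≤ Real.exp (12 * d) := by
    calc (6 * d + 1 : ℝ) ^ 2 ≤ Real.exp (6 * d) ^ 2 := by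
          gcongr; exact Real.add_one_le_exp _
      _ = _ := by rw [← Real.exp_nat_mul]; congr 1; push_cast; ring
  have e2 : (10 ^ 16 * (6 * d + 2 : ℝ) ^ 4) ^ (6 * d) ≤ Real.exp (6 * d * (64 + 24 * d)) := by
    calc (10 ^ 16 * (6 * d + 2 : ℝ) ^ 4) ^ (6 * d)
        ≤ (Real.exp 60 * Real.exp (6 * d + 1) ^ 4) ^ (6 * d) := by
          gcongr
          · calc (10 : ℝ) ^ 16 ≤ 1000 ^ 6 := by norm_num
              _ ≤ Real.exp 10 ^ 6 := by gcongr
              _ = _ := by rw [← Real.exp_nat_mul]; norm_num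
          · linarith [Real.add_one_le_exp (6 * d + 1 : ℝ)]
      _ = _ := by
          rw [← Real.exp_nat_mul, ← Real.exp_add, ← Real.exp_nat_mul]
          congr 1; push_cast; ring
  have e3 : Real.exp (2 * Real.pi * n) ≤ Real.exp (8 * d) := by
    apply Real.exp_le_exp.mpr
    have := Real.pi_lt_four
    have := Real.pi_pos
    have : (0 : ℝ) ≤ n := Nat.cast_nonneg n
    nlinarith
  calc (6 * d + 1 : ℝ) ^ 2 * Real.exp ((C + 78) * d ^ 2 - (d : ℝ) ^ 4 / 1000) *
        (10 ^ 16 * (6 * d + 2) ^ 4) ^ (6 * d) * Real.exp (2 * Real.pi * n)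
      ≤ Real.exp (12 * d) * Real.exp ((C + 78) * d ^ 2 - (d : ℝ) ^ 4 / 1000) *
        Real.exp (6 * d * (64 + 24 * d)) * Real.exp (8 * d) := by gcongr
    _ = Real.exp (12 * d + ((C + 78) * d ^ 2 - (d : ℝ) ^ 4 / 1000) + 6 * d * (64 + 24 * d) +
          8 * d) := by rw [Real.exp_add, Real.exp_add, Real.exp_add]
    _ < 1 := by
        rw [Real.exp_lt_one_iff]
        have h1 : 1000 * (C + 600) * d ^ 2 ≤ d * d ^ 2 := by gcongr
        have h2 : (8 : ℝ) * (d * d ^ 2) ≤ d * (d * d ^ 2) := by gcongr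
        have h3 : (8 : ℝ) * d ≤ d ^ 2 := by nlinarith
        have h4 : (0 : ℝ) < d * d ^ 2 := by positivity
        nlinarith

end ZeroEstimate

section Auxiliary

/-- The monomial with given exponents. -/
noncomputable def boxExponent {N : ℕ} (β : Fin 3 → Fin N) : Fin 3 →₀ ℕ :=
  Finsupp.equivFunOnFinite.symm fun i ↦ (β i : ℕ)

lemma boxExponent_injective {N : ℕ} : Function.Injective (boxExponent (N := N)) := by
  intro β γ h
  ext i
  exact DFunLike.congr_fun h i

lemma norm_coeff_qSeries_monomial_le {m : Fin 3 →₀ ℕ} {d K k : ℕ} (hm : ∑ i, m i ≤ d)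
    (hK : 2 ≤ K) (hk : k ≤ K) :
    ‖(qSeries (MvPolynomial.monomial m 1)).coeff k‖ ≤
      Real.exp 2 * (362880 * (K : ℝ) ^ 7) ^ d := by
  have hK' : (2 : ℝ) ≤ K := by exact_mod_cast hK
  have hKinv : 1 / (K : ℝ) ≤ 1 / 2 := one_div_le_one_div_of_le two_pos hK'
  have hKpos : 0 < 1 / (K : ℝ) := by positivity
  have hdeg : (MvPolynomial.monomial m (1 : ℂ)).totalDegree ≤ d := by
    rw [MvPolynomial.totalDegree_monomial _ one_ne_zero, Finsupp.sum_fintype _ _ (fun _ ↦ rfl)]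
    exact hm
  have h := (isMajorized_qSeries hdeg (r := 1 - 1 / K) (by linarith)
    (by linarith)).norm_coeff_mul_pow_le (by linarith) k
  have hlen : mvLength (MvPolynomial.monomial m (1 : ℂ)) = 1 := by
    rw [mvLength, MvPolynomial.support_monomial, if_neg one_ne_zero]
    simp
  rw [hlen, one_mul, sub_sub_cancel, one_div, inv_pow, div_inv_eq_mul] at h
  have h2 : Real.exp (-2) ≤ (1 - (K : ℝ)⁻¹) ^ k := by
    rw [← one_div]
    exact (exp_neg_two_le_one_sub_pow hK).trans
      (pow_le_pow_of_le_one (by linarith) (by linarith) hk)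
  set x := ‖(qSeries (MvPolynomial.monomial m 1)).coeff k‖ with hx
  have hx0 : 0 ≤ x := norm_nonneg _
  calc x = Real.exp 2 * (x * Real.exp (-2)) := by
        rw [mul_left_comm, ← Real.exp_add]; simp
    _ ≤ Real.exp 2 * (x * (1 - (K : ℝ)⁻¹) ^ k) := by gcongr
    _ ≤ _ := by gcongr

lemma exists_aux_polynomial (L : ℕ) (hL : 1 ≤ L) : ∃ A : MvPolynomial (Fin 3) ℤ, A ≠ 0 ∧
    A.totalDegree ≤ 6 * L ∧
    mvLength A ≤ (8 * L ^ 3) ^ 2 * (Real.exp 2 * (362880 * (8 * L ^ 3 : ℝ) ^ 7) ^ (6 * L)) ∧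
    ∀ n < 4 * L ^ 3, (qSeries (A.map (Int.castRingHom ℂ))).coeff n = 0 := by
  classical
  have hL3 : 1 ≤ L ^ 3 := Nat.one_le_pow _ _ hL
  have hInt (k : Fin (4 * L ^ 3)) (β : Fin 3 → Fin (2 * L)) : ∃ c : ℤ,
      (qSeries (MvPolynomial.monomial (boxExponent β) 1)).coeff k = c := by
    have := qSeries_map_mem_range (MvPolynomial.monomial (boxExponent β) 1)
    rw [MvPolynomial.map_monomial, map_one] at this
    exact exists_int_eq_coeff this k
  choose Mat hMat using hInt
  have hcard : Fintype.card (Fin 3 → Fin (2 * L)) = 8 * L ^ 3 := by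
    rw [Fintype.card_pi_const, Fintype.card_fin]; ring
  obtain ⟨t, ht0, ht, htn⟩ := Int.Matrix.exists_ne_zero_int_vec_norm_le (Matrix.of Mat)
    (by rw [hcard, Fintype.card_fin]; omega) (by rw [Fintype.card_fin]; omega)
  have hsum (β : Fin 3 → Fin (2 * L)) : ∑ i, boxExponent β i ≤ 6 * L := by
    rw [Fin.sum_univ_three]
    have h0 := (β 0).2
    have h1 := (β 1).2
    have h2 := (β 2).2
    simp only [boxExponent, Finsupp.equivFunOnFinite_symm_apply_apply]
    omega
  set E : ℝ := Real.exp 2 * (362880 * (8 * L ^ 3 : ℝ) ^ 7) ^ (6 * L) with hE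
  have hLr : (1 : ℝ) ≤ (L : ℝ) ^ 3 := by exact_mod_cast hL3
  have hE1 : 1 ≤ E := by
    rw [hE]
    refine one_le_mul_of_one_le_of_one_le (Real.one_le_exp (by norm_num)) (one_le_pow₀ ?_)
    refine one_le_mul_of_one_le_of_one_le (by norm_num) (one_le_pow₀ (by linarith))
  have hnorm : ‖t‖ ≤ 8 * L ^ 3 * E := by
    refine htn.trans ?_
    have h1 : ((Fintype.card (Fin (4 * L ^ 3)) : ℝ) /
        (Fintype.card (Fin 3 → Fin (2 * L)) - Fintype.card (Fin (4 * L ^ 3)))) = 1 := by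
      rw [hcard, Fintype.card_fin]
      push_cast
      rw [show (8 * (L : ℝ) ^ 3 - 4 * L ^ 3) = 4 * L ^ 3 by ring, div_self (by positivity)]
    rw [h1, Real.rpow_one, hcard]
    push_cast
    gcongr
    refine max_le hE1 ?_
    rw [Matrix.norm_le_iff (by linarith)]
    intro k β
    have h2 := norm_coeff_qSeries_monomial_le (hsum β) (K := 8 * L ^ 3) (k := k) (by omega)
      (by have := k.2; omega)
    rw [hMat k β, Complex.norm_intCast] at h2
    rw [Matrix.of_apply, Int.norm_eq_abs]
    push_cast at h2
    exact h2
  set A : MvPolynomial (Fin 3) ℤ := ∑ β, MvPolynomial.monomial (boxExponent β) (t β) with hA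
  have hcoeff (β : Fin 3 → Fin (2 * L)) : A.coeff (boxExponent β) = t β := by
    rw [hA, MvPolynomial.coeff_sum, Finset.sum_eq_single β]
    · simp
    · intro γ _ hγ
      rw [MvPolynomial.coeff_monomial, if_neg (fun h ↦ hγ (boxExponent_injective h))]
    · simp
  have hsupp : A.support ⊆ Finset.univ.image (boxExponent (N := 2 * L)) := by
    intro m hm
    by_contra hcon
    refine MvPolynomial.mem_support_iff.mp hm ?_
    rw [hA, MvPolynomial.coeff_sum]
    refine Finset.sum_eq_zero fun β _ ↦ ?_
    rw [MvPolynomial.coeff_monomial, if_neg]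
    rintro rfl
    exact hcon (Finset.mem_image_of_mem _ (Finset.mem_univ _))
  refine ⟨A, ?_, ?_, ?_, fun n hn ↦ ?_⟩
  · intro h0
    apply ht0
    ext β
    rw [← hcoeff, h0]
    rfl
  · refine Finset.sup_le fun m hm ↦ ?_
    obtain ⟨β, -, rfl⟩ := Finset.mem_image.mp (hsupp hm)
    rw [Finsupp.sum_fintype _ _ (fun _ ↦ rfl)]
    exact hsum β
  · calc mvLength A ≤ ∑ m ∈ Finset.univ.image (boxExponent (N := 2 * L)), ‖A.coeff m‖ :=
          Finset.sum_le_sum_of_subset_of_nonneg hsupp fun _ _ _ ↦ norm_nonneg _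
      _ = ∑ β, ‖t β‖ := by
          rw [Finset.sum_image fun _ _ _ _ h ↦ boxExponent_injective h]
          simp_rw [hcoeff]
      _ ≤ ∑ _β : Fin 3 → Fin (2 * L), (8 * L ^ 3 * E) :=
          Finset.sum_le_sum fun β _ ↦ (norm_le_pi_norm t β).trans hnorm
      _ = _ := by
          rw [Finset.sum_const, Finset.card_univ, hcard, nsmul_eq_mul]
          push_cast
          ring
  · have h1 : qSeries (A.map (Int.castRingHom ℂ)) =
        ∑ β, PowerSeries.C (t β : ℂ) * qSeries (MvPolynomial.monomial (boxExponent β) 1) := by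
      rw [hA]
      simp only [qSeries, map_sum, MvPolynomial.eval₂_sum, MvPolynomial.map_monomial,
        MvPolynomial.eval₂_monomial, map_one, one_mul, eq_intCast]
    rw [h1, map_sum]
    simp_rw [PowerSeries.coeff_C_mul]
    have h2 := congrFun ht ⟨n, hn⟩
    simp only [Matrix.mulVec, dotProduct, Matrix.of_apply, Pi.zero_apply] at h2
    have h3 : ∑ β, (t β : ℂ) * Mat ⟨n, hn⟩ β = 0 := by
      rw [← Int.cast_zero, ← h2]
      push_cast
      exact Finset.sum_congr rfl fun _ _ ↦ mul_comm _ _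
    rw [← h3]
    exact Finset.sum_congr rfl fun β _ ↦ by rw [← hMat ⟨n, hn⟩ β]

lemma natCast_le_exp (n : ℕ) : (n : ℝ) ≤ Real.exp n := by
  linarith [Real.add_one_le_exp (n : ℝ)]

lemma thousand_le_exp_ten : (1000 : ℝ) ≤ Real.exp 10 := by
  calc (1000 : ℝ) ≤ 2 ^ 10 := by norm_num
    _ ≤ Real.exp 1 ^ 10 := by gcongr; linarith [Real.add_one_le_exp (1 : ℝ)]
    _ = _ := by rw [← Real.exp_nat_mul]; norm_num

lemma aux_length_le {s : ℕ} (hs : 1 ≤ s) :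
    (8 * ((s ^ 5 : ℕ) : ℝ) ^ 3) ^ 2 *
      (Real.exp 2 * (362880 * (8 * ((s ^ 5 : ℕ) : ℝ) ^ 3) ^ 7) ^ (6 * s ^ 5)) ≤
    Real.exp (2000 * s ^ 6) := by
  have hs' : (1 : ℝ) ≤ s := by exact_mod_cast hs
  have h8 : (8 * ((s ^ 5 : ℕ) : ℝ) ^ 3) ≤ Real.exp (25 * s) := by
    push_cast
    calc 8 * ((s : ℝ) ^ 5) ^ 3 ≤ Real.exp 10 * (Real.exp s) ^ 15 := by
          rw [← pow_mul]
          gcongr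
          · linarith [thousand_le_exp_ten]
          · exact natCast_le_exp s
      _ = Real.exp (10 + 15 * s) := by rw [← Real.exp_nat_mul, ← Real.exp_add]; norm_num
      _ ≤ _ := Real.exp_le_exp.mpr (by linarith)
  calc (8 * ((s ^ 5 : ℕ) : ℝ) ^ 3) ^ 2 *
        (Real.exp 2 * (362880 * (8 * ((s ^ 5 : ℕ) : ℝ) ^ 3) ^ 7) ^ (6 * s ^ 5))
      ≤ Real.exp (25 * s) ^ 2 *
        (Real.exp 2 * (Real.exp 10 ^ 2 * Real.exp (25 * s) ^ 7) ^ (6 * s ^ 5)) := by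
        gcongr
        nlinarith [thousand_le_exp_ten]
    _ = Real.exp (2 * (25 * s) + (2 + 6 * s ^ 5 * (2 * 10 + 7 * (25 * s)))) := by
        simp only [← Real.exp_nat_mul, ← Real.exp_add]
        congr 1
        push_cast
        ring
    _ ≤ _ := by
        apply Real.exp_le_exp.mpr
        have h5 : (1 : ℝ) ≤ (s : ℝ) ^ 5 := one_le_pow₀ hs'
        have h6 : (s : ℝ) ^ 6 = s * s ^ 5 := by ring
        have h7 : (s : ℝ) ≤ s * s ^ 5 := le_mul_of_one_le_right (by linarith) h5
        have h8 : (s : ℝ) ^ 5 ≤ s * s ^ 5 := le_mul_of_one_le_left (by linarith) hs'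
        rw [h6]
        nlinarith

/-- Auxiliary polynomials with a high order of vanishing at the cusp. -/
lemma exists_aux_sequence : ∃ s₀ : ℕ, ∀ s ≥ s₀, ∃ (A : MvPolynomial (Fin 3) ℤ) (M : ℕ),
    A.totalDegree ≤ 6 * s ^ 5 ∧ mvLength A ≤ Real.exp (2000 * s ^ 6) ∧ 4 * s ^ 15 ≤ M ∧
    M ≤ (6 * s ^ 5) ^ 8 ∧ (∀ n < M, (qSeries (A.map (Int.castRingHom ℂ))).coeff n = 0) ∧
    1 ≤ ‖(qSeries (A.map (Int.castRingHom ℂ))).coeff M‖ := by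
  classical
  obtain ⟨d₀, hd₀⟩ := exists_coeff_qSeries_ne_zero 2000
  refine ⟨max 1 d₀, fun s hs ↦ ?_⟩
  have hs1 : 1 ≤ s := (le_max_left _ _).trans hs
  have hsd : d₀ ≤ s := (le_max_right _ _).trans hs
  have hs' : (1 : ℝ) ≤ s := by exact_mod_cast hs1
  obtain ⟨A, hA0, hdeg, hlen, hvan⟩ := exists_aux_polynomial (s ^ 5) (Nat.one_le_pow _ _ hs1)
  have hlen' := hlen.trans (aux_length_le hs1)
  have hex := hd₀ (6 * s ^ 5) (by
    calc d₀ ≤ s := hsd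
      _ ≤ s ^ 5 := Nat.le_self_pow (by norm_num) s
      _ ≤ _ := by omega) A hA0 hdeg (hlen'.trans (by
        apply Real.exp_le_exp.mpr
        push_cast
        calc 2000 * (s : ℝ) ^ 6 ≤ 2000 * (s : ℝ) ^ 10 := by
              gcongr
              norm_num
          _ ≤ 2000 * (36 * (s : ℝ) ^ 10) := by
              gcongr
              linarith [pow_pos (lt_of_lt_of_le one_pos hs') 10]
          _ = _ := by ring))
  have hex' : ∃ n, (qSeries (A.map (Int.castRingHom ℂ))).coeff n ≠ 0 := by
    obtain ⟨n, -, h⟩ := hex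
    exact ⟨n, h⟩
  refine ⟨A, Nat.find hex', hdeg, hlen', ?_, ?_, fun n hn ↦ not_not.mp (Nat.find_min hex' hn), ?_⟩
  · by_contra! hlt
    refine Nat.find_spec hex' (hvan _ ?_)
    rw [← pow_mul]
    exact hlt
  · obtain ⟨n, hn, h⟩ := hex
    exact (Nat.find_min' hex' h).trans hn.le
  · obtain ⟨k, hk⟩ := exists_int_eq_coeff (qSeries_map_mem_range A) (Nat.find hex')
    have h0 := Nat.find_spec hex'
    rw [hk] at h0 ⊢
    rw [Complex.norm_intCast]
    exact_mod_cast Int.one_le_abs (by exact_mod_cast h0 : k ≠ 0)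

end Auxiliary

section Schwarz

lemma exists_eq_sub_pow_mul {c : ℂ} {R : ℝ} (hc : c ∈ Metric.ball (0 : ℂ) R) (n : ℕ) {f : ℂ → ℂ}
    (hf : DifferentiableOn ℂ f (Metric.ball 0 R)) (hn : n ≤ analyticOrderAt f c) :
    ∃ g : ℂ → ℂ, DifferentiableOn ℂ g (Metric.ball 0 R) ∧ ∀ q, f q = (q - c) ^ n * g q := by
  have hnhds : Metric.ball (0 : ℂ) R ∈ nhds c := Metric.isOpen_ball.mem_nhds hc
  induction n generalizing f with
  | zero => exact ⟨f, hf, by simp⟩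
  | succ n ih =>
    have hfa : AnalyticAt ℂ f c := hf.analyticAt hnhds
    have hf0 : f c = 0 := by
      by_contra h
      rw [hfa.analyticOrderAt_eq_zero.mpr h] at hn
      simp at hn
    have hd : DifferentiableOn ℂ (dslope f c) (Metric.ball 0 R) :=
      (Complex.differentiableOn_dslope hnhds).mpr hf
    have he (q : ℂ) : f q = (q - c) * dslope f c q := by
      have := sub_smul_dslope f c q
      rw [hf0, sub_zero, smul_eq_mul] at this
      exact this.symm
    have hda : AnalyticAt ℂ (dslope f c) c := hd.analyticAt hnhds
    have hord : analyticOrderAt f c = 1 + analyticOrderAt (dslope f c) c := by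
      have h1 : f = (fun q ↦ q - c) * dslope f c := funext he
      conv_lhs => rw [h1]
      rw [analyticOrderAt_mul (by fun_prop) hda]
      congr 1
      have h2 : AnalyticAt ℂ (fun q : ℂ ↦ q - c) c := by fun_prop
      exact (h2.analyticOrderAt_eq_natCast (n := 1)).mpr ⟨fun _ ↦ 1, by fun_prop, by simp, by simp⟩
    obtain ⟨g, hg, hg'⟩ := ih hd (by
      rw [hord, Nat.cast_succ, add_comm] at hn
      exact (ENat.add_le_add_iff_left (by simp)).mp hn)
    exact ⟨g, hg, fun q ↦ by rw [he, hg', pow_succ']; ring⟩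

/-- The Blaschke-factor estimate for a function with a multiple zero. -/
lemma norm_mul_pow_le_of_analyticOrderAt {f : ℂ → ℂ} (hf : DifferentiableOn ℂ f (Metric.ball 0 1))
    {c : ℂ} {r B : ℝ} (hc : 0 < ‖c‖) (hcr : ‖c‖ < r) (hr : r < 1) {T : ℕ}
    (hT : T ≤ analyticOrderAt f c) (hB : ∀ q, ‖q‖ = r → ‖f q‖ ≤ B) :
    ‖f 0‖ * (r / ‖c‖) ^ T ≤ B := by
  have hr0 : 0 < r := hc.trans hcr
  obtain ⟨g, hg, hfg⟩ := exists_eq_sub_pow_mul (c := c) (R := 1) (by simp; linarith) T hf hT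
  set h : ℂ → ℂ := fun q ↦ g q * ((r : ℂ) ^ 2 - (starRingEnd ℂ) c * q) ^ T with hh
  have hd : DifferentiableOn ℂ h (Metric.ball 0 1) := by
    refine hg.mul (DifferentiableOn.pow ?_ T)
    fun_prop
  have hcl : DiffContOnCl ℂ h (Metric.ball 0 r) := by
    refine DifferentiableOn.diffContOnCl ?_
    rw [closure_ball _ hr0.ne']
    exact hd.mono (Metric.closedBall_subset_ball hr)
  have hbd (q : ℂ) (hq : ‖q‖ = r) : ‖h q‖ ≤ B * r ^ T := by
    have h1 : ‖(r : ℂ) ^ 2 - (starRingEnd ℂ) c * q‖ = r * ‖q - c‖ := by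
      have : (r : ℂ) ^ 2 = q * (starRingEnd ℂ) q := by
        rw [Complex.mul_conj, Complex.normSq_eq_norm_sq, hq]; push_cast; rfl
      rw [this, show q * (starRingEnd ℂ) q - (starRingEnd ℂ) c * q =
        q * (starRingEnd ℂ) (q - c) by rw [map_sub]; ring, norm_mul, hq, Complex.norm_conj]
    rw [hh]
    simp only [norm_mul, norm_pow]
    rw [h1, mul_pow]
    have h2 := hB q hq
    rw [hfg q, norm_mul, norm_pow] at h2
    calc ‖g q‖ * (r ^ T * ‖q - c‖ ^ T) = (‖q - c‖ ^ T * ‖g q‖) * r ^ T := by ring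
      _ ≤ _ := by gcongr
  have hmax := Complex.norm_le_of_forall_mem_frontier_norm_le Metric.isBounded_ball hcl
    (C := B * r ^ T) (fun q hq ↦ hbd q (by
      rw [frontier_ball _ hr0.ne'] at hq
      simpa using hq)) (z := 0) (subset_closure (by simpa using hr0))
  simp only [hh, mul_zero, sub_zero, norm_mul, norm_pow, Complex.norm_real, Real.norm_eq_abs,
    abs_of_pos hr0] at hmax
  rw [hfg 0, norm_mul, norm_pow, zero_sub, norm_neg, div_pow]
  have hrT : 0 < r ^ T := by positivity
  have h3 : ‖g 0‖ * r ^ T ≤ B := by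
    refine le_of_mul_le_mul_right ?_ hrT
    calc ‖g 0‖ * r ^ T * r ^ T = ‖g 0‖ * (r ^ 2) ^ T := by ring
      _ ≤ _ := hmax
  calc ‖c‖ ^ T * ‖g 0‖ * (r ^ T / ‖c‖ ^ T) = ‖g 0‖ * r ^ T := by field_simp
    _ ≤ B := h3

end Schwarz

section Length

variable {σ R : Type*} [NormedCommRing R]

lemma mvLength_nonneg (A : MvPolynomial σ R) : 0 ≤ mvLength A :=
  Finset.sum_nonneg fun _ _ ↦ norm_nonneg _

lemma mvLength_eq_sum_of_subset (A : MvPolynomial σ R) {s : Finset (σ →₀ ℕ)} (h : A.support ⊆ s) :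
    mvLength A = ∑ m ∈ s, ‖A.coeff m‖ :=
  Finset.sum_subset h fun m _ hm ↦ by rw [MvPolynomial.notMem_support_iff.mp hm, norm_zero]

lemma mvLength_add_le (A B : MvPolynomial σ R) : mvLength (A + B) ≤ mvLength A + mvLength B := by
  classical
  rw [mvLength_eq_sum_of_subset (A + B) MvPolynomial.support_add,
    mvLength_eq_sum_of_subset A Finset.subset_union_left,
    mvLength_eq_sum_of_subset B Finset.subset_union_right, ← Finset.sum_add_distrib]
  exact Finset.sum_le_sum fun m _ ↦ by rw [MvPolynomial.coeff_add]; exact norm_add_le _ _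

lemma mvLength_sum_le {ι : Type*} (s : Finset ι) (A : ι → MvPolynomial σ R) :
    mvLength (∑ i ∈ s, A i) ≤ ∑ i ∈ s, mvLength (A i) := by
  classical
  induction s using Finset.induction_on with
  | empty => simp [mvLength]
  | insert a s ha ih =>
    rw [Finset.sum_insert ha, Finset.sum_insert ha]
    exact (mvLength_add_le _ _).trans (by gcongr)

lemma mvLength_monomial_le (m : σ →₀ ℕ) (a : R) : mvLength (MvPolynomial.monomial m a) ≤ ‖a‖ := by
  classical
  rw [mvLength_eq_sum_of_subset _ MvPolynomial.support_monomial_subset, Finset.sum_singleton,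
    MvPolynomial.coeff_monomial, if_pos rfl]

lemma mvLength_mul_le (A B : MvPolynomial σ R) : mvLength (A * B) ≤ mvLength A * mvLength B := by
  conv_lhs => rw [A.as_sum, B.as_sum]
  rw [Finset.sum_mul_sum]
  simp_rw [MvPolynomial.monomial_mul]
  refine (mvLength_sum_le _ _).trans ?_
  rw [mvLength, mvLength, Finset.sum_mul_sum]
  refine Finset.sum_le_sum fun m _ ↦ (mvLength_sum_le _ _).trans (Finset.sum_le_sum fun n _ ↦ ?_)
  exact (mvLength_monomial_le _ _).trans (norm_mul_le _ _)

end Length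

section Derivation

/-- The derivation of `R[X, Y, Z]` which corresponds to `(12 / 2πi) d/dz` by Ramanujan's
identities. -/
noncomputable def ramanujanDeriv (R : Type*) [CommRing R] :
    Derivation R (MvPolynomial (Fin 3) R) (MvPolynomial (Fin 3) R) :=
  MvPolynomial.mkDerivation R fun i ↦ (ramanujanPoly i).map (Int.castRingHom R)

lemma map_ramanujanDeriv {R S : Type*} [CommRing R] [CommRing S] (f : R →+* S)
    (P : MvPolynomial (Fin 3) R) :
    (ramanujanDeriv R P).map f = ramanujanDeriv S (P.map f) := by
  induction P using MvPolynomial.induction_on with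
  | C a => simp [ramanujanDeriv]
  | add p q hp hq => simp [hp, hq]
  | mul_X p i hp =>
    have e : f.comp (Int.castRingHom R) = Int.castRingHom S := RingHom.ext_int _ _
    simp only [Derivation.leibniz, smul_eq_mul, map_add, map_mul, hp, MvPolynomial.map_X]
    simp only [ramanujanDeriv, MvPolynomial.mkDerivation_X, MvPolynomial.map_map, e]

lemma hasDerivAt_eval_eisVec (P : MvPolynomial (Fin 3) ℂ) {z : ℂ} (hz : 0 < z.im) :
    HasDerivAt (fun w ↦ MvPolynomial.eval (eisVec w) P)
      (2 * Real.pi * I / 12 * MvPolynomial.eval (eisVec z) (ramanujanDeriv ℂ P)) z := by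
  induction P using MvPolynomial.induction_on with
  | C a => simpa [ramanujanDeriv] using hasDerivAt_const z a
  | add p q hp hq =>
    simp only [map_add, mul_add]
    exact hp.add hq
  | mul_X p i hp =>
    simp only [map_mul, MvPolynomial.eval_X]
    convert! hp.mul (hasDerivAt_eisVec_apply i hz) using 1
    simp only [Derivation.leibniz, smul_eq_mul, map_add, map_mul, MvPolynomial.eval_X]
    simp only [ramanujanDeriv, MvPolynomial.mkDerivation_X, MvPolynomial.eval_map]
    rw [MvPolynomial.aeval_def, show algebraMap ℤ ℂ = Int.castRingHom ℂ from rfl]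
    ring

lemma iteratedDeriv_eval_eisVec (P : MvPolynomial (Fin 3) ℂ) (k : ℕ) {z : ℂ} (hz : 0 < z.im) :
    iteratedDeriv k (fun w ↦ MvPolynomial.eval (eisVec w) P) z =
      (2 * Real.pi * I / 12) ^ k * MvPolynomial.eval (eisVec z) ((ramanujanDeriv ℂ)^[k] P) := by
  induction k generalizing z with
  | zero => simp
  | succ k ih =>
    rw [iteratedDeriv_succ]
    have hev : iteratedDeriv k (fun w ↦ MvPolynomial.eval (eisVec w) P) =ᶠ[nhds z] fun w ↦
        (2 * Real.pi * I / 12) ^ k *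
          MvPolynomial.eval (eisVec w) ((ramanujanDeriv ℂ)^[k] P) := by
      filter_upwards [(isOpen_lt continuous_const Complex.continuous_im).mem_nhds hz] with w hw
      exact ih hw
    rw [hev.deriv_eq, ((hasDerivAt_eval_eisVec _ hz).const_mul _).deriv,
      Function.iterate_succ_apply', pow_succ]
    ring

lemma mvLength_ramanujanPoly_le (i : Fin 3) : mvLength (ramanujanPoly i) ≤ 12 := by
  have hX (m : Fin 3) : mvLength (MvPolynomial.X (R := ℤ) m) ≤ 1 :=
    (mvLength_monomial_le _ _).trans (by simp)
  have hC (n : ℤ) : mvLength (MvPolynomial.C (σ := Fin 3) n) ≤ |n| :=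
    (mvLength_monomial_le _ _).trans (by simp [Int.norm_eq_abs])
  have hXX (m n : Fin 3) : mvLength (MvPolynomial.X (R := ℤ) m * MvPolynomial.X n) ≤ 1 :=
    (mvLength_mul_le _ _).trans (mul_le_one₀ (hX _) (mvLength_nonneg _) (hX _))
  have hneg (A : MvPolynomial (Fin 3) ℤ) : mvLength (-A) = mvLength A := by
    simp [mvLength]
  have hsub (A B : MvPolynomial (Fin 3) ℤ) (hA : mvLength A ≤ 1) (hB : mvLength B ≤ 1) :
      mvLength (A - B) ≤ 2 := by
    rw [sub_eq_add_neg]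
    refine (mvLength_add_le _ _).trans ?_
    rw [hneg]
    linarith
  have hCm (n : ℤ) (A : MvPolynomial (Fin 3) ℤ) (hn : |n| ≤ 6) (hA : mvLength A ≤ 2) :
      mvLength (MvPolynomial.C n * A) ≤ 12 := by
    refine (mvLength_mul_le _ _).trans ?_
    have h1 : mvLength (MvPolynomial.C (σ := Fin 3) n) ≤ 6 :=
      (hC n).trans (by exact_mod_cast hn)
    nlinarith [mvLength_nonneg A, mvLength_nonneg (MvPolynomial.C (σ := Fin 3) n)]
  fin_cases i
  · simp only [ramanujanPoly, sq]
    exact (hsub _ _ (hXX _ _) (hX _)).trans (by norm_num)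
  · exact hCm 4 _ (by norm_num) (hsub _ _ (hXX _ _) (hX _))
  · simp only [ramanujanPoly, sq]
    exact hCm 6 _ (by norm_num) (hsub _ _ (hXX _ _) (hXX _ _))

lemma totalDegree_ramanujanPoly_le (i : Fin 3) : (ramanujanPoly i).totalDegree ≤ 2 := by
  have hX (m : Fin 3) : (MvPolynomial.X (R := ℤ) m).totalDegree = 1 := MvPolynomial.totalDegree_X m
  have hXX (m n : Fin 3) : (MvPolynomial.X (R := ℤ) m * MvPolynomial.X n).totalDegree ≤ 2 :=
    (MvPolynomial.totalDegree_mul _ _).trans (by rw [hX, hX])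
  have hsub (A B : MvPolynomial (Fin 3) ℤ) (hA : A.totalDegree ≤ 2) (hB : B.totalDegree ≤ 2) :
      (A - B).totalDegree ≤ 2 := (MvPolynomial.totalDegree_sub _ _).trans (max_le hA hB)
  have hCm (n : ℤ) (A : MvPolynomial (Fin 3) ℤ) (hA : A.totalDegree ≤ 2) :
      (MvPolynomial.C n * A).totalDegree ≤ 2 :=
    (MvPolynomial.totalDegree_mul _ _).trans (by rw [MvPolynomial.totalDegree_C]; omega)
  fin_cases i
  · simp only [ramanujanPoly, sq]
    exact hsub _ _ (hXX _ _) ((hX _).trans_le (by norm_num))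
  · exact hCm 4 _ (hsub _ _ (hXX _ _) ((hX _).trans_le (by norm_num)))
  · simp only [ramanujanPoly, sq]
    exact hCm 6 _ (hsub _ _ (hXX _ _) (hXX _ _))

lemma ramanujanDeriv_eq_sum (A : MvPolynomial (Fin 3) ℤ) :
    ramanujanDeriv ℤ A = ∑ m ∈ A.support, ∑ i,
      MvPolynomial.monomial (m - Finsupp.single i 1) (A.coeff m * m i) * ramanujanPoly i := by
  conv_lhs => rw [A.as_sum]
  rw [map_sum]
  refine Finset.sum_congr rfl fun m _ ↦ ?_
  rw [ramanujanDeriv, MvPolynomial.mkDerivation_monomial, Finsupp.sum_fintype _ _ (by simp),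
    Finset.smul_sum]
  refine Finset.sum_congr rfl fun i _ ↦ ?_
  rw [show Int.castRingHom ℤ = RingHom.id ℤ from RingHom.ext_int _ _, MvPolynomial.map_id,
    smul_eq_mul, ← smul_mul_assoc, MvPolynomial.smul_monomial, smul_eq_mul]

lemma totalDegree_ramanujanDeriv_le (A : MvPolynomial (Fin 3) ℤ) :
    (ramanujanDeriv ℤ A).totalDegree ≤ A.totalDegree + 1 := by
  rw [ramanujanDeriv_eq_sum]
  refine MvPolynomial.totalDegree_finsetSum_le fun m hm ↦
    MvPolynomial.totalDegree_finsetSum_le fun i _ ↦ ?_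
  rcases Nat.eq_zero_or_pos (m i) with h0 | hpos
  · simp [h0]
  refine (MvPolynomial.totalDegree_mul _ _).trans ?_
  have h1 := (MvPolynomial.totalDegree_monomial_le (m - Finsupp.single i 1) (A.coeff m * m i))
  have h2 := totalDegree_ramanujanPoly_le i
  have h3 := MvPolynomial.le_totalDegree hm
  have h4 : ((m - Finsupp.single i 1).sum fun _ ↦ id) + 1 ≤ m.sum fun _ e ↦ e := by
    have : m = (m - Finsupp.single i 1) + Finsupp.single i 1 := by
      rw [tsub_add_cancel_of_le]
      simpa using Nat.succ_le_of_lt hpos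
    conv_rhs => rw [this]
    rw [Finsupp.sum_add_index' (fun _ ↦ rfl) (fun _ _ _ ↦ rfl), Finsupp.sum_single_index rfl]
    rfl
  omega

lemma mvLength_ramanujanDeriv_le {A : MvPolynomial (Fin 3) ℤ} {d : ℕ} (hd : A.totalDegree ≤ d) :
    mvLength (ramanujanDeriv ℤ A) ≤ 12 * d * mvLength A := by
  rw [ramanujanDeriv_eq_sum]
  refine (mvLength_sum_le _ _).trans ?_
  rw [mvLength, Finset.mul_sum]
  refine Finset.sum_le_sum fun m hm ↦ (mvLength_sum_le _ _).trans ?_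
  calc ∑ i, mvLength (MvPolynomial.monomial (m - Finsupp.single i 1) (A.coeff m * m i) *
        ramanujanPoly i) ≤ ∑ i, (‖A.coeff m‖ * m i) * 12 := by
        refine Finset.sum_le_sum fun i _ ↦ (mvLength_mul_le _ _).trans ?_
        gcongr
        · exact mvLength_nonneg _
        · refine (mvLength_monomial_le _ _).trans ((norm_mul_le _ _).trans (le_of_eq ?_))
          simp
        · exact mvLength_ramanujanPoly_le i
    _ = 12 * ((∑ i, m i : ℕ) : ℝ) * ‖A.coeff m‖ := by
        rw [Nat.cast_sum, Finset.mul_sum, Finset.sum_mul]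
        exact Finset.sum_congr rfl fun _ _ ↦ by ring
    _ ≤ _ := by
        have h3 := MvPolynomial.le_totalDegree hm
        rw [Finsupp.sum_fintype _ _ (fun _ ↦ rfl)] at h3
        gcongr
        exact h3.trans hd

lemma iterate_ramanujanDeriv_bounds {A : MvPolynomial (Fin 3) ℤ} {d : ℕ} (hd : A.totalDegree ≤ d)
    (T k : ℕ) (hk : k ≤ T) : ((ramanujanDeriv ℤ)^[k] A).totalDegree ≤ d + k ∧
      mvLength ((ramanujanDeriv ℤ)^[k] A) ≤ (12 * (d + T)) ^ k * mvLength A := by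
  induction k with
  | zero => simpa using hd
  | succ k ih =>
    obtain ⟨h1, h2⟩ := ih (by omega)
    rw [Function.iterate_succ_apply']
    refine ⟨(totalDegree_ramanujanDeriv_le _).trans (by omega), ?_⟩
    refine (mvLength_ramanujanDeriv_le (d := d + T) (by omega)).trans ?_
    calc 12 * ((d + T : ℕ) : ℝ) * mvLength ((ramanujanDeriv ℤ)^[k] A)
        ≤ 12 * ((d + T : ℕ) : ℝ) * ((12 * (d + T)) ^ k * mvLength A) := by gcongr
      _ = _ := by push_cast; ring

lemma map_iterate_ramanujanDeriv {R S : Type*} [CommRing R] [CommRing S] (f : R →+* S) (k : ℕ)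
    (P : MvPolynomial (Fin 3) R) :
    ((ramanujanDeriv R)^[k] P).map f = (ramanujanDeriv S)^[k] (P.map f) := by
  induction k with
  | zero => rfl
  | succ k ih => rw [Function.iterate_succ_apply', Function.iterate_succ_apply',
      map_ramanujanDeriv, ih]

end Derivation

section OrderBound

lemma differentiableOn_tsum_mul_pow {b : ℕ → ℂ}
    (h : ∀ r : ℝ, 0 ≤ r → r < 1 → Summable fun n ↦ ‖b n‖ * r ^ n) :
    DifferentiableOn ℂ (fun q ↦ ∑' n, b n * q ^ n) (Metric.ball 0 1) := by
  intro x hx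
  have hx1 : ‖x‖ < 1 := by simpa using hx
  obtain ⟨r, hr1, hr2⟩ := exists_between hx1
  have h := differentiableOn_tsum_of_summable_norm (F := fun n q ↦ b n * q ^ n)
    (h r ((norm_nonneg x).trans hr1.le) hr2)
    (fun n ↦ by fun_prop) (Metric.isOpen_ball (x := (0 : ℂ)) (ε := r)) (fun n q hq ↦ by
      have : ‖q‖ ≤ r := by simpa using (Metric.mem_ball.mp hq).le
      rw [norm_mul, norm_pow]
      gcongr)
  exact (h.differentiableAt (Metric.isOpen_ball.mem_nhds (by simpa using hr1))).differentiableWithinAt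

lemma norm_coeff_mul_pow_le_of_analyticOrderAt {P : MvPolynomial (Fin 3) ℂ} {M T : ℕ} {r S : ℝ}
    (hvan : ∀ n < M, (qSeries P).coeff n = 0) (hS : IsMajorized (qSeries P) r S)
    {a : ℂ} (ha : 0 < a.im) (har : ‖nome a‖ < r) (hr : r < 1)
    (hT : T ≤ analyticOrderAt (fun z ↦ MvPolynomial.eval (eisVec z) P) a) :
    ‖(qSeries P).coeff M‖ * (r / ‖nome a‖) ^ T ≤ S / r ^ M := by
  have hq0 : 0 < ‖nome a‖ := by rw [norm_nome]; exact Real.exp_pos _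
  have hr0 : 0 < r := hq0.trans har
  have hsum (ρ : ℝ) (h0 : 0 ≤ ρ) (h1 : ρ < 1) :
      Summable fun n ↦ ‖(qSeries P).coeff (n + M)‖ * ρ ^ n := by
    rcases h0.eq_or_lt with rfl | hpos
    · refine summable_of_ne_finset_zero (s := {0}) fun n hn ↦ ?_
      rw [zero_pow (by simpa using hn), mul_zero]
    have h2 := (isMajorized_qSeries (A := P) le_rfl h0 h1).summable h0
    have h3 := ((summable_nat_add_iff M).mpr h2).mul_right (ρ ^ M)⁻¹
    refine h3.congr fun n ↦ ?_
    rw [pow_add]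
    field_simp
  set f : ℂ → ℂ := fun q ↦ ∑' n, (qSeries P).coeff (n + M) * q ^ n with hf
  have hfd : DifferentiableOn ℂ f (Metric.ball 0 1) := differentiableOn_tsum_mul_pow hsum
  have hf0 : f 0 = (qSeries P).coeff M := by
    rw [hf]
    simp only
    rw [tsum_eq_single 0 (fun n hn ↦ by simp [hn])]
    simp
  have hfac (z : ℂ) (hz : 0 < z.im) :
      MvPolynomial.eval (eisVec z) P = ((fun q ↦ q ^ M) * f : ℂ → ℂ) (nome z) := by
    have h := (evalsTo_qSeries P hz).2
    rw [← h.tsum_eq, ← h.summable.sum_add_tsum_nat_add M,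
      Finset.sum_eq_zero (fun n hn ↦ by rw [hvan n (Finset.mem_range.mp hn), zero_mul]), zero_add,
      Pi.mul_apply, hf]
    simp only
    rw [← tsum_mul_left]
    exact tsum_congr fun n ↦ by rw [pow_add]; ring
  have hmem : Metric.ball (0 : ℂ) 1 ∈ nhds (nome a) :=
    Metric.isOpen_ball.mem_nhds (by simpa using norm_nome_lt_one ha)
  have hnd : Differentiable ℂ nome := fun z ↦ (hasDerivAt_nome z).differentiableAt
  have hord : analyticOrderAt (fun z ↦ MvPolynomial.eval (eisVec z) P) a =
      analyticOrderAt f (nome a) := by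
    have h1 : (fun z ↦ MvPolynomial.eval (eisVec z) P) =ᶠ[nhds a]
        ((fun q ↦ q ^ M) * f) ∘ nome := by
      filter_upwards [(isOpen_lt continuous_const Complex.continuous_im).mem_nhds ha] with z hz
      exact hfac z hz
    have hpow : AnalyticAt ℂ (fun q : ℂ ↦ q ^ M) (nome a) := by fun_prop
    rw [analyticOrderAt_congr h1, analyticOrderAt_comp_of_deriv_ne_zero (hnd.analyticAt a) (by
      rw [(hasDerivAt_nome a).deriv]
      exact mul_ne_zero two_pi_I_ne_zero (norm_pos_iff.mp hq0)),
      analyticOrderAt_mul hpow (hfd.analyticAt hmem),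
      hpow.analyticOrderAt_eq_zero.mpr (pow_ne_zero _ (norm_pos_iff.mp hq0)), zero_add]
  rw [hord] at hT
  rw [← hf0]
  refine norm_mul_pow_le_of_analyticOrderAt hfd hq0 har hr hT fun q hq ↦ ?_
  rw [le_div_iff₀ (by positivity)]
  have hs := hsum r hr0.le hr
  calc ‖f q‖ * r ^ M ≤ (∑' n, ‖(qSeries P).coeff (n + M)‖ * r ^ n) * r ^ M := by
        gcongr
        refine (norm_tsum_le_tsum_norm ?_).trans (le_of_eq ?_)
        · simpa only [norm_mul, norm_pow, hq] using hs
        · simp only [norm_mul, norm_pow, hq]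
    _ = ∑' n, ‖(qSeries P).coeff (n + M)‖ * r ^ (n + M) := by
        rw [← tsum_mul_right]
        exact tsum_congr fun n ↦ by rw [pow_add]; ring
    _ ≤ ∑' n, ‖(qSeries P).coeff n‖ * r ^ n := by
        have h2 := (hS.summable hr0.le).sum_add_tsum_nat_add M
        rw [← h2]
        have : 0 ≤ ∑ n ∈ Finset.range M, ‖(qSeries P).coeff n‖ * r ^ n :=
          Finset.sum_nonneg fun _ _ ↦ by positivity
        linarith
    _ ≤ S := hS.tsum_le hr0.le

lemma norm_iterate_ramanujanDeriv_le {P : MvPolynomial (Fin 3) ℂ} {M : ℕ} {r S : ℝ}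
    (hvan : ∀ n < M, (qSeries P).coeff n = 0) (hS : IsMajorized (qSeries P) r S)
    {a : ℂ} (ha : 0 < a.im) (har : Real.exp (-(Real.pi * a.im)) ≤ r) (T : ℕ) :
    ‖MvPolynomial.eval (eisVec a) ((ramanujanDeriv ℂ)^[T] P)‖ ≤
      2 ^ T * (T.factorial * ((Real.exp (-(Real.pi * a.im)) / r) ^ M * S) / (a.im / 2) ^ T) := by
  have hr0 : 0 < r := (Real.exp_pos _).trans_le har
  have him (z : ℂ) (hz : z ∈ Metric.closedBall a (a.im / 2)) : a.im / 2 ≤ z.im := by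
    have h1 := (Complex.abs_im_le_norm (z - a)).trans (mem_closedBall_iff_norm.mp hz)
    rw [Complex.sub_im] at h1
    linarith [(abs_le.mp h1).1]
  have h := norm_iteratedDeriv_le_of_forall_mem_sphere_norm_le
    (f := fun z ↦ MvPolynomial.eval (eisVec z) P) (c := a) (R := a.im / 2) T (by linarith)
    (C := (Real.exp (-(Real.pi * a.im)) / r) ^ M * S) (by
      refine DifferentiableOn.diffContOnCl fun z hz ↦ ?_
      have := him z (Metric.closure_ball_subset_closedBall hz)
      exact (hasDerivAt_eval_eisVec P (by linarith)).differentiableAt.differentiableWithinAt)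
    (fun z hz ↦ by
      have h1 := him z (Metric.sphere_subset_closedBall hz)
      have h2 : ‖nome z‖ ≤ Real.exp (-(Real.pi * a.im)) := by
        rw [norm_nome]
        apply Real.exp_le_exp.mpr
        nlinarith [Real.pi_pos]
      refine (hS.norm_le_of_hasSum hr0 hvan (h2.trans har)
        (evalsTo_qSeries P (by linarith)).2).trans ?_
      have := hS.nonneg
      gcongr)
  rw [iteratedDeriv_eval_eisVec P T ha, norm_mul, norm_pow] at h
  have hc : (1 : ℝ) / 2 ≤ ‖(2 * Real.pi * I / 12 : ℂ)‖ := by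
    simp only [norm_div, norm_mul, norm_I, mul_one, Complex.norm_real, Real.norm_eq_abs,
      abs_of_pos Real.pi_pos, Complex.norm_ofNat]
    linarith [Real.pi_gt_three]
  set x := ‖MvPolynomial.eval (eisVec a) ((ramanujanDeriv ℂ)^[T] P)‖
  calc x = 2 ^ T * ((1 / 2) ^ T * x) := by
        rw [← mul_assoc, ← mul_pow]; norm_num
    _ ≤ 2 ^ T * (‖(2 * Real.pi * I / 12 : ℂ)‖ ^ T * x) := by gcongr
    _ ≤ _ := by gcongr

end OrderBound

section SmallValues

lemma aux_majorant_le {A : MvPolynomial (Fin 3) ℤ} {s M : ℕ} (hs : 1 ≤ s)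
    (hlen : mvLength A ≤ Real.exp (2000 * s ^ 6)) (hM2 : 2 ≤ M) (hM : M ≤ (6 * s ^ 5) ^ 8) :
    mvLength (A.map (Int.castRingHom ℂ)) * (362880 / (1 - (1 - 1 / (M : ℝ))) ^ 7) ^ (6 * s ^ 5) ≤
      Real.exp (7160 * s ^ 6) := by
  have hs' : (1 : ℝ) ≤ s := by exact_mod_cast hs
  have hMle : (M : ℝ) ≤ Real.exp (80 + 40 * s) := by
    calc (M : ℝ) ≤ (6 * (s : ℝ) ^ 5) ^ 8 := by exact_mod_cast hM
      _ ≤ (Real.exp 10 * Real.exp s ^ 5) ^ 8 := by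
          gcongr
          · linarith [thousand_le_exp_ten]
          · exact natCast_le_exp s
      _ = _ := by
          simp only [← Real.exp_nat_mul, ← Real.exp_add]
          congr 1
          push_cast
          ring
  have hM0 : (0 : ℝ) < M := by positivity
  rw [mvLength_map_intCast, sub_sub_cancel, one_div, inv_pow, div_inv_eq_mul]
  calc mvLength A * (362880 * (M : ℝ) ^ 7) ^ (6 * s ^ 5)
      ≤ Real.exp (2000 * s ^ 6) * (Real.exp 10 ^ 2 * Real.exp (80 + 40 * s) ^ 7) ^ (6 * s ^ 5) := by
        gcongr
        nlinarith [thousand_le_exp_ten]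
    _ = Real.exp (2000 * s ^ 6 + 6 * s ^ 5 * (20 + 7 * (80 + 40 * s))) := by
        simp only [← Real.exp_nat_mul, ← Real.exp_add]
        congr 1
        push_cast
        ring
    _ ≤ _ := by
        apply Real.exp_le_exp.mpr
        have h5 : (0 : ℝ) ≤ (s : ℝ) ^ 5 := by positivity
        have h6 : (s : ℝ) ^ 6 = s * s ^ 5 := by ring
        have h8 : (s : ℝ) ^ 5 ≤ s * s ^ 5 := le_mul_of_one_le_left h5 hs'
        rw [h6]
        nlinarith

lemma natCast_le_exp_of_le {n K s : ℕ} (hs : 1 ≤ s) (h : n ≤ K * s ^ 6) :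
    (n : ℝ) ≤ Real.exp ((K + 6) * s) := by
  have hs' : (1 : ℝ) ≤ s := by exact_mod_cast hs
  calc (n : ℝ) ≤ K * (s : ℝ) ^ 6 := by exact_mod_cast h
    _ ≤ Real.exp K * Real.exp s ^ 6 := by
        gcongr
        · exact natCast_le_exp K
        · exact natCast_le_exp s
    _ = Real.exp (K + 6 * s) := by
        rw [← Real.exp_nat_mul, ← Real.exp_add]
        norm_num
    _ ≤ _ := by
        apply Real.exp_le_exp.mpr
        have : (0 : ℝ) ≤ K := Nat.cast_nonneg K
        nlinarith

lemma length_majorant_le {T s K : ℕ} {L : ℝ} (hL0 : 0 ≤ L) (hL : L ≤ Real.exp (2000 * s ^ 6))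
    (hs1 : 1 ≤ s) (hTK : T ≤ K * s ^ 6) :
    (12 * (((6 * s ^ 5 : ℕ) : ℝ) + T)) ^ T * L ≤
      Real.exp (((90 + 12 * K) * (K + 6) + 2000 : ℕ) * s ^ 7) := by
  have hs' : (1 : ℝ) ≤ s := by exact_mod_cast hs1
  have hTr : (T : ℝ) ≤ K * s ^ 6 := by exact_mod_cast hTK
  have hs6 : (s : ℝ) ^ 7 = s * s ^ 6 := by ring
  have hs67 : (s : ℝ) ^ 6 ≤ s ^ 7 := by
    rw [hs6]; exact le_mul_of_one_le_left (by positivity) hs'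
  have h56 : 6 * s ^ 5 + T ≤ (K + 6) * s ^ 6 := by
    have : s ^ 5 ≤ s ^ 6 := Nat.pow_le_pow_right hs1 (by norm_num)
    rw [add_mul]
    omega
  have h1 := natCast_le_exp_of_le (n := 12 * (6 * s ^ 5 + T)) (K := 12 * (K + 6)) hs1 (by
    rw [mul_assoc]; exact Nat.mul_le_mul_left _ h56)
  rw [show ((12 * (6 * s ^ 5 + T) : ℕ) : ℝ) = 12 * (((6 * s ^ 5 : ℕ) : ℝ) + T) by
    push_cast; ring] at h1
  calc (12 * (((6 * s ^ 5 : ℕ) : ℝ) + T)) ^ T * L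
      ≤ Real.exp (((12 * (K + 6) : ℕ) + 6) * s) ^ T * Real.exp (2000 * s ^ 6) := by
        gcongr
    _ = Real.exp (T * (((12 * (K + 6) : ℕ) + 6) * s) + 2000 * s ^ 6) := by
        rw [← Real.exp_nat_mul, ← Real.exp_add]
    _ ≤ _ := by
        apply Real.exp_le_exp.mpr
        have hKr : (0 : ℝ) ≤ K := Nat.cast_nonneg K
        have h2 : (T : ℝ) * s ≤ K * s ^ 7 := by
          rw [hs6]
          nlinarith
        have h3 : (T : ℝ) * s * (78 + 12 * K) ≤ K * s ^ 7 * (78 + 12 * K) := by gcongr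
        have h4 : 0 ≤ (s : ℝ) ^ 7 * (12 * K + 540 + 72 * K) := by positivity
        push_cast
        linarith

lemma smallness_le {T s M : ℕ} {K y r₀ r : ℝ} (hy : 0 < y) (hr₀ : r₀ = Real.exp (-(Real.pi * y)))
    (hs' : (1 : ℝ) ≤ s) (hK : 0 ≤ K) (hTr : (T : ℝ) ≤ K * s ^ 6)
    (hfact : (T.factorial : ℝ) ≤ Real.exp ((K + 6) * s) ^ T) (hM15 : 4 * (s : ℝ) ^ 15 ≤ M)
    (hr : 0 < r) (hrM : Real.exp (-2) ≤ r ^ M)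
    (hsK : (K + (K + 6) * K + 2 + 7160 + 2 / y * K) / y ≤ s) :
    2 ^ T * (T.factorial * ((r₀ / r) ^ M * Real.exp (7160 * s ^ 6)) / (y / 2) ^ T) ≤
      Real.exp (-(y * s ^ 15)) := by
  have hpi := Real.pi_gt_three
  have hr₀0 : 0 < r₀ := hr₀ ▸ Real.exp_pos _
  have hs6 : (s : ℝ) ^ 7 = s * s ^ 6 := by ring
  have hs67 : (s : ℝ) ^ 6 ≤ s ^ 7 := by
    rw [hs6]; exact le_mul_of_one_le_left (by positivity) hs'
  have hs07 : (1 : ℝ) ≤ (s : ℝ) ^ 7 := one_le_pow₀ hs'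
  have h2e : (2 : ℝ) ≤ Real.exp 1 := by linarith [Real.add_one_le_exp (1 : ℝ)]
  have hye : 2 / y ≤ Real.exp (2 / y) := by linarith [Real.add_one_le_exp (2 / y)]
  calc 2 ^ T * (T.factorial * ((r₀ / r) ^ M * Real.exp (7160 * s ^ 6)) / (y / 2) ^ T)
      = 2 ^ T * (T.factorial * ((r₀ ^ M / r ^ M) * Real.exp (7160 * s ^ 6)) * (2 / y) ^ T) := by
        rw [div_pow r₀, div_eq_mul_inv _ ((y / 2) ^ T), ← inv_pow, inv_div]
    _ ≤ Real.exp 1 ^ T * (Real.exp ((K + 6) * s) ^ T *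
        ((r₀ ^ M / Real.exp (-2)) * Real.exp (7160 * s ^ 6)) * Real.exp (2 / y) ^ T) := by
        gcongr
    _ = Real.exp (T + (T * ((K + 6) * s) + (-(M * (Real.pi * y)) - (-2) + 7160 * s ^ 6) +
          T * (2 / y))) := by
        rw [hr₀]
        simp only [← Real.exp_nat_mul, ← Real.exp_add, ← Real.exp_sub]
        congr 1
        ring
    _ ≤ _ := by
        apply Real.exp_le_exp.mpr
        have e1 : (T : ℝ) ≤ K * s ^ 7 := hTr.trans (by gcongr)
        have e2 : (T : ℝ) * ((K + 6) * s) ≤ (K + 6) * K * s ^ 7 := by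
          calc (T : ℝ) * ((K + 6) * s) ≤ (K * s ^ 6) * ((K + 6) * s) := by gcongr
            _ = _ := by ring
        have e3 : (T : ℝ) * (2 / y) ≤ 2 / y * K * s ^ 7 := by
          calc (T : ℝ) * (2 / y) ≤ (K * s ^ 7) * (2 / y) := by gcongr
            _ = _ := by ring
        have e4 : 12 * y * (s : ℝ) ^ 15 ≤ M * (Real.pi * y) := by
          calc 12 * y * (s : ℝ) ^ 15 = (4 * (s : ℝ) ^ 15) * (3 * y) := by ring
            _ ≤ _ := by gcongr
        have e5 : (K + (K + 6) * K + 2 + 7160 + 2 / y * K) * s ^ 7 ≤ y * s ^ 15 := by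
          have h1 := (div_le_iff₀ hy).mp hsK
          calc (K + (K + 6) * K + 2 + 7160 + 2 / y * K) * (s : ℝ) ^ 7 ≤ s * y * s ^ 7 := by gcongr
            _ = y * s ^ 8 := by ring
            _ ≤ y * s ^ 15 := by
              gcongr
              norm_num
        have e7 : 0 ≤ y * (s : ℝ) ^ 15 := by positivity
        linarith

/-- Integer polynomials with very small but nonzero values at `(E₂(a), E₄(a), E₆(a))`. -/
lemma exists_small_values {a : ℂ} (ha : 0 < a.im) : ∃ (C : ℕ) (c : ℝ), 0 < c ∧ ∃ s₀ : ℕ, ∀ s ≥ s₀,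
    ∃ B : MvPolynomial (Fin 3) ℤ, B.totalDegree ≤ C * s ^ 7 ∧ mvLength B ≤ Real.exp (C * s ^ 7) ∧
      MvPolynomial.aeval (eisVec a) B ≠ 0 ∧
      ‖MvPolynomial.aeval (eisVec a) B‖ ≤ Real.exp (-(c * s ^ 15)) := by
  obtain ⟨s₁, hs₁⟩ := exists_aux_sequence
  set y := a.im with hy
  set r₀ := Real.exp (-(Real.pi * y)) with hr₀
  have hpi := Real.pi_gt_three
  have hr₀1 : r₀ < 1 := Real.exp_lt_one_iff.mpr (by nlinarith)
  have hr₀0 : 0 < r₀ := Real.exp_pos _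
  set K : ℕ := ⌈7162 / (Real.pi * y)⌉₊ with hK
  have hKle : 7162 ≤ K * (Real.pi * y) := by
    rw [← div_le_iff₀ (by positivity)]
    exact Nat.le_ceil _
  set K₂ : ℝ := K + (K + 6) * K + 2 + 7160 + 2 / y * K with hK₂
  refine ⟨(90 + 12 * K) * (K + 6) + 2000, y, ha,
    max (max 1 s₁) (max ⌈1 / (1 - r₀)⌉₊ ⌈K₂ / y⌉₊), fun s hs ↦ ?_⟩
  have hs1 : 1 ≤ s := ((le_max_left _ _).trans (le_max_left _ _)).trans hs
  have hs' : (1 : ℝ) ≤ s := by exact_mod_cast hs1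
  have hss₁ : s₁ ≤ s := ((le_max_right _ _).trans (le_max_left _ _)).trans hs
  have hsr : 1 / (1 - r₀) ≤ s := (Nat.le_ceil _).trans (by
    exact_mod_cast ((le_max_left _ _).trans (le_max_right _ _)).trans hs)
  have hsK : K₂ / y ≤ s := (Nat.le_ceil _).trans (by
    exact_mod_cast ((le_max_right _ _).trans (le_max_right _ _)).trans hs)
  obtain ⟨A, M, hdeg, hlen, hM1, hM2, hvan, hlead⟩ := hs₁ s hss₁
  have hs15 : s ≤ s ^ 15 := Nat.le_self_pow (by norm_num) s
  have hsM : s ≤ M := by omega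
  have hM2' : 2 ≤ M := by omega
  have hMr : (0 : ℝ) < M := by positivity
  set r : ℝ := 1 - 1 / M with hr
  have hrr₀ : r₀ ≤ r := by
    have h1 : 1 / (1 - r₀) ≤ M := hsr.trans (by exact_mod_cast hsM)
    have h2 : 1 / (M : ℝ) ≤ 1 - r₀ := by
      rw [div_le_iff₀ (by linarith)] at h1 ⊢
      linarith
    linarith
  have hr0 : 0 < r := hr₀0.trans_le hrr₀
  have hr1 : r < 1 := by
    have : 0 < 1 / (M : ℝ) := by positivity
    linarith
  set P := A.map (Int.castRingHom ℂ) with hP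
  have hPd : P.totalDegree ≤ 6 * s ^ 5 := by rwa [hP, totalDegree_map_intCast]
  have hS : IsMajorized (qSeries P) r (Real.exp (7160 * s ^ 6)) :=
    (isMajorized_qSeries hPd hr0.le hr1).mono (aux_majorant_le hs1 hlen hM2' hM2)
  have hrM : Real.exp (-2) ≤ r ^ M := exp_neg_two_le_one_sub_pow hM2'
  have hnome : ‖nome a‖ = r₀ * r₀ := by
    rw [norm_nome, hr₀, ← Real.exp_add]
    congr 1
    ring
  have hTle (T : ℕ) (hT : T ≤ analyticOrderAt (fun z ↦ MvPolynomial.eval (eisVec z) P) a) :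
      T ≤ K * s ^ 6 := by
    have h := norm_coeff_mul_pow_le_of_analyticOrderAt hvan hS ha
      (by rw [hnome]; nlinarith) hr1 hT
    have h1 : Real.exp (T * (Real.pi * y)) ≤ Real.exp (7160 * s ^ 6 + 2) := by
      calc Real.exp (T * (Real.pi * y)) = 1 * (r₀ / ‖nome a‖) ^ T := by
            rw [one_mul, hnome, div_mul_cancel_left₀ hr₀0.ne', hr₀, ← Real.exp_neg, neg_neg,
              Real.exp_nat_mul]
        _ ≤ ‖(qSeries P).coeff M‖ * (r / ‖nome a‖) ^ T := by gcongr
        _ ≤ _ := h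
        _ ≤ Real.exp (7160 * s ^ 6) / Real.exp (-2) := by gcongr
        _ = _ := by rw [← Real.exp_sub]; congr 1; ring
    rw [Real.exp_le_exp] at h1
    have hs6 : (1 : ℝ) ≤ (s : ℝ) ^ 6 := one_le_pow₀ hs'
    have h2 : (T : ℝ) * (Real.pi * y) ≤ (K * s ^ 6) * (Real.pi * y) := by
      nlinarith
    have h3 := le_of_mul_le_mul_right h2 (by positivity)
    exact_mod_cast h3
  obtain ⟨T, hT⟩ : ∃ T : ℕ, analyticOrderAt (fun z ↦ MvPolynomial.eval (eisVec z) P) a = T := by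
    refine (ENat.ne_top_iff_exists.mp fun htop ↦ ?_).imp fun _ h ↦ h.symm
    have := hTle (K * s ^ 6 + 1) (by rw [htop]; exact le_top)
    omega
  have hTK : T ≤ K * s ^ 6 := hTle T hT.ge
  have hFa : AnalyticAt ℂ (fun z ↦ MvPolynomial.eval (eisVec z) P) a := by
    refine DifferentiableOn.analyticAt (s := {z | 0 < z.im}) (fun z hz ↦
      (hasDerivAt_eval_eisVec P hz).differentiableAt.differentiableWithinAt)
      ((isOpen_lt continuous_const Complex.continuous_im).mem_nhds ha)
  have heval : MvPolynomial.aeval (eisVec a) ((ramanujanDeriv ℤ)^[T] A) =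
      MvPolynomial.eval (eisVec a) ((ramanujanDeriv ℂ)^[T] P) := by
    rw [hP, ← map_iterate_ramanujanDeriv, MvPolynomial.eval_map]
    rfl
  have hTr : (T : ℝ) ≤ K * s ^ 6 := by exact_mod_cast hTK
  have hKr : (0 : ℝ) ≤ K := Nat.cast_nonneg K
  obtain ⟨hBd, hBl⟩ := iterate_ramanujanDeriv_bounds hdeg T T le_rfl
  have h56 : 6 * s ^ 5 + T ≤ (K + 6) * s ^ 6 := by
    have : s ^ 5 ≤ s ^ 6 := Nat.pow_le_pow_right hs1 (by norm_num)
    rw [add_mul]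
    omega
  refine ⟨(ramanujanDeriv ℤ)^[T] A, ?_, ?_, ?_, ?_⟩
  · refine hBd.trans (h56.trans (Nat.mul_le_mul ?_ (Nat.pow_le_pow_right hs1 (by norm_num))))
    exact (Nat.le_mul_of_pos_left _ (by omega)).trans (Nat.le_add_right _ _)
  · exact hBl.trans (length_majorant_le (mvLength_nonneg _) hlen hs1 hTK)
  · rw [heval]
    have h := (analyticOrderAt_eq_nat_iff_iteratedDeriv_eq_zero hFa (n := T)).mp hT
    intro h0
    apply h.2
    rw [iteratedDeriv_eval_eisVec P T ha, h0, mul_zero]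
  · rw [heval]
    refine (norm_iterate_ramanujanDeriv_le hvan hS ha hrr₀ T).trans ?_
    have hfact : (T.factorial : ℝ) ≤ Real.exp ((K + 6) * s) ^ T := by
      calc (T.factorial : ℝ) ≤ (T : ℝ) ^ T := by exact_mod_cast Nat.factorial_le_pow T
        _ ≤ _ := by
          gcongr
          exact natCast_le_exp_of_le hs1 hTK
    have hM15 : 4 * (s : ℝ) ^ 15 ≤ M := by exact_mod_cast hM1
    exact smallness_le ha hr₀ hs' hKr hTr hfact hM15 hr0 hrM hsK

end SmallValues

section Resultant

open Polynomial

/-- The Mahler measure of the polynomial recentred at `θ`. -/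
noncomputable def shiftedMahler (θ : ℂ) (f : ℂ[X]) : ℝ :=
  ‖f.leadingCoeff‖ * (f.roots.map fun α ↦ max 1 ‖θ - α‖).prod

lemma norm_multisetProd (s : Multiset ℂ) (f : ℂ → ℂ) :
    ‖(s.map f).prod‖ = (s.map fun x ↦ ‖f x‖).prod := by
  have h := Multiset.prod_hom (s.map f) (normHom : ℂ →*₀ ℝ)
  rw [Multiset.map_map] at h
  exact h.symm

lemma one_le_prod_max (s : Multiset ℂ) (f : ℂ → ℝ) : 1 ≤ (s.map fun x ↦ max 1 (f x)).prod := by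
  induction s using Multiset.induction_on with
  | empty => simp
  | cons a s ih =>
    rw [Multiset.map_cons, Multiset.prod_cons]
    exact one_le_mul_of_one_le_of_one_le (le_max_left _ _) ih

lemma one_le_shiftedMahler (θ : ℂ) {f : ℂ[X]} (hf : 1 ≤ ‖f.leadingCoeff‖) :
    1 ≤ shiftedMahler θ f :=
  one_le_mul_of_one_le_of_one_le hf (one_le_prod_max _ _)

lemma shiftedMahler_le (θ : ℂ) (f : ℂ[X]) :
    shiftedMahler θ f ≤ (1 + ‖θ‖) ^ f.natDegree * f.mahlerMeasure := by
  rw [shiftedMahler, mahlerMeasure_eq_leadingCoeff_mul_prod_roots,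
    (IsAlgClosed.splits f).natDegree_eq_card_roots, mul_left_comm]
  gcongr
  rw [← Multiset.prod_replicate, ← Multiset.map_const', ← Multiset.prod_map_mul]
  refine Multiset.prod_map_le_prod_map₀ _ _ (fun _ _ ↦ by positivity) fun α _ ↦ max_le ?_ ?_
  · exact one_le_mul_of_one_le_of_one_le (by linarith [norm_nonneg θ]) (le_max_left _ _)
  · refine (norm_sub_le _ _).trans ?_
    have h1 := le_max_left 1 ‖α‖
    have h2 := le_max_right 1 ‖α‖
    nlinarith [norm_nonneg θ]

lemma norm_resultant (f g : ℂ[X]) (hf : f ≠ 0) (hg : g ≠ 0) : ‖resultant f g‖ =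
    ‖f.leadingCoeff‖ ^ g.natDegree * ‖g.leadingCoeff‖ ^ f.natDegree *
      (f.roots.map fun α ↦ (g.roots.map fun β ↦ ‖α - β‖).prod).prod := by
  have hf0 : f.leadingCoeff ≠ 0 := leadingCoeff_ne_zero.mpr hf
  have hg0 : g.leadingCoeff ≠ 0 := leadingCoeff_ne_zero.mpr hg
  set f' := C f.leadingCoeff⁻¹ * f with hf'
  set g' := C g.leadingCoeff⁻¹ * g with hg'
  have hfm : f'.Monic := by rw [hf', mul_comm]; exact monic_mul_leadingCoeff_inv hf
  have hgm : g'.Monic := by rw [hg', mul_comm]; exact monic_mul_leadingCoeff_inv hg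
  have hfd : f'.natDegree = f.natDegree := natDegree_C_mul (inv_ne_zero hf0)
  have hgd : g'.natDegree = g.natDegree := natDegree_C_mul (inv_ne_zero hg0)
  have hff : f = C f.leadingCoeff * f' := by
    rw [hf', ← mul_assoc, ← C_mul, mul_inv_cancel₀ hf0, C_1, one_mul]
  have hgg : g = C g.leadingCoeff * g' := by
    rw [hg', ← mul_assoc, ← C_mul, mul_inv_cancel₀ hg0, C_1, one_mul]
  have hfr : f'.roots = f.roots := roots_C_mul _ (inv_ne_zero hf0)
  have hgr : g'.roots = g.roots := roots_C_mul _ (inv_ne_zero hg0)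
  have key := resultant_eq_prod_roots_sub f' g' hfm hgm (IsAlgClosed.splits _)
    (IsAlgClosed.splits _)
  rw [hfd, hgd, hfr, hgr, Multiset.prod_map_product_eq_prod_prod] at key
  have h : resultant f g = f.leadingCoeff ^ g.natDegree * (g.leadingCoeff ^ f.natDegree *
      resultant f' g' f.natDegree g.natDegree) := by
    rw [← resultant_C_mul_right, ← resultant_C_mul_left, ← hff, ← hgg]
  rw [h, key, norm_mul, norm_mul, norm_pow, norm_pow, norm_multisetProd, mul_assoc]
  simp only [norm_multisetProd]

lemma norm_resultant_le_of_closest {f g : ℂ[X]} (hf : 1 ≤ ‖f.leadingCoeff‖)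
    (hg : 1 ≤ ‖g.leadingCoeff‖) {θ α : ℂ} (hα : α ∈ f.roots)
    (h : ∀ β ∈ g.roots, ‖θ - α‖ ≤ ‖θ - β‖) :
    ‖resultant f g‖ ≤ 2 ^ (f.natDegree * g.natDegree) * shiftedMahler θ f ^ g.natDegree *
      shiftedMahler θ g ^ f.natDegree * ‖g.eval θ‖ := by
  have hf0 : f ≠ 0 := by rintro rfl; norm_num at hf
  have hg0 : g ≠ 0 := by rintro rfl; norm_num at hg
  obtain ⟨s, hs⟩ := Multiset.exists_cons_of_mem hα
  set m := g.natDegree with hm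
  have hmc : m = Multiset.card g.roots := (IsAlgClosed.splits g).natDegree_eq_card_roots
  have hn : f.natDegree = Multiset.card s + 1 := by
    rw [(IsAlgClosed.splits f).natDegree_eq_card_roots, hs, Multiset.card_cons]
  set k := Multiset.card s with hk
  set Y := (g.roots.map fun β ↦ max 1 ‖θ - β‖).prod with hY
  have hY1 : 1 ≤ Y := one_le_prod_max _ _
  set X' := (s.map fun α ↦ max 1 ‖θ - α‖).prod with hX'
  have hX1 : 1 ≤ X' := one_le_prod_max _ _
  have hge : ‖g.eval θ‖ = ‖g.leadingCoeff‖ * (g.roots.map fun β ↦ ‖θ - β‖).prod := by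
    rw [(IsAlgClosed.splits g).eval_eq_prod_roots, norm_mul, norm_multisetProd]
  have hα' : (g.roots.map fun β ↦ ‖α - β‖).prod ≤ 2 ^ m * (g.roots.map fun β ↦ ‖θ - β‖).prod := by
    rw [hmc, ← Multiset.prod_replicate, ← Multiset.map_const', ← Multiset.prod_map_mul]
    refine Multiset.prod_map_le_prod_map₀ _ _ (fun _ _ ↦ norm_nonneg _) fun β hβ ↦ ?_
    have h1 : ‖α - β‖ ≤ ‖α - θ‖ + ‖θ - β‖ := norm_sub_le_norm_sub_add_norm_sub _ _ _
    rw [norm_sub_rev α θ] at h1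
    linarith [h β hβ]
  have hrow (γ : ℂ) : (g.roots.map fun β ↦ ‖γ - β‖).prod ≤ (2 * max 1 ‖θ - γ‖) ^ m * Y := by
    rw [hmc, ← Multiset.prod_replicate, ← Multiset.map_const', ← Multiset.prod_map_mul]
    refine Multiset.prod_map_le_prod_map₀ _ _ (fun _ _ ↦ norm_nonneg _) fun β hβ ↦ ?_
    have h1 : ‖γ - β‖ ≤ ‖γ - θ‖ + ‖θ - β‖ := norm_sub_le_norm_sub_add_norm_sub _ _ _
    rw [norm_sub_rev γ θ] at h1
    have h2 := le_max_left 1 ‖θ - γ‖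
    have h3 := le_max_right 1 ‖θ - γ‖
    have h4 := le_max_left 1 ‖θ - β‖
    have h5 := le_max_right 1 ‖θ - β‖
    nlinarith
  have hrest : (s.map fun γ ↦ (g.roots.map fun β ↦ ‖γ - β‖).prod).prod ≤
      (2 ^ k * X') ^ m * Y ^ k := by
    refine (Multiset.prod_map_le_prod_map₀ _ _ (fun γ _ ↦ Multiset.prod_nonneg ?_)
      fun γ _ ↦ hrow γ).trans_eq ?_
    · simp only [Multiset.mem_map]
      rintro _ ⟨β, _, rfl⟩
      exact norm_nonneg _
    · rw [Multiset.prod_map_mul, Multiset.prod_map_pow, Multiset.prod_map_mul, Multiset.map_const',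
        Multiset.prod_replicate, Multiset.map_const', Multiset.prod_replicate]
  have hP0 : 0 ≤ (g.roots.map fun β ↦ ‖θ - β‖).prod := by
    refine Multiset.prod_nonneg ?_
    simp only [Multiset.mem_map]
    rintro _ ⟨β, _, rfl⟩
    exact norm_nonneg _
  have hXf : ‖f.leadingCoeff‖ * X' ≤ shiftedMahler θ f := by
    rw [shiftedMahler, hs, Multiset.map_cons, Multiset.prod_cons]
    gcongr
    exact le_mul_of_one_le_left (by positivity) (le_max_left _ _)
  rw [norm_resultant f g hf0 hg0, hs, Multiset.map_cons, Multiset.prod_cons, hn, hge]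
  set a := ‖f.leadingCoeff‖
  set b := ‖g.leadingCoeff‖
  have hgM : shiftedMahler θ g = b * Y := rfl
  have hbY : 1 ≤ b * Y := one_le_mul_of_one_le_of_one_le hg hY1
  set p := (g.roots.map fun β ↦ ‖θ - β‖).prod
  calc a ^ m * b ^ (k + 1) * ((g.roots.map fun β ↦ ‖α - β‖).prod *
        (s.map fun γ ↦ (g.roots.map fun β ↦ ‖γ - β‖).prod).prod)
      ≤ a ^ m * b ^ (k + 1) * ((2 ^ m * p) * ((2 ^ k * X') ^ m * Y ^ k)) := by
        gcongr
        refine Multiset.prod_nonneg ?_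
        simp only [Multiset.mem_map]
        rintro _ ⟨γ, _, rfl⟩
        refine Multiset.prod_nonneg ?_
        simp only [Multiset.mem_map]
        rintro _ ⟨β, _, rfl⟩
        exact norm_nonneg _
    _ = 2 ^ ((k + 1) * m) * (a * X') ^ m * (b * Y) ^ k * (b * p) := by
        rw [add_mul, one_mul, pow_add 2, pow_mul 2]
        ring
    _ ≤ 2 ^ ((k + 1) * m) * shiftedMahler θ f ^ m * shiftedMahler θ g ^ (k + 1) * (b * p) := by
        rw [hgM]
        have h0 : 0 ≤ shiftedMahler θ f := zero_le_one.trans (one_le_shiftedMahler θ hf)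
        have : (b * Y) ^ k ≤ (b * Y) ^ (k + 1) := pow_le_pow_right₀ hbY (Nat.le_succ k)
        gcongr

end Resultant

section Gelfond

open Polynomial

/-- The degree plus the logarithmic Mahler measure. -/
noncomputable def polySize (f : ℤ[X]) : ℝ :=
  f.natDegree + Real.log (f.map (Int.castRingHom ℂ)).mahlerMeasure

lemma log_mahler_nonneg (f : ℤ[X]) : 0 ≤ Real.log (f.map (Int.castRingHom ℂ)).mahlerMeasure := by
  by_cases hf : f = 0
  · simp [hf]
  · exact Real.log_nonneg (one_le_mahlerMeasure_of_ne_zero hf)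

lemma natDegree_le_polySize (f : ℤ[X]) : f.natDegree ≤ polySize f :=
  le_add_of_nonneg_right (log_mahler_nonneg f)

lemma polySize_nonneg (f : ℤ[X]) : 0 ≤ polySize f :=
  (Nat.cast_nonneg _).trans (natDegree_le_polySize f)

lemma polySize_mul {f g : ℤ[X]} (hf : f ≠ 0) (hg : g ≠ 0) :
    polySize (f * g) = polySize f + polySize g := by
  have h1 := (one_le_mahlerMeasure_of_ne_zero hf).trans_lt' zero_lt_one
  have h2 := (one_le_mahlerMeasure_of_ne_zero hg).trans_lt' zero_lt_one
  rw [polySize, polySize, polySize, natDegree_mul hf hg, Polynomial.map_mul, mahlerMeasure_mul,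
    Real.log_mul h1.ne' h2.ne', Nat.cast_add]
  ring

lemma polySize_le_of_dvd {f g : ℤ[X]} (hg : g ≠ 0) (h : f ∣ g) : polySize f ≤ polySize g := by
  obtain ⟨k, rfl⟩ := h
  rw [polySize_mul (left_ne_zero_of_mul hg) (right_ne_zero_of_mul hg)]
  linarith [polySize_nonneg k]

lemma norm_aeval_of_isUnit {u : ℤ[X]} (hu : IsUnit u) (θ : ℂ) : ‖aeval θ u‖ = 1 := by
  obtain ⟨r, hr, rfl⟩ := Polynomial.isUnit_iff.mp hu
  rcases Int.isUnit_iff.mp hr with rfl | rfl <;> simp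

lemma one_le_norm_intCast {n : ℤ} (hn : n ≠ 0) : 1 ≤ ‖(n : ℂ)‖ := by
  rw [Complex.norm_intCast]
  exact_mod_cast Int.one_le_abs hn

lemma le_log_norm_of_irreducible_factors {θ : ℂ} (hθ : Transcendental ℤ θ) {lam : ℝ}
    (hlam : 0 ≤ lam) (p : ℤ[X]) :
    p ≠ 0 → (∀ q, Irreducible q → q ∣ p → -(lam * polySize q) ≤ Real.log ‖aeval θ q‖) →
      -(lam * polySize p) ≤ Real.log ‖aeval θ p‖ := by
  have hne {q : ℤ[X]} (hq : q ≠ 0) : ‖aeval θ q‖ ≠ 0 :=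
    norm_ne_zero_iff.mpr fun h ↦ hθ ⟨q, hq, h⟩
  induction p using WfDvdMonoid.induction_on_irreducible with
  | zero => exact fun h ↦ (h rfl).elim
  | unit u hu =>
    intro _ _
    rw [norm_aeval_of_isUnit hu, Real.log_one]
    nlinarith [polySize_nonneg u]
  | mul a i ha hi ih =>
    intro _ h
    have h1 := ih ha fun q hq hqa ↦ h q hq (hqa.mul_left i)
    have h2 := h i hi (dvd_mul_right i a)
    rw [polySize_mul hi.ne_zero ha, map_mul, norm_mul, Real.log_mul (hne hi.ne_zero) (hne ha)]
    linarith

lemma resultant_ne_zero_of_irreducible {f g : ℤ[X]} (hf : Irreducible f) (hg : Irreducible g)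
    (hfd : f.natDegree ≠ 0) (hfg : ¬ Associated f g) :
    resultant f g ≠ 0 := by
  have hinj := Int.cast_injective (α := ℚ)
  have hfp := hf.isPrimitive hfd
  have hf' := (IsPrimitive.Int.irreducible_iff_irreducible_map_cast hfp).mp hf
  have h : ¬ (f.map (Int.castRingHom ℚ)) ∣ (g.map (Int.castRingHom ℚ)) := by
    rw [← IsPrimitive.Int.dvd_iff_map_cast_dvd_map_cast f g hfp]
    exact fun h ↦ hfg (hf.associated_of_dvd hg h)
  have hcop := (hf'.coprime_iff_not_dvd).mpr h
  intro h0
  have h1 : resultant (f.map (Int.castRingHom ℚ)) (g.map (Int.castRingHom ℚ)) = 0 := by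
    rw [natDegree_map_eq_of_injective hinj, natDegree_map_eq_of_injective hinj, resultant_map_map,
      h0, map_zero]
  exact (resultant_eq_zero_iff.mp h1).2 hcop

lemma exp_le_of_norm_resultant_le {f g : ℤ[X]} {θ : ℂ} {x : ℝ}
    (hf0 : f ≠ 0) (hg0 : g ≠ 0)
    (h : 1 ≤ 2 ^ (f.natDegree * g.natDegree) *
      shiftedMahler θ (f.map (Int.castRingHom ℂ)) ^ g.natDegree *
      shiftedMahler θ (g.map (Int.castRingHom ℂ)) ^ f.natDegree * x) :
    Real.exp (-((3 + 2 * Real.log (1 + ‖θ‖)) * (polySize f * polySize g))) ≤ x := by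
  have hsm (p : ℤ[X]) (hp : p ≠ 0) : shiftedMahler θ (p.map (Int.castRingHom ℂ)) ≤
      Real.exp (p.natDegree * Real.log (1 + ‖θ‖) +
        Real.log (p.map (Int.castRingHom ℂ)).mahlerMeasure) := by
    refine (shiftedMahler_le θ _).trans_eq ?_
    rw [Real.exp_add, Real.exp_log ((one_le_mahlerMeasure_of_ne_zero hp).trans_lt' zero_lt_one),
      Real.exp_nat_mul, Real.exp_log (by positivity),
      natDegree_map_eq_of_injective Int.cast_injective]
  have hnn (p : ℤ[X]) : 0 ≤ shiftedMahler θ (p.map (Int.castRingHom ℂ)) :=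
    mul_nonneg (norm_nonneg _) (zero_le_one.trans (one_le_prod_max _ _))
  have hx : 0 < x := by
    by_contra! hx
    have : 2 ^ (f.natDegree * g.natDegree) *
      shiftedMahler θ (f.map (Int.castRingHom ℂ)) ^ g.natDegree *
      shiftedMahler θ (g.map (Int.castRingHom ℂ)) ^ f.natDegree * x ≤ 0 :=
      mul_nonpos_of_nonneg_of_nonpos (by have := hnn f; have := hnn g; positivity) hx
    linarith
  have h2e : (2 : ℝ) ≤ Real.exp 1 := by linarith [Real.add_one_le_exp (1 : ℝ)]
  set L := Real.log (1 + ‖θ‖) with hL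
  have hL0 : 0 ≤ L := Real.log_nonneg (by linarith [norm_nonneg θ])
  have hMf := log_mahler_nonneg f
  have hMg := log_mahler_nonneg g
  set mf := Real.log (f.map (Int.castRingHom ℂ)).mahlerMeasure with hmf
  set mg := Real.log (g.map (Int.castRingHom ℂ)).mahlerMeasure with hmg
  have hpf : polySize f = f.natDegree + mf := rfl
  have hpg : polySize g = g.natDegree + mg := rfl
  have h' : 1 ≤ Real.exp ((3 + 2 * L) * (polySize f * polySize g)) * x := by
    refine h.trans ?_
    calc _ ≤ Real.exp 1 ^ (f.natDegree * g.natDegree) *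
          Real.exp (f.natDegree * L + mf) ^ g.natDegree *
          Real.exp (g.natDegree * L + mg) ^ f.natDegree * x := by
          have h3 := hnn f
          have h4 := hnn g
          have h5 := hsm f hf0
          have h6 := hsm g hg0
          gcongr
      _ ≤ _ := by
          rw [← Real.exp_nat_mul, ← Real.exp_nat_mul, ← Real.exp_nat_mul, ← Real.exp_add,
            ← Real.exp_add]
          gcongr
          rw [hpf, hpg]
          push_cast
          have hn : (0 : ℝ) ≤ f.natDegree := Nat.cast_nonneg _
          have hm : (0 : ℝ) ≤ g.natDegree := Nat.cast_nonneg _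
          have e1 := mul_nonneg hn hm
          have e2 := mul_nonneg hn hMg
          have e3 := mul_nonneg hMf hm
          have e4 := mul_nonneg hMf hMg
          nlinarith [mul_nonneg hL0 e2, mul_nonneg hL0 e3, mul_nonneg hL0 e4]
  rw [Real.exp_neg, inv_le_iff_one_le_mul₀ (Real.exp_pos _), mul_comm]
  exact h'

lemma exp_le_norm_aeval_or {f g : ℤ[X]} (hf : Irreducible f) (hg : Irreducible g)
    (hfd : f.natDegree ≠ 0) (hgd : g.natDegree ≠ 0) (hfg : ¬ Associated f g) (θ : ℂ) :
    Real.exp (-((3 + 2 * Real.log (1 + ‖θ‖)) * (polySize f * polySize g))) ≤ ‖aeval θ f‖ ∨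
    Real.exp (-((3 + 2 * Real.log (1 + ‖θ‖)) * (polySize f * polySize g))) ≤ ‖aeval θ g‖ := by
  have hinj := Int.cast_injective (α := ℂ)
  have hres (p q : ℤ[X]) (h : resultant p q ≠ 0) :
      1 ≤ ‖resultant (p.map (Int.castRingHom ℂ)) (q.map (Int.castRingHom ℂ))‖ := by
    rw [natDegree_map_eq_of_injective hinj, natDegree_map_eq_of_injective hinj, resultant_map_map]
    exact one_le_norm_intCast h
  have hlc (p : ℤ[X]) (hp : p ≠ 0) : 1 ≤ ‖(p.map (Int.castRingHom ℂ)).leadingCoeff‖ := by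
    rw [leadingCoeff_map_of_injective hinj]
    have h0 : p.leadingCoeff ≠ 0 := leadingCoeff_ne_zero.mpr hp
    exact one_le_norm_intCast h0
  have hev (p : ℤ[X]) : ‖aeval θ p‖ = ‖(p.map (Int.castRingHom ℂ)).eval θ‖ := by
    rw [eval_map]
    rfl
  have hex (p : ℤ[X]) (hp : p.natDegree ≠ 0) : ∃ α ∈ (p.map (Int.castRingHom ℂ)).roots,
      ∀ β ∈ (p.map (Int.castRingHom ℂ)).roots, ‖θ - α‖ ≤ ‖θ - β‖ := by
    have hne : (p.map (Int.castRingHom ℂ)).roots ≠ 0 := by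
      rw [← Multiset.card_pos, ← (IsAlgClosed.splits _).natDegree_eq_card_roots,
        natDegree_map_eq_of_injective hinj]
      omega
    obtain ⟨α, hα, h⟩ := Finset.exists_min_image (p.map (Int.castRingHom ℂ)).roots.toFinset
      (fun β ↦ ‖θ - β‖) (Multiset.toFinset_nonempty.mpr hne)
    exact ⟨α, Multiset.mem_toFinset.mp hα, fun β hβ ↦ h β (Multiset.mem_toFinset.mpr hβ)⟩
  obtain ⟨α, hα, hαm⟩ := hex f hfd
  obtain ⟨β, hβ, hβm⟩ := hex g hgd
  have hf0 := hf.ne_zero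
  have hg0 := hg.ne_zero
  rcases le_total ‖θ - α‖ ‖θ - β‖ with h | h
  · right
    rw [hev]
    refine exp_le_of_norm_resultant_le hf0 hg0 ?_
    have := norm_resultant_le_of_closest (hlc f hf0) (hlc g hg0) hα fun γ hγ ↦ h.trans (hβm γ hγ)
    rw [natDegree_map_eq_of_injective hinj f, natDegree_map_eq_of_injective hinj g] at this
    have h1 := hres f g (resultant_ne_zero_of_irreducible hf hg hfd hfg)
    rw [natDegree_map_eq_of_injective hinj f, natDegree_map_eq_of_injective hinj g] at h1
    exact h1.trans this
  · left
    rw [hev, mul_comm (polySize f)]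
    refine exp_le_of_norm_resultant_le hg0 hf0 ?_
    have := norm_resultant_le_of_closest (hlc g hg0) (hlc f hf0) hβ fun γ hγ ↦ h.trans (hαm γ hγ)
    rw [natDegree_map_eq_of_injective hinj f, natDegree_map_eq_of_injective hinj g] at this
    have h1 := hres g f (resultant_ne_zero_of_irreducible hg hf hgd fun h ↦ hfg h.symm)
    rw [natDegree_map_eq_of_injective hinj f, natDegree_map_eq_of_injective hinj g] at h1
    exact h1.trans this

lemma mahlerMeasure_le_of_norm_eval_le {f : ℂ[X]} {L : ℝ} (hL : 1 ≤ L)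
    (h : ∀ z : ℂ, ‖z‖ = 1 → ‖f.eval z‖ ≤ L) : Real.log f.mahlerMeasure ≤ Real.log L := by
  rw [← logMahlerMeasure_eq_log_MahlerMeasure, logMahlerMeasure_def]
  refine Real.circleAverage_mono_on_of_le_circle
    (analyticOnNhd_id.aeval_polynomial f).meromorphicOn.circleIntegrable_log_norm fun z hz ↦ ?_
  rcases (norm_nonneg (f.eval z)).eq_or_lt with h0 | h0
  · rw [← h0, Real.log_zero]
    exact Real.log_nonneg hL
  · exact Real.log_le_log h0 (h z (by simpa using hz))

/-- A form of Gelfond's transcendence criterion. -/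
lemma gelfond_criterion {θ : ℂ} (hθ : Transcendental ℤ θ) {C c : ℝ} (hC : 0 < C) (hc : 0 < c)
    {s₀ : ℕ} (h : ∀ s ≥ s₀, ∃ p : ℤ[X], p ≠ 0 ∧ polySize p ≤ C * s ^ 7 ∧
      ‖aeval θ p‖ ≤ Real.exp (-(c * s ^ 15))) : False := by
  have hne {q : ℤ[X]} (hq : q ≠ 0) : 0 < ‖aeval θ q‖ :=
    norm_pos_iff.mpr fun h ↦ hθ ⟨q, hq, h⟩
  set lam : ℕ → ℝ := fun s ↦ c / (2 * C) * s ^ 8 with hlam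
  have hlam0 (s : ℕ) : 0 ≤ lam s := by positivity
  have hq (s : ℕ) : ∃ q : ℤ[X], s ≥ s₀ + 1 → Irreducible q ∧ polySize q ≤ C * s ^ 7 ∧
      ‖aeval θ q‖ < Real.exp (-(lam s * polySize q)) := by
    by_cases hs : s ≥ s₀ + 1
    swap
    · exact ⟨0, fun h ↦ (hs h).elim⟩
    obtain ⟨p, hp0, hps, hpv⟩ := h s (by omega)
    by_contra! hcon
    have h1 := le_log_norm_of_irreducible_factors hθ (hlam0 s) p hp0 fun q hqi hqp ↦ by
      obtain ⟨_, hq⟩ := hcon q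
      rw [Real.le_log_iff_exp_le (hne hqi.ne_zero)]
      exact hq hqi ((polySize_le_of_dvd hp0 hqp).trans hps)
    have h2 : Real.log ‖aeval θ p‖ ≤ -(c * s ^ 15) := (Real.log_le_iff_le_exp (hne hp0)).mpr hpv
    have hs1 : (0 : ℝ) < s := by exact_mod_cast (by omega : 0 < s)
    have h3 : lam s * polySize p ≤ c / 2 * s ^ 15 := by
      calc lam s * polySize p ≤ lam s * (C * s ^ 7) := mul_le_mul_of_nonneg_left hps (hlam0 s)
        _ = _ := by rw [hlam]; field_simp
    have h4 : 0 < c * (s : ℝ) ^ 15 := by positivity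
    linarith
  choose q hq using hq
  have hdeg (s : ℕ) (hs : s ≥ s₀ + 1) : (q s).natDegree ≠ 0 := by
    obtain ⟨hi, _, hv⟩ := hq s hs
    intro h0
    obtain ⟨x, hx⟩ := natDegree_eq_zero.mp h0
    have hx0 : x ≠ 0 := by rintro rfl; exact hi.ne_zero (by rw [← hx, C_0])
    have h1 : 1 ≤ ‖aeval θ (q s)‖ := by
      rw [← hx, aeval_C]
      exact one_le_norm_intCast hx0
    have h2 : Real.exp (-(lam s * polySize (q s))) ≤ 1 :=
      Real.exp_le_one_iff.mpr (neg_nonpos.mpr (mul_nonneg (hlam0 s) (polySize_nonneg _)))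
    linarith
  set κ := 3 + 2 * Real.log (1 + ‖θ‖) with hκ
  have hκ0 : 0 ≤ κ := by
    have : 0 ≤ Real.log (1 + ‖θ‖) := Real.log_nonneg (by linarith [norm_nonneg θ])
    linarith
  obtain ⟨s₁, hs₁⟩ := exists_nat_ge (κ * C * 2 ^ 7 / (c / (2 * C)))
  have hbig (s : ℕ) (hs : s ≥ s₁) (hs0 : 1 ≤ s) : κ * (C * ((s + 1 : ℕ) : ℝ) ^ 7) ≤ lam s := by
    have hs' : (1 : ℝ) ≤ s := by exact_mod_cast hs0
    have h1 : κ * C * 2 ^ 7 ≤ s * (c / (2 * C)) := by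
      rw [← div_le_iff₀ (by positivity)]
      exact hs₁.trans (by exact_mod_cast hs)
    calc κ * (C * ((s + 1 : ℕ) : ℝ) ^ 7) ≤ κ * (C * (2 * s) ^ 7) := by
          gcongr
          push_cast
          linarith
      _ = (κ * C * 2 ^ 7) * s ^ 7 := by ring
      _ ≤ (s * (c / (2 * C))) * s ^ 7 := by gcongr
      _ = lam s := by rw [hlam]; ring
  have hlam_mono (s : ℕ) : lam s ≤ lam (s + 1) := by
    simp only [hlam]
    gcongr
    omega
  set s₂ := s₀ + s₁ + 1 with hs₂
  have hassoc (s : ℕ) (hs : s ≥ s₂) : Associated (q s) (q (s + 1)) := by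
    by_contra hna
    obtain ⟨hi, hz, hv⟩ := hq s (by omega)
    obtain ⟨hi', hz', hv'⟩ := hq (s + 1) (by omega)
    have hb := hbig s (by omega) (by omega)
    have hn := polySize_nonneg (q s)
    have hn' := polySize_nonneg (q (s + 1))
    rcases exp_le_norm_aeval_or hi hi' (hdeg s (by omega)) (hdeg (s + 1) (by omega)) hna θ with h | h
    · have h1 := Real.exp_lt_exp.mp (h.trans_lt hv)
      have h2 : κ * polySize (q (s + 1)) ≤ lam s := le_trans (by gcongr) hb
      nlinarith
    · have h1 := Real.exp_lt_exp.mp (h.trans_lt hv')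
      have h2 : κ * polySize (q s) ≤ lam (s + 1) := by
        refine le_trans ?_ (hb.trans (hlam_mono s))
        refine mul_le_mul_of_nonneg_left (hz.trans ?_) hκ0
        gcongr
        omega
      nlinarith
  have hall (k : ℕ) : Associated (q s₂) (q (s₂ + k)) := by
    induction k with
    | zero => exact Associated.refl _
    | succ k ih => exact ih.trans (hassoc _ (by omega))
  obtain ⟨hi, -, -⟩ := hq s₂ (by omega)
  set v := ‖aeval θ (q s₂)‖ with hv
  have hv0 : 0 < v := hne hi.ne_zero
  obtain ⟨k, hk⟩ := exists_nat_gt (-Real.log v / (c / (2 * C)))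
  obtain ⟨-, -, hlt⟩ := hq (s₂ + k) (by omega)
  obtain ⟨u, hu⟩ := hall k
  have hval : ‖aeval θ (q (s₂ + k))‖ = v := by
    rw [← hu, map_mul, norm_mul, norm_aeval_of_isUnit u.isUnit, mul_one]
  rw [hval, ← Real.log_lt_iff_lt_exp hv0] at hlt
  rw [div_lt_iff₀ (by positivity)] at hk
  have h1 : (1 : ℝ) ≤ polySize (q (s₂ + k)) := by
    refine le_trans ?_ (natDegree_le_polySize _)
    exact_mod_cast Nat.one_le_iff_ne_zero.mpr (hdeg (s₂ + k) (by omega))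
  have h2 : k * (c / (2 * C)) ≤ lam (s₂ + k) := by
    have h3 : (k : ℝ) ≤ ((s₂ + k : ℕ) : ℝ) ^ 8 := by
      have : k ≤ (s₂ + k) ^ 8 := (Nat.le_add_left k s₂).trans (Nat.le_self_pow (by norm_num) _)
      exact_mod_cast this
    calc k * (c / (2 * C)) ≤ ((s₂ + k : ℕ) : ℝ) ^ 8 * (c / (2 * C)) := by gcongr
      _ = _ := by rw [hlam]; ring
  nlinarith [hlam0 (s₂ + k)]

end Gelfond

section Norms

open Polynomial

variable {n : ℕ}

lemma rowSum_mul_le {A B : Matrix (Fin n) (Fin n) ℂ} {x y : ℝ} (hy : 0 ≤ y)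
    (hA : ∀ i, ∑ j, ‖A i j‖ ≤ x) (hB : ∀ i, ∑ j, ‖B i j‖ ≤ y) (i : Fin n) :
    ∑ j, ‖(A * B) i j‖ ≤ x * y := by
  calc ∑ j, ‖(A * B) i j‖ ≤ ∑ j, ∑ k, ‖A i k‖ * ‖B k j‖ := by
        refine Finset.sum_le_sum fun j _ ↦ ?_
        rw [Matrix.mul_apply]
        exact (norm_sum_le _ _).trans_eq (by simp only [norm_mul])
    _ = ∑ k, ‖A i k‖ * ∑ j, ‖B k j‖ := by
        rw [Finset.sum_comm]
        simp only [Finset.mul_sum]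
    _ ≤ ∑ k, ‖A i k‖ * y := by
        gcongr with k
        exact hB k
    _ ≤ x * y := by
        rw [← Finset.sum_mul]
        gcongr
        exact hA i

lemma rowSum_pow_le {A : Matrix (Fin n) (Fin n) ℂ} {x : ℝ} (hx : 0 ≤ x)
    (hA : ∀ i, ∑ j, ‖A i j‖ ≤ x) (k : ℕ) (i : Fin n) : ∑ j, ‖(A ^ k) i j‖ ≤ x ^ k := by
  induction k generalizing i with
  | zero => simp [Matrix.one_apply, apply_ite norm]
  | succ k ih =>
    rw [pow_succ, pow_succ]
    exact rowSum_mul_le hx ih hA i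

lemma natDegree_matrix_mul_le {A B : Matrix (Fin n) (Fin n) ℤ[X]} {a b : ℕ}
    (hA : ∀ i j, (A i j).natDegree ≤ a) (hB : ∀ i j, (B i j).natDegree ≤ b) (i j : Fin n) :
    ((A * B) i j).natDegree ≤ a + b := by
  rw [Matrix.mul_apply]
  exact natDegree_sum_le_of_forall_le _ _ fun k _ ↦
    natDegree_mul_le.trans (add_le_add (hA i k) (hB k j))

lemma natDegree_matrix_pow_le {A : Matrix (Fin n) (Fin n) ℤ[X]} {a : ℕ}
    (hA : ∀ i j, (A i j).natDegree ≤ a) (k : ℕ) (i j : Fin n) :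
    ((A ^ k) i j).natDegree ≤ k * a := by
  induction k generalizing i j with
  | zero => by_cases h : i = j <;> simp [h]
  | succ k ih =>
    rw [pow_succ, add_mul, one_mul]
    exact natDegree_matrix_mul_le ih hA i j

lemma natDegree_det_le_of_entries {A : Matrix (Fin n) (Fin n) ℤ[X]} {a : ℕ}
    (hA : ∀ i j, (A i j).natDegree ≤ a) : A.det.natDegree ≤ n * a := by
  rw [Matrix.det_apply]
  refine natDegree_sum_le_of_forall_le _ _ fun σ _ ↦ (natDegree_smul_le _ _).trans ?_
  refine (natDegree_prod_le _ _).trans ((Finset.sum_le_sum fun i _ ↦ hA (σ i) i).trans_eq ?_)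
  simp

/-- The value at commuting or non-commuting matrices of the homogenization of `B` in degree `D`,
with monomials in the standard order. -/
noncomputable def homogenizedEval {S : Type*} [CommRing S] (h : S)
    (M : Fin 3 → Matrix (Fin n) (Fin n) S) (D : ℕ) (B : MvPolynomial (Fin 3) ℤ) :
    Matrix (Fin n) (Fin n) S :=
  ∑ e ∈ B.support, (((B.coeff e : ℤ) : S) * h ^ (D - (e 0 + e 1 + e 2))) •
    (M 0 ^ e 0 * M 1 ^ e 1 * M 2 ^ e 2)

lemma degree_le_of_mem_support {B : MvPolynomial (Fin 3) ℤ} {D : ℕ} (hB : B.totalDegree ≤ D)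
    {e : Fin 3 →₀ ℕ} (he : e ∈ B.support) : e 0 + e 1 + e 2 ≤ D := by
  have h := (MvPolynomial.le_totalDegree he).trans hB
  rwa [Finsupp.sum_fintype _ _ (fun _ ↦ rfl), Fin.sum_univ_three] at h

lemma map_homogenizedEval {S T : Type*} [CommRing S] [CommRing T] (f : S →+* T) (h : S)
    (M : Fin 3 → Matrix (Fin n) (Fin n) S) (D : ℕ) (B : MvPolynomial (Fin 3) ℤ) :
    (homogenizedEval h M D B).map f = homogenizedEval (f h) (fun k ↦ (M k).map f) D B := by
  have hf : ∀ A : Matrix (Fin n) (Fin n) S, A.map f = f.mapMatrix A := fun _ ↦ rfl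
  have hs (c : S) (A : Matrix (Fin n) (Fin n) S) : f.mapMatrix (c • A) = f c • f.mapMatrix A := by
    ext i j
    simp
  simp only [homogenizedEval, hf, map_sum, hs, map_mul, map_pow, map_intCast]

lemma natDegree_homogenizedEval_le {h : ℤ[X]} {M : Fin 3 → Matrix (Fin n) (Fin n) ℤ[X]} {d D : ℕ}
    {B : MvPolynomial (Fin 3) ℤ} (hB : B.totalDegree ≤ D) (hh : h.natDegree ≤ d)
    (hM : ∀ k i j, (M k i j).natDegree ≤ d) (i j : Fin n) :
    (homogenizedEval h M D B i j).natDegree ≤ D * d := by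
  rw [homogenizedEval, Matrix.sum_apply]
  refine natDegree_sum_le_of_forall_le _ _ fun e he ↦ ?_
  have hd := degree_le_of_mem_support hB he
  have h1 : (h ^ (D - (e 0 + e 1 + e 2))).natDegree ≤ (D - (e 0 + e 1 + e 2)) * d :=
    natDegree_pow_le.trans (Nat.mul_le_mul_left _ hh)
  have h2 := natDegree_matrix_mul_le (natDegree_matrix_mul_le
    (natDegree_matrix_pow_le (hM 0) (e 0)) (natDegree_matrix_pow_le (hM 1) (e 1)))
    (natDegree_matrix_pow_le (hM 2) (e 2)) i j
  rw [Matrix.smul_apply, smul_eq_mul, mul_assoc]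
  refine (natDegree_mul_le.trans (add_le_add (natDegree_intCast _).le natDegree_mul_le)).trans ?_
  calc 0 + ((h ^ (D - (e 0 + e 1 + e 2))).natDegree +
        ((M 0 ^ e 0 * M 1 ^ e 1 * M 2 ^ e 2) i j).natDegree)
      ≤ 0 + ((D - (e 0 + e 1 + e 2)) * d + (e 0 * d + e 1 * d + e 2 * d)) := by gcongr
    _ = ((D - (e 0 + e 1 + e 2)) + (e 0 + e 1 + e 2)) * d := by ring
    _ = D * d := by rw [Nat.sub_add_cancel hd]

lemma norm_homogenizedEval_le {h : ℂ} {M : Fin 3 → Matrix (Fin n) (Fin n) ℂ} {D : ℕ} {x : ℝ}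
    {B : MvPolynomial (Fin 3) ℤ} (hB : B.totalDegree ≤ D) (hx : 0 ≤ x) (hh : ‖h‖ ≤ x)
    (hM : ∀ k i, ∑ j, ‖M k i j‖ ≤ x) (i j : Fin n) :
    ‖homogenizedEval h M D B i j‖ ≤ mvLength B * x ^ D := by
  rw [homogenizedEval, Matrix.sum_apply, mvLength, Finset.sum_mul]
  refine norm_sum_le_of_le _ fun e he ↦ ?_
  have hd := degree_le_of_mem_support hB he
  rw [Matrix.smul_apply, smul_eq_mul, norm_mul, norm_mul, norm_pow]
  have h2 := rowSum_mul_le (by positivity) (rowSum_mul_le (by positivity)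
    (rowSum_pow_le hx (hM 0) (e 0)) (rowSum_pow_le hx (hM 1) (e 1)))
    (rowSum_pow_le hx (hM 2) (e 2)) i
  have h3 := (Finset.single_le_sum (f := fun j ↦ ‖(M 0 ^ e 0 * M 1 ^ e 1 * M 2 ^ e 2) i j‖)
    (fun _ _ ↦ norm_nonneg _) (Finset.mem_univ j)).trans h2
  have h4 : ‖((B.coeff e : ℤ) : ℂ)‖ = ‖B.coeff e‖ := by
    rw [Complex.norm_intCast, Int.norm_eq_abs]
  calc ‖((B.coeff e : ℤ) : ℂ)‖ * ‖h‖ ^ (D - (e 0 + e 1 + e 2)) *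
        ‖(M 0 ^ e 0 * M 1 ^ e 1 * M 2 ^ e 2) i j‖
      ≤ ‖B.coeff e‖ * x ^ (D - (e 0 + e 1 + e 2)) * (x ^ e 0 * x ^ e 1 * x ^ e 2) := by
        rw [h4]
        gcongr
    _ = ‖B.coeff e‖ * x ^ ((D - (e 0 + e 1 + e 2)) + (e 0 + e 1 + e 2)) := by ring
    _ = _ := by rw [Nat.sub_add_cancel hd]

lemma homogenizedEval_leftMulMatrix {F K : Type*} [Field F] [Field K] [Algebra F K]
    (b : Module.Basis (Fin n) F K) (w : Fin 3 → K) (h : F) {D : ℕ} {B : MvPolynomial (Fin 3) ℤ}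
    (hB : B.totalDegree ≤ D) :
    homogenizedEval h (fun k ↦ h • Algebra.leftMulMatrix b (w k)) D B =
      h ^ D • Algebra.leftMulMatrix b (MvPolynomial.aeval w B) := by
  rw [homogenizedEval, MvPolynomial.aeval_def, MvPolynomial.eval₂_eq', map_sum, Finset.smul_sum]
  refine Finset.sum_congr rfl fun e he ↦ ?_
  have hd := degree_le_of_mem_support hB he
  rw [Fin.prod_univ_three, map_mul, map_mul, map_mul, map_pow, map_pow, map_pow, _root_.smul_pow, _root_.smul_pow,
    _root_.smul_pow, smul_mul_smul_comm, smul_mul_smul_comm, smul_smul]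
  have h1 : Algebra.leftMulMatrix b (algebraMap ℤ K (B.coeff e)) =
      ((B.coeff e : ℤ) : F) • (1 : Matrix (Fin n) (Fin n) F) := by
    rw [eq_intCast, map_intCast]
    simp [Algebra.smul_def]
  rw [h1, smul_mul_assoc, one_mul, smul_smul]
  congr 1
  calc _ = ((B.coeff e : ℤ) : F) * h ^ ((D - (e 0 + e 1 + e 2)) + (e 0 + e 1 + e 2)) := by ring
    _ = _ := by rw [Nat.sub_add_cancel hd, mul_comm]

lemma norm_det_mul_le {A : Matrix (Fin n) (Fin n) ℂ} {v : Fin n → ℂ} {x : ℂ} {α : ℝ} (hα : 1 ≤ α)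
    (hA : ∀ i j, ‖A i j‖ ≤ α) (hv : Matrix.vecMul v A = x • v) (i : Fin n) :
    ‖A.det‖ * ‖v i‖ ≤ ‖x‖ * ((∑ j, ‖v j‖) * (n.factorial * α ^ n)) := by
  have h1 : A.det • v = x • Matrix.vecMul v A.adjugate := by
    rw [← Matrix.smul_vecMul, ← hv, Matrix.vecMul_vecMul, Matrix.mul_adjugate, Matrix.vecMul_smul,
      Matrix.vecMul_one]
  have hadj (j : Fin n) : ‖A.adjugate j i‖ ≤ n.factorial * α ^ n := by
    rw [Matrix.adjugate_apply]
    have := Matrix.det_le (abv := NormedField.toAbsoluteValue ℂ) (x := α)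
      (A := A.updateRow i (Pi.single j 1)) fun k l ↦ by
        by_cases hk : k = i
        · subst hk
          rw [Matrix.updateRow_self]
          by_cases hl : l = j
          · subst hl
            simpa using hα
          · simpa [hl] using zero_le_one.trans hα
        · rw [Matrix.updateRow_ne hk]
          exact hA k l
    simpa using! this
  have h2 := congrArg norm (congrFun h1 i)
  rw [Pi.smul_apply, Pi.smul_apply, smul_eq_mul, smul_eq_mul, norm_mul, norm_mul] at h2
  rw [h2, Finset.sum_mul]
  refine mul_le_mul_of_nonneg_left ?_ (norm_nonneg x)
  simp only [Matrix.vecMul, dotProduct]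
  refine norm_sum_le_of_le _ fun j _ ↦ ?_
  rw [norm_mul]
  gcongr
  exact hadj j

lemma exists_norm_aeval_le (f : ℤ[X]) (R : ℝ) :
    ∃ x : ℝ, 0 ≤ x ∧ ∀ z : ℂ, ‖z‖ ≤ R → ‖aeval z f‖ ≤ x := by
  obtain ⟨x, hx⟩ := (isCompact_closedBall (0 : ℂ) R).exists_bound_of_continuousOn
    (f := fun z ↦ aeval z f) (by fun_prop)
  exact ⟨max x 0, le_max_right _ _, fun z hz ↦ (hx z (by simpa using hz)).trans (le_max_left _ _)⟩

lemma exists_common_denominator {F τ : Type*} [Field F] [Fintype τ] (φ : ℤ[X] →+* F)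
    (hφ : ∀ x : F, ∃ p q, φ q ≠ 0 ∧ x * φ q = φ p) (x : τ → F) :
    ∃ h, φ h ≠ 0 ∧ ∀ t, ∃ m, φ m = φ h * x t := by
  classical
  choose p q hq hpq using fun t ↦ hφ (x t)
  refine ⟨∏ t, q t, ?_, fun t ↦ ⟨p t * ∏ u ∈ Finset.univ.erase t, q u, ?_⟩⟩
  · rw [map_prod]
    exact Finset.prod_ne_zero_iff.mpr fun t _ ↦ hq t
  · rw [← Finset.mul_prod_erase _ _ (Finset.mem_univ t), map_mul, map_mul, ← hpq]
    ring

end Norms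

section Elimination

open Polynomial

lemma pow_mul_mul_div_le {u x s S f v : ℝ} (hu : 0 ≤ u) (hux : u ≤ x) (D : ℕ) (hs : 0 ≤ s)
    (hS : 0 ≤ S) (hf : 0 ≤ f) (hv : 0 < v) :
    u ^ D * s * (S * f) / v ≤ s * (x ^ D * (S / v) * f) := by
  calc u ^ D * s * (S * f) / v ≤ x ^ D * s * (S * f) / v := by gcongr
    _ = s * (x ^ D * (S / v) * f) := by ring

/-- Taking norms to a purely transcendental subfield: bounds for a polynomial in one variable whose
value is, up to a denominator, the norm of the value of `B`. -/
lemma exists_norm_polynomial {F K : Type*} [Field F] [Field K] [Algebra F K] [FiniteDimensional F K]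
    (φ : ℤ[X] →+* F) (hφ : ∀ x : F, ∃ p q, φ q ≠ 0 ∧ x * φ q = φ p) (σ : K →+* ℂ) {θ : ℂ}
    (hσ : ∀ p, σ (algebraMap F K (φ p)) = aeval θ p) (w : Fin 3 → K) :
    ∃ (n d : ℕ) (x y : ℝ), 1 ≤ x ∧ 0 ≤ y ∧ ∀ (B : MvPolynomial (Fin 3) ℤ) (D : ℕ),
      B.totalDegree ≤ D → MvPolynomial.aeval w B ≠ 0 → ∃ p : ℤ[X], φ p ≠ 0 ∧
        p.natDegree ≤ n * (D * d) ∧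
        (∀ z : ℂ, ‖z‖ = 1 → ‖aeval z p‖ ≤ n.factorial * ((1 + mvLength B) * x ^ D) ^ n) ∧
        ‖aeval θ p‖ ≤ ‖σ (MvPolynomial.aeval w B)‖ * (x ^ D * y *
          (n.factorial * ((1 + mvLength B) * x ^ D) ^ n)) := by
  classical
  set n := Module.finrank F K with hn
  let b := Module.finBasis F K
  obtain ⟨h, hh0, hM⟩ := exists_common_denominator φ hφ
    fun t : Fin 3 × Fin n × Fin n ↦ Algebra.leftMulMatrix b (w t.1) t.2.1 t.2.2
  choose M' hM' using hM
  set M : Fin 3 → Matrix (Fin n) (Fin n) ℤ[X] := fun k ↦ Matrix.of fun i j ↦ M' (k, i, j) with hMdef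
  have hMφ (k : Fin 3) : (M k).map φ = φ h • Algebra.leftMulMatrix b (w k) := by
    ext i j
    exact hM' (k, i, j)
  set R := max 1 ‖θ‖ with hR
  obtain ⟨xh, hxh0, hxh⟩ := exists_norm_aeval_le h R
  choose xM hxM0 hxM using fun k i j ↦ exists_norm_aeval_le (M k i j) R
  set x : ℝ := 1 + xh + ∑ k, ∑ i, ∑ j, xM k i j with hx
  have hsum0 : 0 ≤ ∑ k, ∑ i, ∑ j, xM k i j :=
    Finset.sum_nonneg fun k _ ↦ Finset.sum_nonneg fun i _ ↦ Finset.sum_nonneg fun j _ ↦ hxM0 k i j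
  have hx1 : 1 ≤ x := by linarith
  have hxh' : xh ≤ x := by linarith
  have hxM' (k : Fin 3) (i : Fin n) : ∑ j, xM k i j ≤ x := by
    have h1 : ∑ j, xM k i j ≤ ∑ i, ∑ j, xM k i j :=
      Finset.single_le_sum (f := fun i ↦ ∑ j, xM k i j)
        (fun i _ ↦ Finset.sum_nonneg fun j _ ↦ hxM0 k i j) (Finset.mem_univ i)
    have h2 : ∑ i, ∑ j, xM k i j ≤ ∑ k, ∑ i, ∑ j, xM k i j :=
      Finset.single_le_sum (f := fun k ↦ ∑ i, ∑ j, xM k i j)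
        (fun k _ ↦ Finset.sum_nonneg fun i _ ↦ Finset.sum_nonneg fun j _ ↦ hxM0 k i j)
        (Finset.mem_univ k)
    linarith
  set d : ℕ := h.natDegree + ∑ k, ∑ i, ∑ j, (M k i j).natDegree with hd
  have hdM (k : Fin 3) (i j : Fin n) : (M k i j).natDegree ≤ d := by
    have h1 : (M k i j).natDegree ≤ ∑ j, (M k i j).natDegree :=
      Finset.single_le_sum (f := fun j ↦ (M k i j).natDegree) (fun _ _ ↦ Nat.zero_le _)
        (Finset.mem_univ j)
    have h2 : ∑ j, (M k i j).natDegree ≤ ∑ i, ∑ j, (M k i j).natDegree :=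
      Finset.single_le_sum (f := fun i ↦ ∑ j, (M k i j).natDegree) (fun _ _ ↦ Nat.zero_le _)
        (Finset.mem_univ i)
    have h3 : ∑ i, ∑ j, (M k i j).natDegree ≤ ∑ k, ∑ i, ∑ j, (M k i j).natDegree :=
      Finset.single_le_sum (f := fun k ↦ ∑ i, ∑ j, (M k i j).natDegree)
        (fun _ _ ↦ Nat.zero_le _) (Finset.mem_univ k)
    omega
  have hn0 : 0 < n := Module.finrank_pos
  let i₀ : Fin n := ⟨0, hn0⟩
  set v : Fin n → ℂ := fun i ↦ σ (b i) with hv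
  have hv0 : 0 < ‖v i₀‖ := by
    rw [norm_pos_iff, hv]
    exact (map_ne_zero σ).mpr (b.ne_zero i₀)
  refine ⟨n, d, x, (∑ j, ‖v j‖) / ‖v i₀‖, hx1, by positivity, fun B D hBD hB0 ↦ ?_⟩
  set N := homogenizedEval h M D B with hN
  have hNφ : N.map φ = φ h ^ D • Algebra.leftMulMatrix b (MvPolynomial.aeval w B) := by
    rw [hN, map_homogenizedEval]
    simp only [hMφ]
    exact homogenizedEval_leftMulMatrix b w (φ h) hBD
  have hentry (z : ℂ) (hz : ‖z‖ ≤ R) (i j : Fin n) :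
      ‖N.map (aeval z : ℤ[X] →ₐ[ℤ] ℂ) i j‖ ≤ (1 + mvLength B) * x ^ D := by
    have h1 : N.map (aeval z : ℤ[X] →ₐ[ℤ] ℂ) = homogenizedEval (aeval z h)
        (fun k ↦ (M k).map (aeval z : ℤ[X] →ₐ[ℤ] ℂ)) D B :=
      map_homogenizedEval (aeval z : ℤ[X] →ₐ[ℤ] ℂ).toRingHom h M D B
    rw [h1]
    refine (norm_homogenizedEval_le hBD (by linarith) ((hxh z hz).trans hxh')
      (fun k i ↦ ?_) i j).trans ?_
    · exact (Finset.sum_le_sum fun j _ ↦ hxM k i j z hz).trans (hxM' k i)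
    · gcongr
      linarith
  have hα : 1 ≤ (1 + mvLength B) * x ^ D :=
    one_le_mul_of_one_le_of_one_le (by linarith [mvLength_nonneg B]) (one_le_pow₀ hx1)
  have hdet (z : ℂ) : aeval z N.det = (N.map (aeval z : ℤ[X] →ₐ[ℤ] ℂ)).det :=
    (aeval z : ℤ[X] →ₐ[ℤ] ℂ).toRingHom.map_det N
  refine ⟨N.det, ?_, ?_, ?_, ?_⟩
  · have h1 : φ N.det = (N.map φ).det := φ.map_det N
    rw [h1, hNφ, Matrix.det_smul]
    refine mul_ne_zero (pow_ne_zero _ (pow_ne_zero _ hh0)) ?_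
    rw [← Algebra.norm_eq_matrix_det b]
    exact (Algebra.norm_ne_zero_iff_of_basis b).mpr hB0
  · exact natDegree_det_le_of_entries
      (natDegree_homogenizedEval_le hBD (by omega) hdM)
  · intro z hz
    rw [hdet]
    have := Matrix.det_le (abv := NormedField.toAbsoluteValue ℂ)
      (hentry z (hz.le.trans (le_max_left _ _)))
    simpa using! this
  · have hvec : Matrix.vecMul v (N.map (aeval θ : ℤ[X] →ₐ[ℤ] ℂ)) =
        (aeval θ h ^ D * σ (MvPolynomial.aeval w B)) • v := by
      ext i
      have h1 (j : Fin n) : (N.map (aeval θ : ℤ[X] →ₐ[ℤ] ℂ)) j i = aeval θ h ^ D *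
          σ (algebraMap F K (Algebra.leftMulMatrix b (MvPolynomial.aeval w B) j i)) := by
        have h2 : φ (N j i) = φ h ^ D * Algebra.leftMulMatrix b (MvPolynomial.aeval w B) j i :=
          congrFun (congrFun hNφ j) i
        rw [Matrix.map_apply, ← hσ, h2, map_mul, map_mul, map_pow, map_pow, hσ]
      have h3 : MvPolynomial.aeval w B * b i =
          ∑ j, Algebra.leftMulMatrix b (MvPolynomial.aeval w B) j i • b j := by
        conv_lhs => rw [← b.sum_repr (MvPolynomial.aeval w B * b i)]
        simp only [Algebra.leftMulMatrix_eq_repr_mul]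
      simp only [Matrix.vecMul, dotProduct, h1, Pi.smul_apply, smul_eq_mul, hv]
      rw [mul_assoc, ← map_mul, h3, map_sum, Finset.mul_sum]
      refine Finset.sum_congr rfl fun j _ ↦ ?_
      rw [Algebra.smul_def, map_mul]
      ring
    have h4 := norm_det_mul_le hα (hentry θ (le_max_right _ _)) hvec i₀
    rw [← hdet, norm_mul, norm_pow, ← le_div_iff₀ hv0] at h4
    refine h4.trans ?_
    have h5 : ‖aeval θ h‖ ≤ x := (hxh θ (le_max_right _ _)).trans hxh'
    exact pow_mul_mul_div_le (norm_nonneg _) h5 D (norm_nonneg _)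
      (Finset.sum_nonneg fun j _ ↦ norm_nonneg (v j)) (by positivity) hv0

end Elimination

section AlgebraicIndependence

open Polynomial

lemma exists_intPolynomial_eq_smul_map (r : ℚ[X]) :
    ∃ (b : ℤ) (p : ℤ[X]), b ≠ 0 ∧ p.map (algebraMap ℤ ℚ) = (b : ℚ) • r := by
  obtain ⟨b, hb0, hb⟩ := IsLocalization.integerNormalization_spec (nonZeroDivisors ℤ) r
  refine ⟨b, _, nonZeroDivisors.ne_zero hb0, hb.trans ?_⟩
  ext n
  simp

lemma exists_int_fraction_of_mem_adjoin {L : Type*} [Field L] [Algebra ℚ L] {θ x : L}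
    (hx : x ∈ IntermediateField.adjoin ℚ {θ}) :
    ∃ p q : ℤ[X], aeval θ q ≠ 0 ∧ x * aeval θ q = aeval θ p := by
  obtain ⟨r, s, rfl⟩ := (IntermediateField.mem_adjoin_simple_iff ℚ x).mp hx
  by_cases hs : aeval θ s = 0
  · exact ⟨0, 1, by simp, by simp [hs]⟩
  obtain ⟨b, p, hb, hp⟩ := exists_intPolynomial_eq_smul_map r
  obtain ⟨e, q, he, hq⟩ := exists_intPolynomial_eq_smul_map s
  have h1 : aeval θ p = (b : L) * aeval θ r := by
    rw [← aeval_map_algebraMap ℚ, hp, map_smul, Algebra.smul_def]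
    simp
  have h2 : aeval θ q = (e : L) * aeval θ s := by
    rw [← aeval_map_algebraMap ℚ, hq, map_smul, Algebra.smul_def]
    simp
  have := algebraRat.charZero L
  have hb' : (b : L) ≠ 0 := by exact_mod_cast hb
  have he' : (e : L) ≠ 0 := by exact_mod_cast he
  refine ⟨C e * p, C b * q, ?_, ?_⟩
  · simp [h2, hb', he', hs]
  · simp only [map_mul, aeval_C, h1, h2]
    simp only [algebraMap_int_eq, eq_intCast]
    field_simp

lemma pow_le_exp_mul {x : ℝ} (hx : 0 ≤ x) (C s : ℕ) :
    x ^ (C * s ^ 7) ≤ Real.exp (x * C * s ^ 7) := by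
  have h4 : x ≤ Real.exp x := by linarith [Real.add_one_le_exp x]
  calc x ^ (C * s ^ 7) ≤ Real.exp x ^ (C * s ^ 7) := by gcongr
    _ = Real.exp (x * C * s ^ 7) := by
      rw [← Real.exp_nat_mul]
      push_cast
      ring_nf

/-- Exponential bounds for the quantities attached to the norm polynomial. -/
lemma norm_bound_le_exp (n C : ℕ) {x : ℝ} (hx : 1 ≤ x) {s : ℕ} (hs : 1 ≤ s) {l : ℝ} (hl0 : 0 ≤ l)
    (hl : l ≤ Real.exp (C * s ^ 7)) :
    (n.factorial : ℝ) * ((1 + l) * x ^ (C * s ^ 7)) ^ n ≤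
      Real.exp ((n.factorial + n * (1 + C + x * C)) * s ^ 7) := by
  have hs' : (1 : ℝ) ≤ (s : ℝ) ^ 7 := one_le_pow₀ (by exact_mod_cast hs)
  have h1 : (n.factorial : ℝ) ≤ Real.exp (n.factorial * s ^ 7) :=
    (natCast_le_exp _).trans (Real.exp_le_exp.mpr (le_mul_of_one_le_right (by positivity) hs'))
  have h2 : 1 + l ≤ Real.exp ((1 + C) * s ^ 7) := by
    rw [add_mul, Real.exp_add, one_mul]
    have h3 : (2 : ℝ) ≤ Real.exp (s ^ 7) := by linarith [Real.add_one_le_exp ((s : ℝ) ^ 7)]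
    have h4 : 1 ≤ Real.exp (C * (s : ℝ) ^ 7) := Real.one_le_exp (by positivity)
    nlinarith
  have h3 : x ^ (C * s ^ 7) ≤ Real.exp (x * C * s ^ 7) :=
    pow_le_exp_mul (by linarith) C s
  calc (n.factorial : ℝ) * ((1 + l) * x ^ (C * s ^ 7)) ^ n
      ≤ Real.exp (n.factorial * s ^ 7) *
        (Real.exp ((1 + C) * s ^ 7) * Real.exp (x * C * s ^ 7)) ^ n := by gcongr
    _ = _ := by
      rw [← Real.exp_add, ← Real.exp_nat_mul, ← Real.exp_add]
      ring_nf

/-- Three numbers algebraic over the field generated by one transcendental number have no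
sequence of integer polynomials with very small nonzero values. -/
theorem not_exists_small_values {θ : ℂ} (hθ : Transcendental ℤ θ) {ω : Fin 3 → ℂ}
    (hω : ∀ i, IsAlgebraic (IntermediateField.adjoin ℚ {θ}) (ω i)) {C : ℕ} {c : ℝ} (hc : 0 < c)
    {s₀ : ℕ} (h : ∀ s ≥ s₀, ∃ B : MvPolynomial (Fin 3) ℤ, B.totalDegree ≤ C * s ^ 7 ∧
      mvLength B ≤ Real.exp (C * s ^ 7) ∧ MvPolynomial.aeval ω B ≠ 0 ∧
      ‖MvPolynomial.aeval ω B‖ ≤ Real.exp (-(c * s ^ 15))) : False := by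
  set F := IntermediateField.adjoin ℚ {θ} with hF
  set K := IntermediateField.adjoin F (Set.range ω) with hK
  have : FiniteDimensional F K :=
    IntermediateField.finiteDimensional_adjoin fun x hx ↦ by
      obtain ⟨i, rfl⟩ := hx
      exact (hω i).isIntegral
  let g : F := IntermediateField.AdjoinSimple.gen ℚ θ
  have hg (p : ℤ[X]) : ((aeval g p : F) : ℂ) = aeval θ p := by
    have := (aeval_algebraMap_apply ℂ g p).symm
    simpa using! this
  let w : Fin 3 → K := fun i ↦ ⟨ω i, IntermediateField.subset_adjoin F _ ⟨i, rfl⟩⟩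
  have hw (B : MvPolynomial (Fin 3) ℤ) :
      ((MvPolynomial.aeval w B : K) : ℂ) = MvPolynomial.aeval ω B :=
    (MvPolynomial.aeval_algebraMap_apply (B := ℂ) w B).symm
  obtain ⟨n, d, x, y, hx, hy, hE⟩ := exists_norm_polynomial (K := K)
    (aeval g : ℤ[X] →ₐ[ℤ] F).toRingHom (fun t ↦ by
      obtain ⟨p, q, hq, hpq⟩ := exists_int_fraction_of_mem_adjoin t.2
      refine ⟨p, q, fun h0 ↦ hq ?_, Subtype.ext ?_⟩
      · rw [← hg]
        exact congrArg Subtype.val h0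
      · rw [← hg, ← hg] at hpq
        exact hpq) (algebraMap K ℂ) (θ := θ) hg w
  set A : ℝ := n.factorial + n * (1 + C + x * C) with hA
  have hA0 : 0 ≤ A := by positivity
  set E : ℝ := x * C + y + A with hE'
  obtain ⟨s₁, hs₁⟩ := exists_nat_ge (2 * E / c)
  refine gelfond_criterion hθ (C := n * C * d + A + 1) (c := c / 2) (by positivity) (by positivity)
    (s₀ := s₀ + s₁ + 1) fun s hs ↦ ?_
  obtain ⟨B, hBD, hBl, hB0, hBs⟩ := h s (by omega)
  obtain ⟨p, hp0, hpd, hpl, hps⟩ := hE B (C * s ^ 7) hBD fun h0 ↦ hB0 (by rw [← hw, h0]; rfl)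
  have hs1 : 1 ≤ s := by omega
  have hs' : (1 : ℝ) ≤ (s : ℝ) ^ 7 := one_le_pow₀ (by exact_mod_cast hs1)
  have hL := norm_bound_le_exp n C hx hs1 (mvLength_nonneg B) hBl
  refine ⟨p, fun h0 ↦ hp0 (by rw [h0, map_zero]), ?_, ?_⟩
  · have h1 : Real.log (p.map (Int.castRingHom ℂ)).mahlerMeasure ≤ Real.log (Real.exp (A * s ^ 7)) :=
      mahlerMeasure_le_of_norm_eval_le (Real.one_le_exp (by positivity)) fun z hz ↦ by
        rw [eval_map]
        exact (hpl z hz).trans hL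
    rw [Real.log_exp] at h1
    have h2 : (p.natDegree : ℝ) ≤ n * (C * s ^ 7 * d) := by exact_mod_cast hpd
    rw [polySize]
    nlinarith
  · have h1 : x ^ (C * s ^ 7) ≤ Real.exp (x * C * s ^ 7) :=
      pow_le_exp_mul (by linarith) C s
    have h2 : y ≤ Real.exp (y * s ^ 7) := by
      have := Real.add_one_le_exp (y * s ^ 7)
      nlinarith
    have h3 : ‖algebraMap K ℂ (MvPolynomial.aeval w B)‖ ≤ Real.exp (-(c * s ^ 15)) := by
      have := hw B
      rw [← this] at hBs
      exact hBs
    have h5 : E * s ^ 7 ≤ c / 2 * s ^ 15 := by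
      have h6 : (s₁ : ℝ) ≤ s := by exact_mod_cast (by omega : s₁ ≤ s)
      have h7 : E ≤ c / 2 * s := by
        rw [div_le_iff₀ hc] at hs₁
        nlinarith
      have h8 : (s : ℝ) ≤ s ^ 8 := le_self_pow₀ (by exact_mod_cast hs1) (by norm_num)
      calc E * s ^ 7 ≤ c / 2 * s ^ 8 * s ^ 7 := by
            gcongr
            exact h7.trans (by gcongr)
        _ = _ := by ring
    refine hps.trans ?_
    have hl := mvLength_nonneg B
    calc _ ≤ Real.exp (-(c * s ^ 15)) * (Real.exp (x * C * s ^ 7) * Real.exp (y * s ^ 7) *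
          Real.exp (A * s ^ 7)) := by gcongr
      _ = Real.exp (-(c * s ^ 15) + E * s ^ 7) := by
        rw [← Real.exp_add, ← Real.exp_add, ← Real.exp_add, hE']
        ring_nf
      _ ≤ _ := by
        gcongr
        linarith

end AlgebraicIndependence

section CommonZeros

open Polynomial

/-- Two polynomials over a unique factorization domain, one irreducible and not dividing the other,
have no common zero under an embedding of the coefficients into a field. -/
lemma not_common_root_of_irreducible {R L : Type*} [CommRing R] [IsDomain R]
    [UniqueFactorizationMonoid R] [Field L] {f : R →+* L} (hf : Function.Injective f) {t : L}
    {p q : R[X]} (hp : Irreducible p) (hpq : ¬ p ∣ q) (hp0 : p.eval₂ f t = 0)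
    (hq0 : q.eval₂ f t = 0) : False := by
  classical
  have hdeg : p.natDegree ≠ 0 := fun h ↦ by
    rw [eq_C_of_natDegree_eq_zero h, eval₂_C] at hp0
    refine hp.ne_zero ?_
    rw [eq_C_of_natDegree_eq_zero h, (map_eq_zero_iff f hf).mp hp0, C_0]
  let _ : StrongNormalizationMonoid R := UniqueFactorizationMonoid.strongNormalizationMonoid
  let _ : NormalizedGCDMonoid R := UniqueFactorizationMonoid.toNormalizedGCDMonoid R
  set F := FractionRing R
  have hpF : Irreducible (p.map (algebraMap R F)) :=
    (hp.isPrimitive hdeg).irreducible_iff_irreducible_map_fraction_map.mp hp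
  have hndvd : ¬ p.map (algebraMap R F) ∣ q.map (algebraMap R F) := by
    rintro ⟨r, hr⟩
    obtain ⟨b, hb0, hb⟩ := IsLocalization.integerNormalization_spec (nonZeroDivisors R) r
    set r' := IsLocalization.integerNormalization (nonZeroDivisors R) r
    have h1 : C b * q = p * r' := by
      refine map_injective _ (IsFractionRing.injective R F) ?_
      rw [Polynomial.map_mul, Polynomial.map_mul, hr, hb, map_C, Algebra.smul_def,
        Polynomial.algebraMap_apply]
      ring
    rcases hp.prime.dvd_or_dvd ⟨r', h1⟩ with h2 | h2
    · refine hdeg (Nat.le_zero.mp ?_)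
      simpa using natDegree_le_of_dvd h2 (C_ne_zero.mpr (nonZeroDivisors.ne_zero hb0))
    · exact hpq h2
  obtain ⟨u, v, huv⟩ := (hpF.coprime_iff_not_dvd).mpr hndvd
  let g : F →+* L := IsFractionRing.lift hf
  have hg (s : R[X]) : (s.map (algebraMap R F)).eval₂ g t = s.eval₂ f t := by
    rw [eval₂_map]
    congr 1
    ext x
    exact IsFractionRing.lift_algebraMap hf x
  have h3 := congrArg (eval₂ g t) huv
  rw [eval₂_add, eval₂_mul, eval₂_mul, hg, hg, hp0, hq0, eval₂_one] at h3
  simp at h3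

lemma not_common_zero_of_irreducible {σ k L : Type*} [Field k] [Field L] [Algebra k L]
    {x : Option σ → L} (hx : AlgebraicIndependent k (x ∘ some)) {p q : MvPolynomial (Option σ) k}
    (hp : Irreducible p) (hpq : ¬ p ∣ q) (hp0 : MvPolynomial.aeval x p = 0)
    (hq0 : MvPolynomial.aeval x q = 0) : False := by
  set e := MvPolynomial.optionEquivLeft k σ
  have he (s : MvPolynomial (Option σ) k) : (e s).eval₂
      (MvPolynomial.aeval (x ∘ some) : MvPolynomial σ k →ₐ[k] L).toRingHom (x none) =
      MvPolynomial.aeval x s := by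
    induction s using MvPolynomial.induction_on with
    | C r => simp [e]
    | add p q hp hq => simp only [map_add, eval₂_add, hp, hq]
    | mul_X p i hp =>
      rw [map_mul, eval₂_mul, hp, map_mul]
      cases i <;> simp [e]
  refine not_common_root_of_irreducible (p := e p) (q := e q) hx ?_ ?_
    ((he p).trans hp0) ((he q).trans hq0)
  · exact (MulEquiv.irreducible_iff e).mpr hp
  · exact fun h ↦ hpq ((map_dvd_iff e).mp h)

lemma algebraicIndependent_pair {x y : ℂ} (hx : Transcendental ℚ x)
    (hy : Transcendental (IntermediateField.adjoin ℚ {x}) y) :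
    AlgebraicIndependent ℚ fun o : Option Unit ↦ o.elim y fun _ ↦ x := by
  have h1 : AlgebraicIndependent ℚ fun _ : Unit ↦ x :=
    algebraicIndependent_unique_type_iff.mpr hx
  refine (h1.option_iff_transcendental y).mpr ?_
  refine Transcendental.of_tower_top_of_subalgebra_le
    (B := (IntermediateField.adjoin ℚ {x}).toSubalgebra) ?_ hy
  rw [Set.range_const]
  exact IntermediateField.algebra_adjoin_le_adjoin ℚ {x}

/-- Among the values of `E₂`, `E₄`, `E₆` at any point two are algebraically independent. -/
theorem exists_algebraicIndependent_eisVec {a : ℂ} (ha : 0 < a.im) :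
    ∃ i j, Transcendental ℚ (eisVec a i) ∧
      Transcendental (IntermediateField.adjoin ℚ {eisVec a i}) (eisVec a j) := by
  by_contra! hcon
  obtain ⟨C, c, hc, s₀, h⟩ := exists_small_values ha
  by_cases hi : ∃ i, Transcendental ℚ (eisVec a i)
  · obtain ⟨i, hi⟩ := hi
    exact not_exists_small_values (hi.restrictScalars (algebraMap ℤ ℚ).injective_int)
      (fun j ↦ not_not.mp (hcon i j hi)) hc h
  · push Not at hi
    have hθ : Transcendental ℤ ((liouvilleNumber 2 : ℝ) : ℂ) :=
      (transcendental_algebraMap_iff (R := ℤ) (S := ℝ) (A := ℂ)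
        (algebraMap ℝ ℂ).injective).mpr (transcendental_liouvilleNumber (m := 2) le_rfl)
    exact not_exists_small_values hθ (fun j ↦ (not_not.mp (hi j)).tower_top _) hc h

/-- An irreducible polynomial over `Q̄` vanishing at `(E₂(a), E₄(a), E₆(a))` divides every
polynomial vanishing there. -/
theorem dvd_of_eval_eisVec_eq_zero {k : Type*} [Field k] [Algebra ℚ k] [Algebra.IsAlgebraic ℚ k]
    (ι : k →+* ℂ) {p q : MvPolynomial (Fin 3) k} (hp : Irreducible p) {a : ℂ} (ha : 0 < a.im)
    (hp0 : MvPolynomial.eval (eisVec a) (p.map ι) = 0)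
    (hq0 : MvPolynomial.eval (eisVec a) (q.map ι) = 0) : p ∣ q := by
  by_contra hpq
  let _ : Algebra k ℂ := ι.toAlgebra
  obtain ⟨i, j, hi, hj⟩ := exists_algebraicIndependent_eisVec ha
  have hij : i ≠ j := by
    rintro rfl
    exact hj (isAlgebraic_algebraMap (IntermediateField.AdjoinSimple.gen ℚ (eisVec a i)))
  obtain ⟨l, hl⟩ : ∃ l : Fin 3, l ≠ i ∧ l ≠ j :=
    (by decide : ∀ i j : Fin 3, ∃ l, l ≠ i ∧ l ≠ j) i j
  let g : Option (Option Unit) → Fin 3 := fun o ↦ o.elim l fun o ↦ o.elim j fun _ ↦ i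
  have hg : Function.Injective g := by
    rintro (_ | _ | _) (_ | _ | _) h <;> simp_all [g]
  have hg' : Function.Bijective g :=
    (Fintype.bijective_iff_injective_and_card g).mpr ⟨hg, by simp⟩
  let e := Equiv.ofBijective g hg'
  have hx : AlgebraicIndependent k ((eisVec a ∘ e) ∘ some) := by
    have h1 := (algebraicIndependent_pair hi hj).extendScalars k
    convert! h1 using 1
    ext o
    cases o <;> rfl
  let r := MvPolynomial.renameEquiv k e.symm
  have hr (s : MvPolynomial (Fin 3) k) (hs : MvPolynomial.eval (eisVec a) (s.map ι) = 0) :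
      MvPolynomial.aeval (eisVec a ∘ e) (r s) = 0 := by
    rw [MvPolynomial.renameEquiv_apply, MvPolynomial.aeval_rename, Function.comp_assoc,
      Equiv.self_comp_symm, Function.comp_id, MvPolynomial.aeval_def]
    rwa [MvPolynomial.eval_map] at hs
  exact not_common_zero_of_irreducible hx (p := r p) (q := r q)
    ((MulEquiv.irreducible_iff r).mpr hp) (fun h ↦ hpq ((map_dvd_iff r).mp h)) (hr p hp0) (hr q hq0)

end CommonZeros

section SimpleZeros

lemma ramanujanDeriv_iterate_dvd {R : Type*} [CommRing R] {p : MvPolynomial (Fin 3) R}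
    (h : p ∣ ramanujanDeriv R p) (k : ℕ) : p ∣ (ramanujanDeriv R)^[k] p := by
  induction k with
  | zero => exact dvd_rfl
  | succ k ih =>
    obtain ⟨g, hg⟩ := ih
    rw [Function.iterate_succ_apply', hg, Derivation.leibniz, smul_eq_mul, smul_eq_mul]
    exact dvd_add (dvd_mul_right _ _) (h.mul_left _)

/-- A polynomial dividing its derivative and vanishing at one point of the curve is zero. -/
lemma eq_zero_of_dvd_ramanujanDeriv {p : MvPolynomial (Fin 3) ℂ} (h : p ∣ ramanujanDeriv ℂ p)
    {a : ℂ} (ha : 0 < a.im) (hp0 : MvPolynomial.eval (eisVec a) p = 0) : p = 0 := by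
  set f : ℂ → ℂ := fun z ↦ MvPolynomial.eval (eisVec z) p with hf
  have hfd : DifferentiableOn ℂ f {z : ℂ | 0 < z.im} := fun z hz ↦
    (hasDerivAt_eval_eisVec p hz).differentiableAt.differentiableWithinAt
  have hopen : IsOpen {z : ℂ | 0 < z.im} := isOpen_lt continuous_const continuous_im
  have hfa := hfd.analyticOnNhd hopen
  have htop : analyticOrderAt f a = ⊤ := by
    by_contra hne
    obtain ⟨n, hn⟩ := ENat.ne_top_iff_exists.mp hne
    refine ((analyticOrderAt_eq_nat_iff_iteratedDeriv_eq_zero (hfa a ha)).mp hn.symm).2 ?_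
    obtain ⟨g, hg⟩ := ramanujanDeriv_iterate_dvd h n
    rw [hf, iteratedDeriv_eval_eisVec p n ha, hg, map_mul, hp0, zero_mul, mul_zero]
  exact eq_zero_of_eval_eisVec (hfa.eqOn_zero_of_preconnected_of_eventuallyEq_zero
    (convex_halfSpace_im_gt 0).isPreconnected ha (analyticOrderAt_eq_top.mp htop))

lemma exists_irreducible_factor_eval_eq_zero {k : Type*} [Field k] (ι : k →+* ℂ) (x : Fin 3 → ℂ)
    {P : MvPolynomial (Fin 3) k} (hP : P ≠ 0) (h0 : MvPolynomial.eval x (P.map ι) = 0) :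
    ∃ p, Irreducible p ∧ p ∣ P ∧ MvPolynomial.eval x (p.map ι) = 0 := by
  induction P using UniqueFactorizationMonoid.induction_on_prime with
  | h₁ => exact absurd rfl hP
  | h₂ u hu =>
    have h1 := (hu.map (MvPolynomial.map ι)).map (MvPolynomial.eval x)
    rw [h0] at h1
    exact absurd rfl h1.ne_zero
  | h₃ q p hq hp ih =>
    rw [map_mul, map_mul, mul_eq_zero] at h0
    rcases h0 with h0 | h0
    · exact ⟨p, hp.irreducible, dvd_mul_right _ _, h0⟩
    · obtain ⟨r, hr, hrq, hr0⟩ := ih hq h0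
      exact ⟨r, hr, hrq.mul_left _, hr0⟩

end SimpleZeros

/- Here `AlgebraicClosure ℚ` plays the role of the field `Q̄` of algebraic numbers; any
ring homomorphism `ι : AlgebraicClosure ℚ →+* ℂ` identifies it with the algebraic
closure of `ℚ` inside `ℂ`. -/
theorem stmt13 (ι : AlgebraicClosure ℚ →+* ℂ)
    (P : MvPolynomial (Fin 3) (AlgebraicClosure ℚ))
    (hP0 : P ≠ 0) (hP : Squarefree P)
    (a : ℂ) (ha : 0 < a.im) (hzero : psi (P.map ι) a = 0) :
    deriv (psi (P.map ι)) a ≠ 0 := by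
  have : Algebra.IsAlgebraic ℚ (AlgebraicClosure ℚ) := by
    convert! AlgebraicClosure.isAlgebraic ℚ
  intro hd
  have hder : MvPolynomial.eval (eisVec a) ((ramanujanDeriv _ P).map ι) = 0 := by
    have h1 := (hasDerivAt_eval_eisVec (P.map ι) ha).deriv.symm.trans hd
    rw [← map_ramanujanDeriv] at h1
    exact (mul_eq_zero.mp h1).resolve_left (by simp [Real.pi_ne_zero])
  obtain ⟨p, hp, ⟨Q, rfl⟩, hp0⟩ := exists_irreducible_factor_eval_eq_zero ι (eisVec a) hP0 hzero
  have hpQ : ¬ p ∣ Q := fun h ↦ hp.not_isUnit (hP p (mul_dvd_mul_left p h))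
  rw [Derivation.leibniz, smul_eq_mul, smul_eq_mul, map_add, map_mul, map_mul, map_add, map_mul,
    map_mul, hp0, zero_mul, zero_add, mul_eq_zero] at hder
  rcases hder with h0 | h0
  · exact hpQ (dvd_of_eval_eisVec_eq_zero ι hp ha hp0 h0)
  · have h1 := map_dvd (MvPolynomial.map ι) (dvd_of_eval_eisVec_eq_zero ι hp ha hp0 h0)
    rw [map_ramanujanDeriv] at h1
    exact hp.ne_zero (MvPolynomial.map_injective ι ι.injective
      ((eq_zero_of_dvd_ramanujanDeriv h1 ha hp0).trans (map_zero _).symm))
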